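/- arXiv:1512.04621 — 2 statements merged into one kernel-verified Lean document; each statement's English description precedes it below -/
import Mathlib

section
/- Let 1 < p < n, q = p/(p-1), and let C be even, convex, q-homogeneous and positive away from 0. For the function w_0(t,x) = C((t,x) + e_1)^{-(n-p)/(q(p-1))} on ℝ^n_+ (where e_1 = (1,0,…,0)), the ratio (∫_{∂ℝ^n_+} |w_0(0,x)|^{p(n-1)/(n-p)} dx)^{(n-p)/(n-1)} / ∫_{ℝ^n_+} C^*(∇w_0) dx dt equals p^p (n-p)^{-p/q} (q(n-1))^{-p/(q(n-1))} (∫_{(K_C)_+} y_1^{qn-q-n} dy)^{-p/(q(n-1))}; consequently the best constant 𝒦_{n,C} in the anisotropic trace inequality is given by this formula. -/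
open MeasureTheory Real Set
open scoped RealInnerProductSpace ENNReal NNReal Pointwise

noncomputable section

namespace AffineTrace

/-- `ω s = π^(s/2) / Γ(s/2 + 1)` -/
def w (s : ℝ) : ℝ := Real.pi ^ (s / 2) / Real.Gamma (s / 2 + 1)

/-- the constant `c_{m,p} = (m ω_m)^{1/m} (m ω_m ω_{p-1} / (2 ω_{m+p-2}))^{1/p}` -/
def cc (m : ℕ) (p : ℝ) : ℝ :=
  ((m : ℝ) * w m) ^ ((m : ℝ)⁻¹) *
    ((m : ℝ) * w m * w (p - 1) / (2 * w ((m : ℝ) + p - 2))) ^ p⁻¹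

/-- the constant `a_{m,p} = ω_{m+p} / (ω_2 ω_m ω_{p-1})` -/
def aa (m : ℕ) (p : ℝ) : ℝ := w ((m : ℝ) + p) / (w 2 * w m * w (p - 1))

/-- the open half-space `ℝⁿ₊ = (0,∞) × ℝ^{n-1}` -/
def H (n : ℕ) : Set (ℝ × EuclideanSpace ℝ (Fin (n - 1))) := {y | 0 < y.1}

/-- `∂f/∂t`, the partial derivative in the `t`-variable -/
def dt {n : ℕ} (f : ℝ × EuclideanSpace ℝ (Fin (n - 1)) → ℝ)
    (y : ℝ × EuclideanSpace ℝ (Fin (n - 1))) : ℝ :=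
  fderiv ℝ f y (1, 0)

/-- `∇_ξ f = ∇̃f ⬝ ξ`, the directional derivative in the direction `(0, ξ)` -/
def dxi {n : ℕ} (f : ℝ × EuclideanSpace ℝ (Fin (n - 1)) → ℝ)
    (ξ : EuclideanSpace ℝ (Fin (n - 1))) (y : ℝ × EuclideanSpace ℝ (Fin (n - 1))) : ℝ :=
  fderiv ℝ f y (0, ξ)

/-- `∇̃f`, the gradient in the `x`-variable -/
def gradx {n : ℕ} (f : ℝ × EuclideanSpace ℝ (Fin (n - 1)) → ℝ)
    (y : ℝ × EuclideanSpace ℝ (Fin (n - 1))) : EuclideanSpace ℝ (Fin (n - 1)) :=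
  gradient (fun x => f (y.1, x)) y.2

/-- the `L^p` norm (w.r.t. Lebesgue measure) over the half-space `ℝⁿ₊` -/
def lp (n : ℕ) (p : ℝ) (g : ℝ × EuclideanSpace ℝ (Fin (n - 1)) → ℝ) : ℝ :=
  (∫ y in H n, |g y| ^ p) ^ p⁻¹

/-- the surface measure on the unit sphere `𝕊^{m-1}` of `ℝ^m` -/
def sphMeasure (m : ℕ) : Measure (Metric.sphere (0 : EuclideanSpace ℝ (Fin m)) 1) :=
  (volume : Measure (EuclideanSpace ℝ (Fin m))).toSphere

/-- `Z_p(f) = (∫_{𝕊^{n-2}} ‖∇_ξ f‖_p^{1-n} dξ)^{1/(1-n)}` -/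
def Z (n : ℕ) (p : ℝ) (f : ℝ × EuclideanSpace ℝ (Fin (n - 1)) → ℝ) : ℝ :=
  (∫ ξ, lp n p (dxi f (ξ : EuclideanSpace ℝ (Fin (n - 1)))) ^ (1 - (n : ℝ))
      ∂(sphMeasure (n - 1))) ^ (1 - (n : ℝ))⁻¹

/-- the affine energy `ℰ_p(f) = c_{n-1,p} Z_p(f)` -/
def Ep (n : ℕ) (p : ℝ) (f : ℝ × EuclideanSpace ℝ (Fin (n - 1)) → ℝ) : ℝ :=
  cc (n - 1) p * Z n p f

/-- the boundary trace integral `∫_{∂ℝⁿ₊} |f(0,x)|^r dx` -/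
def bdry (n : ℕ) (r : ℝ) (f : ℝ × EuclideanSpace ℝ (Fin (n - 1)) → ℝ) : ℝ :=
  ∫ x : EuclideanSpace ℝ (Fin (n - 1)), |f (0, x)| ^ r

/-- the duality pairing on `ℝ × ℝ^m` -/
def pairP {m : ℕ} (y z : ℝ × EuclideanSpace ℝ (Fin m)) : ℝ := y.1 * z.1 + ⟪y.2, z.2⟫

/-- the Legendre transform of a function on `ℝ × ℝ^m` -/
def legendreP {m : ℕ} (C : ℝ × EuclideanSpace ℝ (Fin m) → ℝ)
    (y : ℝ × EuclideanSpace ℝ (Fin m)) : ℝ :=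
  ⨆ z, (pairP y z - C z)

/-- the Legendre transform of a function on `ℝ^m` -/
def legendreE {m : ℕ} (C : EuclideanSpace ℝ (Fin m) → ℝ) (y : EuclideanSpace ℝ (Fin m)) : ℝ :=
  ⨆ z, (⟪y, z⟫ - C z)

/-- the `m`-dimensional volume of a subset of `ℝ^m`, as a real number -/
def vol {m : ℕ} (K : Set (EuclideanSpace ℝ (Fin m))) : ℝ := (volume K).toReal

/-- the support function of a subset of `ℝ^m` -/
def suppFn {m : ℕ} (K : Set (EuclideanSpace ℝ (Fin m))) (y : EuclideanSpace ℝ (Fin m)) : ℝ :=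
  sSup ((fun z => ⟪y, z⟫) '' K)

/-- the polar body of a subset of `ℝ^m` -/
def polar {m : ℕ} (K : Set (EuclideanSpace ℝ (Fin m))) : Set (EuclideanSpace ℝ (Fin m)) :=
  {y | ∀ z ∈ K, ⟪y, z⟫ ≤ 1}

/-- the `L_p`-centroid body `Γ_p K` of a convex body `K ⊂ ℝ^m`: the convex body whose
support function is `h(y) = ((a_{m,p} vol K)⁻¹ ∫_K |⟨y,z⟩|^p dz)^{1/p}` -/
def centroid (m : ℕ) (p : ℝ) (K : Set (EuclideanSpace ℝ (Fin m))) :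
    Set (EuclideanSpace ℝ (Fin m)) :=
  {x | ∀ y, ⟪x, y⟫ ≤ ((aa m p * vol K)⁻¹ * ∫ z in K, |⟪y, z⟫| ^ p) ^ p⁻¹}

/-- the convex body `L_f = {ξ : ‖∇_ξ f‖_p ≤ 1}` in `ℝ^{n-1}` -/
def Lbody (n : ℕ) (p : ℝ) (f : ℝ × EuclideanSpace ℝ (Fin (n - 1)) → ℝ) :
    Set (EuclideanSpace ℝ (Fin (n - 1))) :=
  {ξ | lp n p (dxi f ξ) ≤ 1}

/-- the constant `α_f = (p/(p-1)) ‖∂f/∂t‖_p^{-p} Z_p(f)^{1-n}` -/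
def alpha (n : ℕ) (p : ℝ) (f : ℝ × EuclideanSpace ℝ (Fin (n - 1)) → ℝ) : ℝ :=
  p / (p - 1) * lp n p (dt f) ^ (-p) * Z n p f ^ (1 - (n : ℝ))

/-- `D_f^*(x) = ∫_{𝕊^{n-2}} ‖∇_ξ f‖_p^{1-n-p} |⟨x,ξ⟩|^p dξ` -/
def Dstar (n : ℕ) (p : ℝ) (f : ℝ × EuclideanSpace ℝ (Fin (n - 1)) → ℝ)
    (x : EuclideanSpace ℝ (Fin (n - 1))) : ℝ :=
  ∫ ξ, lp n p (dxi f (ξ : EuclideanSpace ℝ (Fin (n - 1)))) ^ (1 - (n : ℝ) - p) *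
      |⟪x, (ξ : EuclideanSpace ℝ (Fin (n - 1)))⟫| ^ p ∂(sphMeasure (n - 1))

/-- `C_f^*(t,x) = (α_f/p)|t|^p + D_f^*(x)` -/
def Cstar (n : ℕ) (p : ℝ) (f : ℝ × EuclideanSpace ℝ (Fin (n - 1)) → ℝ)
    (y : ℝ × EuclideanSpace ℝ (Fin (n - 1))) : ℝ :=
  alpha n p f / p * |y.1| ^ p + Dstar n p f y.2

/-- `C_f`, the Legendre transform of `C_f^*` -/
def Cf (n : ℕ) (p : ℝ) (f : ℝ × EuclideanSpace ℝ (Fin (n - 1)) → ℝ) :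
    ℝ × EuclideanSpace ℝ (Fin (n - 1)) → ℝ :=
  legendreP (Cstar n p f)

/-- the convex body `K_f = {y : C_f(y) ≤ 1}` in `ℝⁿ` -/
def Kf (n : ℕ) (p : ℝ) (f : ℝ × EuclideanSpace ℝ (Fin (n - 1)) → ℝ) :
    Set (ℝ × EuclideanSpace ℝ (Fin (n - 1))) :=
  {y | Cf n p f y ≤ 1}

/-- the slice `K_{f,t} = {x : (t,x) ∈ K_f}` -/
def slice (n : ℕ) (p : ℝ) (f : ℝ × EuclideanSpace ℝ (Fin (n - 1)) → ℝ) (t : ℝ) :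
    Set (EuclideanSpace ℝ (Fin (n - 1))) :=
  {x | (t, x) ∈ Kf n p f}

/-- the sharp constant `𝒦_n` of the `L²` Sobolev trace inequality -/
def Kn (n : ℕ) : ℝ :=
  1 / (Real.sqrt Real.pi * ((n : ℝ) - 2)) *
    (Real.Gamma n / (((n : ℝ) - 1) * Real.Gamma (((n : ℝ) - 1) / 2))) ^ (((n : ℝ) - 1)⁻¹)

/-- the sharp constant `𝒜_{n,p}` of the affine `L^p` Sobolev trace inequality -/
def A (n : ℕ) (p : ℝ) : ℝ :=
  Real.pi ^ (-(p - 1) / 2) * ((p - 1) ^ ((p - 1) / p) / ((n : ℝ) - p)) ^ (p - 1) *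
    (Real.Gamma n * Real.Gamma (((n : ℝ) + 1) / 2) /
      (((n : ℝ) - 1) * Real.Gamma (((n : ℝ) - 1) / p) *
        Real.Gamma (((n : ℝ) * (p - 1) + 1) / p))) ^ ((p - 1) / ((n : ℝ) - 1))

/-- A family of one-dimensional monotone rearrangements depending continuously on a parameter. -/
theorem exists_monotone_rearrangement {X : Type*} [TopologicalSpace X] (P Q : X → ℝ → ℝ)
    (hP : Continuous (Function.uncurry P)) (hQ : Continuous (Function.uncurry Q))
    {l : ℝ} (hl : 0 < l) (hlQ : ∀ x y, l ≤ Q x y) (a c : ℝ) :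
    ∃ τ : X → ℝ → ℝ, Continuous (Function.uncurry τ) ∧
      (∀ x s, HasDerivAt (τ x) (P x s / Q x (τ x s)) s) ∧
      ∀ x b d, ∫ s in a..b, P x s = ∫ y in c..d, Q x y → τ x b = d := by
  have hPx : ∀ x, Continuous (P x) := fun x => hP.comp (Continuous.prodMk_right x)
  have hQx : ∀ x, Continuous (Q x) := fun x => hQ.comp (Continuous.prodMk_right x)
  have hder : ∀ x y, HasDerivAt (fun y => ∫ t in c..y, Q x t) (Q x y) y := fun x y =>
    (hQx x).integral_hasStrictDerivAt c y |>.hasDerivAt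
  have hmono : ∀ x, StrictMono (fun y => ∫ t in c..y, Q x t) := fun x => by
    apply strictMono_of_deriv_pos
    intro y
    rw [(hder x y).deriv]
    exact hl.trans_le (hlQ x y)
  have hcont : ∀ x, Continuous (fun y => ∫ t in c..y, Q x t) := fun x =>
    continuous_iff_continuousAt.2 fun y => (hder x y).continuousAt
  have hge : ∀ x y, c ≤ y → l * (y - c) ≤ ∫ t in c..y, Q x t := fun x y hy => by
    have := intervalIntegral.integral_mono_on (f := fun _ => l) (g := Q x) (μ := volume) hy
      intervalIntegrable_const ((hQx x).intervalIntegrable _ _) (fun t _ => hlQ x t)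
    simpa [mul_comm] using this
  have hle : ∀ x y, y ≤ c → ∫ t in c..y, Q x t ≤ l * (y - c) := fun x y hy => by
    have := intervalIntegral.integral_mono_on (f := fun _ => l) (g := Q x) (μ := volume) hy
      intervalIntegrable_const ((hQx x).intervalIntegrable _ _) (fun t _ => hlQ x t)
    rw [intervalIntegral.integral_symm]
    simp only [intervalIntegral.integral_const, smul_eq_mul] at this
    linarith
  have hsurj : ∀ x, Function.Surjective (fun y => ∫ t in c..y, Q x t) := fun x => by
    intro v
    have h1 : (c - |v| / l) ≤ (c + |v| / l) := by
      have : 0 ≤ |v| / l := by positivity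
      linarith
    have h2 := hge x (c + |v| / l) (by have : 0 ≤ |v| / l := by positivity
                                       linarith)
    have h3 := hle x (c - |v| / l) (by have : 0 ≤ |v| / l := by positivity
                                       linarith)
    have h4 : l * (c + |v| / l - c) = |v| := by field_simp; ring
    have h5 : l * (c - |v| / l - c) = -|v| := by field_simp; ring
    obtain ⟨y, -, hy⟩ := intermediate_value_Icc h1 (hcont x).continuousOn
      (show v ∈ _ from ⟨by linarith [neg_abs_le v], by linarith [le_abs_self v]⟩)
    exact ⟨y, hy⟩
  choose τ hτ using fun x s => hsurj x (∫ t in a..s, P x t)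
  simp only at hτ
  have hτc : Continuous (Function.uncurry τ) := by
    have hA : Continuous fun p : X × ℝ => ∫ t in a..p.2, P p.1 t :=
      intervalIntegral.continuous_parametric_primitive_of_continuous hP
    have hB : ∀ y, Continuous fun p : X × ℝ => ∫ t in c..y, Q p.1 t := fun y =>
      (intervalIntegral.continuous_parametric_primitive_of_continuous hQ).comp
        (continuous_fst.prodMk (continuous_const (y := y)))
    rw [OrderTopology.continuous_iff]
    intro y
    constructor
    · have : Function.uncurry τ ⁻¹' Ioi y =
          {p : X × ℝ | ∫ t in c..y, Q p.1 t < ∫ t in a..p.2, P p.1 t} := by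
        ext p
        simp only [mem_preimage, mem_Ioi, mem_ofPred_eq, Function.uncurry]
        rw [← hτ, (hmono p.1).lt_iff_lt]
      rw [this]
      exact isOpen_lt (hB y) hA
    · have : Function.uncurry τ ⁻¹' Iio y =
          {p : X × ℝ | ∫ t in a..p.2, P p.1 t < ∫ t in c..y, Q p.1 t} := by
        ext p
        simp only [mem_preimage, mem_Iio, mem_ofPred_eq, Function.uncurry]
        rw [← hτ, (hmono p.1).lt_iff_lt]
      rw [this]
      exact isOpen_lt hA (hB y)
  refine ⟨τ, hτc, fun x s => ?_, fun x b d h => (hmono x).injective (by rw [hτ, h])⟩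
  have hτx : Continuous (τ x) := hτc.comp (Continuous.prodMk_right x)
  set e := (hmono x).orderIsoOfSurjective _ (hsurj x) with he
  have h1 : HasDerivAt e.symm (Q x (e.symm (∫ t in a..s, P x t)))⁻¹ (∫ t in a..s, P x t) := by
    apply HasDerivAt.of_local_left_inverse (f := fun y => ∫ t in c..y, Q x t)
    · exact e.symm.continuous.continuousAt
    · exact hder x _
    · exact (hl.trans_le (hlQ _ _)).ne'
    · exact Filter.Eventually.of_forall fun v => e.apply_symm_apply v
  have h2 : HasDerivAt (fun s => ∫ t in a..s, P x t) (P x s) s :=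
    ((hPx x).integral_hasStrictDerivAt a s).hasDerivAt
  have h3 : ∀ s, τ x s = e.symm (∫ t in a..s, P x t) := fun s => by
    rw [OrderIso.eq_symm_apply]
    exact hτ x s
  have h4 := HasDerivAt.comp s h1 h2
  rw [← h3] at h4
  have h5 : τ x = (e.symm : ℝ → ℝ) ∘ fun s => ∫ t in a..s, P x t := funext h3
  rw [div_eq_inv_mul]
  nth_rewrite 1 [h5]
  exact h4

/-- Lebesgue measure restricted to the box `∏ (a i, b i]`. -/
def boxMeas {N : ℕ} (a b : Fin N → ℝ) : Measure (Fin N → ℝ) :=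
  Measure.pi fun i => volume.restrict (Ioc (a i) (b i))

instance {N : ℕ} (a b : Fin N → ℝ) : IsFiniteMeasure (boxMeas a b) := by
  unfold boxMeas; infer_instance

theorem boxMeas_eq {N : ℕ} (a b : Fin N → ℝ) :
    boxMeas a b = volume.restrict (univ.pi fun i => Ioc (a i) (b i)) := by
  rw [boxMeas, ← Measure.restrict_pi_pi]; rfl

theorem ae_boxMeas_mem_Icc {N : ℕ} (a b : Fin N → ℝ) : ∀ᵐ x ∂boxMeas a b, x ∈ Icc a b := by
  rw [boxMeas_eq]
  filter_upwards [ae_restrict_mem (MeasurableSet.univ_pi fun i => measurableSet_Ioc)] with x hx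
  exact ⟨fun i => (hx i trivial).1.le, fun i => (hx i trivial).2⟩

theorem integrable_boxMeas {N : ℕ} (a b : Fin N → ℝ) {F : (Fin N → ℝ) → ℝ} (hF : Continuous F) :
    Integrable F (boxMeas a b) := by
  rw [boxMeas_eq]
  refine (hF.continuousOn.integrableOn_compact (isCompact_Icc (a := a) (b := b))).mono_set ?_
  intro x hx
  exact ⟨fun i => (hx i trivial).1.le, fun i => (hx i trivial).2⟩

theorem integral_boxMeas_insertNth {N : ℕ} (a b : Fin (N + 1) → ℝ) (hab : ∀ i, a i < b i)
    {F : (Fin (N + 1) → ℝ) → ℝ} (hF : Continuous F) (i : Fin (N + 1)) :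
    ∫ x, F x ∂boxMeas a b =
      ∫ x', (∫ s in (a i)..(b i), F (i.insertNth s x'))
        ∂boxMeas (fun j => a (i.succAbove j)) (fun j => b (i.succAbove j)) := by
  have hmp := (measurePreserving_piFinSuccAbove
    (fun i => (volume : Measure ℝ).restrict (Ioc (a i) (b i))) i).symm
  have hprod_int := hmp.integrable_comp_emb (MeasurableEquiv.measurableEmbedding _) |>.2
    (integrable_boxMeas a b hF)
  have := hmp.integral_comp' (g := F)
  rw [boxMeas, ← this]
  refine (integral_prod_symm _ hprod_int).trans ?_
  refine integral_congr_ae (Filter.Eventually.of_forall fun x' => ?_)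
  simp only
  rw [intervalIntegral.integral_of_le (hab i).le]
  rfl

theorem integral_boxMeas_cons {N : ℕ} (a b : Fin (N + 1) → ℝ) (hab : ∀ i, a i < b i)
    {F : (Fin (N + 1) → ℝ) → ℝ} (hF : Continuous F) :
    ∫ x, F x ∂boxMeas a b =
      ∫ x', (∫ s in (a 0)..(b 0), F (Fin.cons s x')) ∂boxMeas (Fin.tail a) (Fin.tail b) := by
  rw [integral_boxMeas_insertNth a b hab hF 0]
  simp only [Fin.insertNth_zero', Fin.succAbove_zero]
  rfl

theorem continuous_cons {N : ℕ} :
    Continuous fun p : (Fin N → ℝ) × ℝ => (Fin.cons p.2 p.1 : Fin (N + 1) → ℝ) := by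
  refine continuous_pi fun i => ?_
  refine Fin.cases ?_ (fun j => ?_) i
  · simpa using continuous_snd
  · simp only [Fin.cons_succ]
    fun_prop

theorem continuous_tail {N : ℕ} :
    Continuous fun x : Fin (N + 1) → ℝ => (Fin.tail x : Fin N → ℝ) :=
  continuous_pi fun j => continuous_apply j.succ

/-- A triangular (Knothe) transport between two positive continuous densities on boxes. -/
theorem exists_triangular_transport : ∀ (N : ℕ) (a b c d : Fin N → ℝ), (∀ i, a i < b i) →
    (∀ i, c i < d i) → ∀ (F G : (Fin N → ℝ) → ℝ), Continuous F → Continuous G →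
    (∀ x, 0 < F x) → ∀ l : ℝ, 0 < l → (∀ y, l ≤ G y) →
    ∃ (T : (Fin N → ℝ) → (Fin N → ℝ)) (D : Fin N → (Fin N → ℝ) → ℝ),
      Continuous T ∧ (∀ i, Continuous (D i)) ∧ (∀ i x, 0 ≤ D i x) ∧
      (∀ x ∈ Icc a b, T x ∈ Icc c d) ∧
      (∀ i x, HasDerivAt (fun s => T (Function.update x i s) i) (D i x) (x i)) ∧
      (∀ x, (∏ i, D i x) * (G (T x) * ∫ z, F z ∂boxMeas a b) = F x * ∫ z, G z ∂boxMeas c d) ∧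
      (∀ φ : (Fin N → ℝ) → ℝ, Continuous φ →
        (∫ x, φ (T x) * F x ∂boxMeas a b) * ∫ z, G z ∂boxMeas c d =
          (∫ y, φ y * G y ∂boxMeas c d) * ∫ z, F z ∂boxMeas a b) := by
  intro N
  induction N with
  | zero =>
    intro a b c d _ _ F G _ _ _ l _ _
    refine ⟨id, fun i => i.elim0, continuous_id, fun i => i.elim0, fun i => i.elim0,
      fun x _ => ⟨fun i => i.elim0, fun i => i.elim0⟩, fun i => i.elim0, fun x => ?_,
      fun φ _ => ?_⟩
    · rw [boxMeas, Measure.pi_of_empty _ x, boxMeas, Measure.pi_of_empty _ x]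
      simp [mul_comm]
    · rw [boxMeas, Measure.pi_of_empty _, boxMeas, Measure.pi_of_empty _]
      simp only [integral_dirac, id]
      ring
  | succ N ih =>
    intro a b c d hab hcd F G hF hG hFpos l hl hGl
    set F' : (Fin N → ℝ) → ℝ := fun x' => ∫ s in (a 0)..(b 0), F (Fin.cons s x') with hF'
    set G' : (Fin N → ℝ) → ℝ := fun y' => ∫ s in (c 0)..(d 0), G (Fin.cons s y') with hG'
    have hFu : Continuous (Function.uncurry fun (x' : Fin N → ℝ) (s : ℝ) =>
      F (Fin.cons s x' : Fin (N + 1) → ℝ)) := hF.comp continuous_cons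
    have hGu : Continuous (Function.uncurry fun (x' : Fin N → ℝ) (s : ℝ) =>
      G (Fin.cons s x' : Fin (N + 1) → ℝ)) := hG.comp continuous_cons
    have hF'c : Continuous F' :=
      intervalIntegral.continuous_parametric_intervalIntegral_of_continuous hFu continuous_const
    have hG'c : Continuous G' :=
      intervalIntegral.continuous_parametric_intervalIntegral_of_continuous hGu continuous_const
    have hF'pos : ∀ x', 0 < F' x' := fun x' =>
      intervalIntegral.intervalIntegral_pos_of_pos
        ((hFu.comp (Continuous.prodMk_right x')).intervalIntegrable _ _) (fun s => hFpos _) (hab 0)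
    have hG'l : ∀ y', l * (d 0 - c 0) ≤ G' y' := fun y' => by
      have := intervalIntegral.integral_mono_on (f := fun _ => l)
        (g := fun s => G (Fin.cons s y')) (μ := volume) (hcd 0).le
        intervalIntegrable_const ((hGu.comp (Continuous.prodMk_right y')).intervalIntegrable _ _)
        (fun t _ => hGl _)
      simpa [mul_comm] using this
    have hl' : 0 < l * (d 0 - c 0) := mul_pos hl (sub_pos.2 (hcd 0))
    have hG'pos : ∀ y', 0 < G' y' := fun y' => hl'.trans_le (hG'l y')
    obtain ⟨T', D', hT'c, hD'c, hD'0, hT'm, hT'd, hT'e, hT'p⟩ :=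
      ih (Fin.tail a) (Fin.tail b) (Fin.tail c) (Fin.tail d) (fun i => hab i.succ)
        (fun i => hcd i.succ) F' G' hF'c hG'c hF'pos _ hl' hG'l
    set P : (Fin N → ℝ) → ℝ → ℝ := fun x' s => F (Fin.cons s x') * (G' (T' x') / F' x') with hP
    set Q : (Fin N → ℝ) → ℝ → ℝ := fun x' y => G (Fin.cons y (T' x')) with hQ
    have hPc : Continuous (Function.uncurry P) :=
      hFu.mul (((hG'c.comp hT'c).div hF'c fun x => (hF'pos x).ne').comp continuous_fst)
    have hQc : Continuous (Function.uncurry Q) :=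
      hGu.comp ((hT'c.comp continuous_fst).prodMk continuous_snd)
    have hP0 : ∀ x' s, 0 < P x' s := fun x' s =>
      mul_pos (hFpos _) (div_pos (hG'pos _) (hF'pos _))
    have hQ0 : ∀ x' s, 0 < Q x' s := fun x' s => hl.trans_le (hGl _)
    obtain ⟨τ, hτc, hτd, hτe⟩ := exists_monotone_rearrangement P Q hPc hQc hl
      (fun x y => hGl _) (a 0) (c 0)
    have hτa : ∀ x', τ x' (a 0) = c 0 := fun x' => hτe x' _ _ (by simp)
    have hτb : ∀ x', τ x' (b 0) = d 0 := fun x' => hτe x' _ _ (by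
      simp only [hP, hQ]
      rw [intervalIntegral.integral_mul_const]
      change F' x' * (G' (T' x') / F' x') = G' (T' x')
      have := (hF'pos x').ne'
      field_simp)
    have hτm : ∀ x', Monotone (τ x') := fun x' =>
      monotone_of_deriv_nonneg (fun s => (hτd x' s).differentiableAt) fun s => by
        rw [(hτd x' s).deriv]
        exact (div_pos (hP0 _ _) (hQ0 _ _)).le
    have hIF : ∫ z, F z ∂boxMeas a b = ∫ z, F' z ∂boxMeas (Fin.tail a) (Fin.tail b) :=
      integral_boxMeas_cons a b hab hF
    have hIG : ∫ z, G z ∂boxMeas c d = ∫ z, G' z ∂boxMeas (Fin.tail c) (Fin.tail d) :=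
      integral_boxMeas_cons c d hcd hG
    have hpair : Continuous fun x : Fin (N + 1) → ℝ => ((Fin.tail x : Fin N → ℝ), x 0) :=
      continuous_tail.prodMk (continuous_apply 0)
    have hTc : Continuous fun x : Fin (N + 1) → ℝ =>
        (Fin.cons (τ (Fin.tail x) (x 0)) (T' (Fin.tail x)) : Fin (N + 1) → ℝ) :=
      continuous_cons.comp ((hT'c.comp continuous_tail).prodMk (hτc.comp hpair))
    refine ⟨fun x => Fin.cons (τ (Fin.tail x) (x 0)) (T' (Fin.tail x)),
      Fin.cons (fun x => P (Fin.tail x) (x 0) / Q (Fin.tail x) (τ (Fin.tail x) (x 0)))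
        (fun j x => D' j (Fin.tail x)), hTc, ?_, ?_, ?_, ?_, ?_, ?_⟩
    · refine Fin.cases ?_ (fun j => ?_)
      · refine (hPc.comp hpair).div (hQc.comp (continuous_tail.prodMk (hτc.comp hpair))) ?_
        exact fun x => (hQ0 _ _).ne'
      · exact (hD'c j).comp continuous_tail
    · refine Fin.cases ?_ (fun j => ?_)
      · exact fun x => (div_pos (hP0 _ _) (hQ0 _ _)).le
      · exact fun x => hD'0 j _
    · intro x hx
      have h' := hT'm (Fin.tail x) ⟨fun i => hx.1 i.succ, fun i => hx.2 i.succ⟩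
      constructor
      · refine Fin.cases ?_ (fun j => ?_)
        · simpa [hτa] using hτm (Fin.tail x) (hx.1 0)
        · simpa [Fin.tail] using h'.1 j
      · refine Fin.cases ?_ (fun j => ?_)
        · simpa [hτb] using hτm (Fin.tail x) (hx.2 0)
        · simpa [Fin.tail] using h'.2 j
    · refine Fin.cases (fun x => ?_) (fun j x => ?_)
      · simpa using hτd (Fin.tail x) (x 0)
      · simpa using! hT'd j (Fin.tail x)
    · intro x
      rw [Fin.prod_univ_succ, hIF, hIG]
      simp only [Fin.cons_zero, Fin.cons_succ]
      have h1 := hT'e (Fin.tail x)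
      have h2 : G (Fin.cons (τ (Fin.tail x) (x 0)) (T' (Fin.tail x))) =
        Q (Fin.tail x) (τ (Fin.tail x) (x 0)) := rfl
      have h3 := (hQ0 (Fin.tail x) (τ (Fin.tail x) (x 0))).ne'
      have h4 : P (Fin.tail x) (x 0) = F x * (G' (T' (Fin.tail x)) / F' (Fin.tail x)) := by
        simp only [hP, Fin.cons_self_tail]
      have h5 := (hF'pos (Fin.tail x)).ne'
      rw [h2, h4]
      field_simp
      linear_combination F x * h1
    · intro φ hφ
      set φ' : (Fin N → ℝ) → ℝ := fun y' =>
        (∫ y in (c 0)..(d 0), φ (Fin.cons y y') * G (Fin.cons y y')) / G' y' with hφ'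
      have hφGu : Continuous (Function.uncurry fun (y' : Fin N → ℝ) (y : ℝ) =>
        φ (Fin.cons y y' : Fin (N + 1) → ℝ) * G (Fin.cons y y' : Fin (N + 1) → ℝ)) :=
        (hφ.comp continuous_cons).mul hGu
      have hφ'c : Continuous φ' :=
        (intervalIntegral.continuous_parametric_intervalIntegral_of_continuous hφGu
          continuous_const).div hG'c fun y => (hG'pos y).ne'
      have key := hT'p φ' hφ'c
      rw [integral_boxMeas_cons a b hab
          (F := fun x => φ (Fin.cons (τ (Fin.tail x) (x 0)) (T' (Fin.tail x))) * F x)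
          ((hφ.comp hTc).mul hF),
        integral_boxMeas_cons c d hcd (F := fun x => φ x * G x) (hφ.mul hG), hIF, hIG]
      have e1 : ∀ y', ∫ s in (c 0)..(d 0), φ (Fin.cons s y') * G (Fin.cons s y') =
          φ' y' * G' y' := fun y' => by
        simp only [hφ']
        have := (hG'pos y').ne'
        field_simp
      have e2 : ∀ x', ∫ s in (a 0)..(b 0),
          φ (Fin.cons (τ (Fin.tail (Fin.cons s x' : Fin (N + 1) → ℝ))
            ((Fin.cons s x' : Fin (N + 1) → ℝ) 0))
            (T' (Fin.tail (Fin.cons s x' : Fin (N + 1) → ℝ)))) * F (Fin.cons s x') =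
          φ' (T' x') * F' x' := fun x' => by
        simp only [Fin.tail_cons, Fin.cons_zero]
        have hcv := intervalIntegral.integral_comp_mul_deriv (a := a 0) (b := b 0) (f := τ x')
          (f' := fun s => P x' s / Q x' (τ x' s))
          (g := fun y => φ (Fin.cons y (T' x')) * G (Fin.cons y (T' x')))
          (fun s _ => hτd x' s)
          (((hPc.comp (Continuous.prodMk_right x')).div
            (hQc.comp (continuous_const.prodMk (hτc.comp (Continuous.prodMk_right x'))))
            fun s => (hQ0 _ _).ne').continuousOn)
          (hφGu.comp (Continuous.prodMk_right (T' x')))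
        rw [hτa, hτb, e1] at hcv
        have h5 := (hF'pos x').ne'
        have h6 := (hG'pos (T' x')).ne'
        have : ∫ s in (a 0)..(b 0), φ (Fin.cons (τ x' s) (T' x')) * F (Fin.cons s x') =
          (F' x' / G' (T' x')) * ∫ s in (a 0)..(b 0),
            ((fun y => φ (Fin.cons y (T' x')) * G (Fin.cons y (T' x'))) ∘ τ x') s *
              (P x' s / Q x' (τ x' s)) := by
          rw [← intervalIntegral.integral_const_mul]
          refine intervalIntegral.integral_congr fun s _ => ?_
          have h7 := (hQ0 x' (τ x' s)).ne'
          simp only [Function.comp, hP, hQ] at h7 ⊢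
          field_simp
        rw [this, hcv]
        field_simp
      simp_rw [e1, e2]
      exact key

theorem integral_mul_partial_box {N : ℕ} (a b : Fin (N + 1) → ℝ) (hab : ∀ i, a i < b i)
    {u T D : (Fin (N + 1) → ℝ) → ℝ} (hu : ContDiff ℝ 1 u) (hT : Continuous T) (hD : Continuous D)
    (i : Fin (N + 1)) (hTD : ∀ x, HasDerivAt (fun s => T (Function.update x i s)) (D x) (x i)) :
    ∫ x, u x * D x ∂boxMeas a b =
      ∫ x', (u (i.insertNth (b i) x') * T (i.insertNth (b i) x') -
          u (i.insertNth (a i) x') * T (i.insertNth (a i) x'))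
        ∂boxMeas (fun j => a (i.succAbove j)) (fun j => b (i.succAbove j)) -
      ∫ x, fderiv ℝ u x (Pi.single i 1) * T x ∂boxMeas a b := by
  have hins : ∀ x' : Fin N → ℝ,
      Continuous fun s : ℝ => (i.insertNth s x' : Fin (N + 1) → ℝ) := fun x' =>
    Continuous.finInsertNth i continuous_id continuous_const
  have hins' : ∀ s : ℝ, Continuous fun x' : Fin N → ℝ => (i.insertNth s x' : Fin (N + 1) → ℝ) :=
    fun s => Continuous.finInsertNth i continuous_const continuous_id
  have hinsu : Continuous fun p : (Fin N → ℝ) × ℝ => (i.insertNth p.2 p.1 : Fin (N + 1) → ℝ) :=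
    Continuous.finInsertNth i continuous_snd continuous_fst
  have hdu : Continuous fun x => fderiv ℝ u x (Pi.single i 1) :=
    (hu.continuous_fderiv one_ne_zero).clm_apply continuous_const
  have hupd : ∀ (s t : ℝ) (x' : Fin N → ℝ),
      Function.update (i.insertNth s x' : Fin (N + 1) → ℝ) i t = i.insertNth t x' :=
    fun s t x' => Fin.update_insertNth (α := fun _ => ℝ) i s t x'
  have h1 := integral_boxMeas_insertNth a b hab (F := fun x => u x * D x)
    (hu.continuous.mul hD) i
  have h2 := integral_boxMeas_insertNth a b hab
    (F := fun x => fderiv ℝ u x (Pi.single i 1) * T x) (hdu.mul hT) i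
  rw [h1, h2, ← integral_sub]
  · refine integral_congr_ae (Filter.Eventually.of_forall fun x' => ?_)
    simp only
    refine intervalIntegral.integral_mul_deriv_eq_deriv_mul
      (u := fun s => u (i.insertNth s x')) (v := fun s => T (i.insertNth s x'))
      (u' := fun s => fderiv ℝ u (i.insertNth s x') (Pi.single i 1))
      (v' := fun s => D (i.insertNth s x')) (fun s _ => ?_) (fun s _ => ?_)
      ((hdu.comp (hins x')).intervalIntegrable _ _) ((hD.comp (hins x')).intervalIntegrable _ _)
    · have e1 : HasDerivAt (fun s => (i.insertNth s x' : Fin (N + 1) → ℝ)) (Pi.single i 1) s := by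
        have := hasDerivAt_update (𝕜 := ℝ) (i.insertNth s x' : Fin (N + 1) → ℝ) i s
        refine this.congr_of_eventuallyEq (Filter.Eventually.of_forall fun t => ?_)
        exact (hupd s t x').symm
      exact ((hu.differentiable one_ne_zero _).hasFDerivAt).comp_hasDerivAt s e1
    · have := hTD (i.insertNth s x')
      simp only [hupd, Fin.insertNth_apply_same] at this
      exact this
  · exact integrable_boxMeas _ _ (((hu.continuous.comp (hins' _)).mul (hT.comp (hins' _))).sub
      ((hu.continuous.comp (hins' _)).mul (hT.comp (hins' _))))
  · refine integrable_boxMeas _ _ ?_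
    exact intervalIntegral.continuous_parametric_intervalIntegral_of_continuous
      (f := fun x' s => fderiv ℝ u (i.insertNth s x') (Pi.single i 1) * T (i.insertNth s x'))
      ((hdu.comp hinsu).mul (hT.comp hinsu)) continuous_const

theorem card_mul_prod_rpow_le_sum {N : ℕ} (z : Fin (N + 1) → ℝ) (hz : ∀ i, 0 ≤ z i) :
    ((N : ℝ) + 1) * (∏ i, z i) ^ (((N : ℝ) + 1)⁻¹) ≤ ∑ i, z i := by
  have := Real.geom_mean_le_arith_mean Finset.univ (fun _ => (1 : ℝ)) z (fun _ _ => zero_le_one)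
    (by simp; positivity) (fun i _ => hz i)
  simp only [Real.rpow_one, Finset.sum_const, Finset.card_univ, Fintype.card_fin, nsmul_eq_mul,
    Nat.cast_add, Nat.cast_one, mul_one, one_mul] at this
  rw [le_div_iff₀ (by positivity)] at this
  linarith

theorem insertNth_mem_Icc {N : ℕ} {a b : Fin (N + 1) → ℝ} {i : Fin (N + 1)} {s : ℝ}
    {x' : Fin N → ℝ} (hs : s ∈ Icc (a i) (b i))
    (hx : x' ∈ Icc (fun j => a (i.succAbove j)) (fun j => b (i.succAbove j))) :
    (i.insertNth s x' : Fin (N + 1) → ℝ) ∈ Icc a b := by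
  rw [Fin.insertNth_mem_Icc]
  exact ⟨hs, hx⟩

/-- The mass transport inequality behind the sharp trace inequality. -/
theorem box_transport_inequality {N : ℕ} (a b c d : Fin (N + 1) → ℝ) (hab : ∀ i, a i < b i)
    (hcd : ∀ i, c i < d i) {u F G S Φ : (Fin (N + 1) → ℝ) → ℝ} (hu : ContDiff ℝ 1 u)
    (hF : Continuous F) (hG : Continuous G) (hS : Continuous S) (hΦ : Continuous Φ)
    (hupos : ∀ x, 0 < u x) (hFpos : ∀ x, 0 < F x) {l : ℝ} (hl : 0 < l) (hGl : ∀ y, l ≤ G y)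
    (huF : ∀ x, u x * F x ^ (((N : ℝ) + 1)⁻¹) = F x) {M η : ℝ}
    (hM : ∀ y ∈ Icc c d, ∀ i, |y i| ≤ M)
    (hη : ∀ x ∈ Icc a b, ∀ i, x i = b i ∨ (i ≠ 0 ∧ x i = a i) → u x ≤ η)
    (hY : ∀ x y, -(fderiv ℝ u x y) ≤ S x + Φ y * F x) {κ : ℝ}
    (hκ : κ = (∫ x, F x ∂boxMeas a b) / ∫ y, G y ∂boxMeas c d) (hκ0 : 0 < κ)
    (hG0 : 0 < ∫ y, G y ∂boxMeas c d) :
    c 0 * ∫ x', u (Fin.cons (a 0) x') ∂boxMeas (Fin.tail a) (Fin.tail b) +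
        ((N : ℝ) + 1) * κ ^ (1 - ((N : ℝ) + 1)⁻¹) *
          ∫ y, G y ^ (1 - ((N : ℝ) + 1)⁻¹) ∂boxMeas c d ≤
      ∫ x, S x ∂boxMeas a b + κ * ∫ y, Φ y * G y ∂boxMeas c d +
        (∑ i : Fin (N + 1), 2 * M *
          (boxMeas (fun j => a (i.succAbove j)) (fun j => b (i.succAbove j))).real univ) * η := by
  obtain ⟨T, D, hTc, hDc, hD0, hTm, hTd, hTe, hTp⟩ :=
    exists_triangular_transport (N + 1) a b c d hab hcd F G hF hG hFpos l hl hGl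
  set ι : ℝ := ((N : ℝ) + 1)⁻¹ with hι
  have hι0 : 0 < ι := by positivity
  set cF := ∫ x, F x ∂boxMeas a b with hcF
  set cG := ∫ y, G y ∂boxMeas c d with hcG
  have hcFκ : cF = κ * cG := by rw [hκ]; field_simp
  have hGpos : ∀ y, 0 < G y := fun y => hl.trans_le (hGl y)
  have hpush : ∀ φ : (Fin (N + 1) → ℝ) → ℝ, Continuous φ →
      ∫ x, φ (T x) * F x ∂boxMeas a b = κ * ∫ y, φ y * G y ∂boxMeas c d := by
    intro φ hφ
    have := hTp φ hφ
    rw [hcFκ] at this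
    have h2 : (∫ x, φ (T x) * F x ∂boxMeas a b) * cG =
      (κ * ∫ y, φ y * G y ∂boxMeas c d) * cG := by rw [this]; ring
    exact mul_right_cancel₀ hG0.ne' h2
  have hTi : ∀ i, Continuous fun x => T x i := fun i => (continuous_apply i).comp hTc
  have hDi : ∀ i, Continuous fun x => u x * D i x := fun i => hu.continuous.mul (hDc i)
  have hdu : ∀ i, Continuous fun x => fderiv ℝ u x (Pi.single i 1) * T x i := fun i =>
    ((hu.continuous_fderiv one_ne_zero).clm_apply continuous_const).mul (hTi i)
  -- lower bound for the divergence term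
  have hφ : Continuous fun y => G y ^ (-ι) := hG.rpow_const fun y => Or.inl (hGpos y).ne'
  have hpt : ∀ x, ((N : ℝ) + 1) * κ ^ (-ι) * (G (T x) ^ (-ι) * F x) ≤ ∑ i, u x * D i x := by
    intro x
    have h1 := card_mul_prod_rpow_le_sum (fun i => D i x) (fun i => hD0 i x)
    have h2 : ∏ i, D i x = F x * (κ⁻¹ * (G (T x))⁻¹) := by
      have h3 := hTe x
      rw [hcFκ] at h3
      have h4 := (hGpos (T x)).ne'
      have h5 : (∏ i, D i x) * (G (T x) * κ) = F x := by
        refine mul_right_cancel₀ hG0.ne' ?_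
        rw [← h3]; ring
      rw [← h5]
      field_simp
    rw [h2, Real.mul_rpow (hFpos x).le (by have := hGpos (T x); positivity),
      Real.mul_rpow (by positivity) (by have := hGpos (T x); positivity),
      Real.inv_rpow hκ0.le, Real.inv_rpow (hGpos _).le, ← Real.rpow_neg hκ0.le,
      ← Real.rpow_neg (hGpos _).le] at h1
    rw [← Finset.mul_sum]
    calc ((N : ℝ) + 1) * κ ^ (-ι) * (G (T x) ^ (-ι) * F x)
        = u x * (((N : ℝ) + 1) * (F x ^ ι * (κ ^ (-ι) * G (T x) ^ (-ι)))) := by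
          linear_combination (-(((N : ℝ) + 1) * κ ^ (-ι) * G (T x) ^ (-ι))) * huF x
      _ ≤ _ := mul_le_mul_of_nonneg_left h1 (hupos x).le
  have hlow : ((N : ℝ) + 1) * κ ^ (1 - ι) * ∫ y, G y ^ (1 - ι) ∂boxMeas c d ≤
      ∑ i, ∫ x, u x * D i x ∂boxMeas a b := by
    rw [← integral_finsetSum _ fun i _ => integrable_boxMeas a b (hDi i)]
    have h1 : ((N : ℝ) + 1) * κ ^ (1 - ι) * ∫ y, G y ^ (1 - ι) ∂boxMeas c d =
        ∫ x, ((N : ℝ) + 1) * κ ^ (-ι) * (G (T x) ^ (-ι) * F x) ∂boxMeas a b := by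
      rw [integral_const_mul, hpush (fun y => G y ^ (-ι)) hφ]
      have h2 : ∀ y, G y ^ (-ι) * G y = G y ^ (1 - ι) := fun y => by
        rw [sub_eq_neg_add, Real.rpow_add (hGpos y), Real.rpow_one]
      simp_rw [h2]
      rw [sub_eq_neg_add, Real.rpow_add hκ0, Real.rpow_one]
      ring
    rw [h1]
    refine integral_mono (integrable_boxMeas a b ?_) (integrable_boxMeas a b ?_) hpt
    · exact continuous_const.mul ((hφ.comp hTc).mul hF)
    · exact continuous_finsetSum _ fun i _ => hDi i
  -- integration by parts
  have hparts := fun i : Fin (N + 1) =>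
    integral_mul_partial_box a b hab hu (hTi i) (hDc i) i (hTd i)
  have hsum : ∑ i, ∫ x, fderiv ℝ u x (Pi.single i 1) * T x i ∂boxMeas a b =
      ∫ x, fderiv ℝ u x (T x) ∂boxMeas a b := by
    rw [← integral_finsetSum _ fun i _ => integrable_boxMeas a b (hdu i)]
    refine integral_congr_ae (Filter.Eventually.of_forall fun x => ?_)
    simp only
    conv_rhs => rw [← Finset.univ_sum_single (T x), map_sum]
    refine Finset.sum_congr rfl fun i _ => ?_
    have : (Pi.single i (T x i) : Fin (N + 1) → ℝ) = T x i • Pi.single i (1 : ℝ) := by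
      rw [← Pi.single_smul, smul_eq_mul, mul_one]
    rw [this, map_smul, smul_eq_mul, mul_comm]
  have hup : -∫ x, fderiv ℝ u x (T x) ∂boxMeas a b ≤
      ∫ x, S x ∂boxMeas a b + κ * ∫ y, Φ y * G y ∂boxMeas c d := by
    rw [← hpush Φ hΦ, ← integral_neg, ← integral_add (integrable_boxMeas a b hS)
           (g := fun x => Φ (T x) * F x) (integrable_boxMeas a b ((hΦ.comp hTc).mul hF))]
    refine integral_mono (integrable_boxMeas a b ?_) (integrable_boxMeas a b ?_)
      fun x => hY x (T x)
    · exact ((hu.continuous_fderiv one_ne_zero).clm_apply hTc).neg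
    · exact hS.add ((hΦ.comp hTc).mul hF)
  -- the faces
  have hins' : ∀ (i : Fin (N + 1)) (s : ℝ),
      Continuous fun x' : Fin N → ℝ => (i.insertNth s x' : Fin (N + 1) → ℝ) :=
    fun i s => Continuous.finInsertNth i continuous_const continuous_id
  have hM0 : 0 ≤ M := (abs_nonneg _).trans (hM c ⟨le_rfl, fun i => (hcd i).le⟩ 0)
  have hη0 : 0 ≤ η := (hupos b).le.trans (hη b ⟨fun i => (hab i).le, le_rfl⟩ 0 (Or.inl rfl))
  have hfb : ∀ i, ∀ x ∈ Icc a b, (x i = b i ∨ (i ≠ 0 ∧ x i = a i)) → |u x * T x i| ≤ M * η := by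
    intro i x hx h
    rw [abs_mul, abs_of_pos (hupos x), mul_comm]
    exact mul_le_mul (hM _ (hTm x hx) i) (hη x hx i h) (hupos x).le hM0
  have hface : ∀ i : Fin (N + 1), i ≠ 0 →
      ∫ x', (u (i.insertNth (b i) x') * T (i.insertNth (b i) x') i -
          u (i.insertNth (a i) x') * T (i.insertNth (a i) x') i)
        ∂boxMeas (fun j => a (i.succAbove j)) (fun j => b (i.succAbove j)) ≤
      2 * M * (boxMeas (fun j => a (i.succAbove j)) (fun j => b (i.succAbove j))).real univ * η := by
    intro i hi
    have h0 : 2 * M * (boxMeas (fun j => a (i.succAbove j))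
        (fun j => b (i.succAbove j))).real univ * η =
        ∫ _, 2 * M * η ∂boxMeas (fun j => a (i.succAbove j)) (fun j => b (i.succAbove j)) := by
      rw [integral_const, smul_eq_mul]; ring
    rw [h0]
    refine integral_mono_ae (integrable_boxMeas _ _ ?_) (integrable_const _) ?_
    · exact ((hu.continuous.comp (hins' _ _)).mul ((hTi i).comp (hins' _ _))).sub
        ((hu.continuous.comp (hins' _ _)).mul ((hTi i).comp (hins' _ _)))
    · filter_upwards [ae_boxMeas_mem_Icc _ _] with x' hx'
      have h1 := hfb i _ (insertNth_mem_Icc (right_mem_Icc.2 (hab i).le) hx')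
        (Or.inl (by simp))
      have h2 := hfb i _ (insertNth_mem_Icc (left_mem_Icc.2 (hab i).le) hx')
        (Or.inr ⟨hi, by simp⟩)
      linarith [abs_le.1 h1, abs_le.1 h2]
  have hface0 : ∫ x', (u ((0 : Fin (N + 1)).insertNth (b 0) x') *
          T ((0 : Fin (N + 1)).insertNth (b 0) x') 0 -
          u ((0 : Fin (N + 1)).insertNth (a 0) x') * T ((0 : Fin (N + 1)).insertNth (a 0) x') 0)
        ∂boxMeas (fun j => a ((0 : Fin (N + 1)).succAbove j))
          (fun j => b ((0 : Fin (N + 1)).succAbove j)) ≤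
      2 * M * (boxMeas (fun j => a ((0 : Fin (N + 1)).succAbove j))
          (fun j => b ((0 : Fin (N + 1)).succAbove j))).real univ * η -
        c 0 * ∫ x', u (Fin.cons (a 0) x') ∂boxMeas (Fin.tail a) (Fin.tail b) := by
    have h0 : 2 * M * (boxMeas (fun j => a ((0 : Fin (N + 1)).succAbove j))
          (fun j => b ((0 : Fin (N + 1)).succAbove j))).real univ * η -
        c 0 * ∫ x', u (Fin.cons (a 0) x') ∂boxMeas (Fin.tail a) (Fin.tail b) =
        ∫ x', (2 * M * η - c 0 * u ((0 : Fin (N + 1)).insertNth (a 0) x'))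
          ∂boxMeas (fun j => a ((0 : Fin (N + 1)).succAbove j))
          (fun j => b ((0 : Fin (N + 1)).succAbove j)) := by
      rw [integral_sub (g := fun x' => c 0 * u ((0 : Fin (N + 1)).insertNth (a 0) x'))
        (integrable_const _)
        (integrable_boxMeas _ _ (continuous_const.mul (hu.continuous.comp (hins' _ _)))),
        integral_const, integral_const_mul, smul_eq_mul]
      simp only [Fin.insertNth_zero', Fin.succAbove_zero]
      simp only [show (fun j : Fin N => a j.succ) = Fin.tail a from rfl,
        show (fun j : Fin N => b j.succ) = Fin.tail b from rfl]
      ring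
    rw [h0]
    refine integral_mono_ae (integrable_boxMeas _ _ ?_) (integrable_boxMeas _ _ ?_) ?_
    · exact ((hu.continuous.comp (hins' _ _)).mul ((hTi 0).comp (hins' _ _))).sub
        ((hu.continuous.comp (hins' _ _)).mul ((hTi 0).comp (hins' _ _)))
    · exact continuous_const.sub (continuous_const.mul (hu.continuous.comp (hins' _ _)))
    · filter_upwards [ae_boxMeas_mem_Icc _ _] with x' hx'
      have h1 := hfb 0 _ (insertNth_mem_Icc (right_mem_Icc.2 (hab 0).le) hx')
        (Or.inl (by simp))
      have h2 := (hTm _ (insertNth_mem_Icc (left_mem_Icc.2 (hab 0).le) hx')).1 0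
      have h3 := mul_le_mul_of_nonneg_left h2
        (hupos ((0 : Fin (N + 1)).insertNth (a 0) x')).le
      have h4 : 0 ≤ M * η := mul_nonneg hM0 hη0
      linarith [abs_le.1 h1]
  have hfaces := Finset.sum_le_sum fun (i : Fin N) (_ : i ∈ Finset.univ) =>
    hface i.succ (Fin.succ_ne_zero i)
  have hps : ∑ i, ∫ x, u x * D i x ∂boxMeas a b = _ := Finset.sum_congr rfl fun i _ => hparts i
  rw [hps, Finset.sum_sub_distrib, hsum, Fin.sum_univ_succ] at hlow
  rw [← Finset.sum_mul] at hfaces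
  rw [Fin.sum_univ_succ (fun i : Fin (N + 1) => 2 * M *
    (boxMeas (fun j => a (i.succAbove j)) (fun j => b (i.succAbove j))).real univ),
    add_mul (2 * M * _)]
  linarith

theorem exists_scale_le {n p q E J κ : ℝ} (hp : 1 < p) (hpn : p < n) (hq : q = p / (p - 1))
    (hE : 0 < E) (hJ : 0 < J) (hκ : 0 < κ) :
    ∃ s : ℝ, 0 < s ∧ p * (n - 1) / (n - p) * (s ^ (-p) * E + s ^ q * (κ * J)) ≤
      n * κ ^ (1 - n⁻¹) * J +
        J * ((n - p) / (p - 1)) * (E / (((n - p) / p) ^ p * (q - 1) * J)) ^ ((n - 1) / (n - p)) := by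
  have hp0 : 0 < p := by linarith
  have hp1 : 0 < p - 1 := by linarith
  have hn0 : 0 < n := by linarith
  have hnp : 0 < n - p := by linarith
  have hn1 : 0 < n - 1 := by linarith
  have hq1 : q - 1 = 1 / (p - 1) := by rw [hq]; field_simp; ring
  have hq10 : 0 < q - 1 := by rw [hq1]; positivity
  have hq0 : 0 < q := by linarith
  set a := (n - p) / p with ha
  have ha0 : 0 < a := by positivity
  set e := E / (a ^ p * (q - 1) * J) with he
  have he0 : 0 < e := by positivity
  set τ := e ^ p⁻¹ with hτ
  have hτ0 : 0 < τ := by positivity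
  have hτp : τ ^ p = e := by rw [hτ, ← Real.rpow_mul he0.le, inv_mul_cancel₀ hp0.ne', Real.rpow_one]
  have hEe : E = τ ^ p * a ^ p * (q - 1) * J := by rw [hτp, he]; field_simp
  set t := τ * a with ht
  have ht0 : 0 < t := by positivity
  have htp : E = t ^ p * (q - 1) * J := by rw [hEe, ht, Real.mul_rpow hτ0.le ha0.le]
  refine ⟨t ^ q⁻¹ * κ ^ (-(p * q)⁻¹), by positivity, ?_⟩
  have e1 : (t ^ q⁻¹ * κ ^ (-(p * q)⁻¹)) ^ (-p) = t ^ (1 - p) * κ ^ q⁻¹ := by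
    rw [Real.mul_rpow (by positivity) (by positivity), ← Real.rpow_mul ht0.le,
      ← Real.rpow_mul hκ.le]
    congr 2
    · rw [hq]; field_simp; ring
    · field_simp
  have e2 : (t ^ q⁻¹ * κ ^ (-(p * q)⁻¹)) ^ q = t * κ ^ (q⁻¹ - 1) := by
    rw [Real.mul_rpow (by positivity) (by positivity), ← Real.rpow_mul ht0.le,
      ← Real.rpow_mul hκ.le, inv_mul_cancel₀ hq0.ne', Real.rpow_one]
    congr 2
    rw [hq]; field_simp; ring
  have e3 : t ^ (1 - p) * t ^ p = t := by
    rw [← Real.rpow_add ht0]; simp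
  have e4 : κ ^ (q⁻¹ - 1) * κ = κ ^ q⁻¹ := by
    nth_rewrite 2 [← Real.rpow_one κ]
    rw [← Real.rpow_add hκ]; simp
  have e5 : p * (n - 1) / (n - p) * (t ^ (1 - p) * κ ^ q⁻¹ * E + t * κ ^ (q⁻¹ - 1) * (κ * J)) =
      q * (n - 1) * J * (κ ^ q⁻¹ * τ) := by
    have h1 : t ^ (1 - p) * κ ^ q⁻¹ * E + t * κ ^ (q⁻¹ - 1) * (κ * J) = t * q * J * κ ^ q⁻¹ := by
      rw [htp]
      linear_combination (κ ^ q⁻¹ * (q - 1) * J) * e3 + t * J * e4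
    rw [h1, ht, ha]
    field_simp
  rw [e1, e2, e5]
  set θ := n / (q * (n - 1)) with hθ
  have hθ' : 1 - θ = (n - p) / (p * (n - 1)) := by rw [hθ, hq]; field_simp; ring
  have hy := Real.geom_mean_le_arith_mean2_weighted (w₁ := θ) (w₂ := 1 - θ)
    (p₁ := κ ^ (1 - n⁻¹)) (p₂ := e ^ ((n - 1) / (n - p))) (by positivity)
    (by rw [hθ']; positivity) (by positivity) (by positivity) (by ring)
  rw [← Real.rpow_mul hκ.le, ← Real.rpow_mul he0.le, hθ',
    show (1 - n⁻¹) * θ = q⁻¹ by rw [hθ]; field_simp,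
    show (n - 1) / (n - p) * ((n - p) / (p * (n - 1))) = p⁻¹ by field_simp] at hy
  have := mul_le_mul_of_nonneg_left hy (show 0 ≤ q * (n - 1) * J by positivity)
  refine this.trans (le_of_eq ?_)
  rw [mul_add, ← mul_assoc, ← mul_assoc]
  congr 1
  · rw [hθ]; field_simp
  · congr 1
    rw [hq]; field_simp

theorem integral_boxMeas_pos {N : ℕ} {a b : Fin N → ℝ} (hab : ∀ i, a i < b i)
    {F : (Fin N → ℝ) → ℝ} (hF : Continuous F) (hpos : ∀ x, 0 < F x) :
    0 < ∫ x, F x ∂boxMeas a b := by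
  rw [integral_pos_iff_support_of_nonneg (fun x => (hpos x).le) (integrable_boxMeas _ _ hF)]
  have : Function.support F = univ := eq_univ_of_forall fun x => (hpos x).ne'
  rw [this, boxMeas, Measure.pi_univ, pos_iff_ne_zero, Finset.prod_ne_zero_iff]
  intro i _
  simp [hab i]

/-- The trace inequality on a box, for a function vanishing on all faces of the box except the one
that lies in the boundary hyperplane. -/
theorem box_trace_inequality {N : ℕ} {p q : ℝ} (hp : 1 < p) (hpn : p < (N : ℝ) + 1)
    (hq : q = p / (p - 1)) {a b c d : Fin (N + 1) → ℝ} (hab : ∀ i, a i < b i)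
    (hcd : ∀ i, c i < d i) (hc : c 0 = 1) {f S C : (Fin (N + 1) → ℝ) → ℝ} (hf : ContDiff ℝ 1 f)
    (hS : Continuous S) (hC : Continuous C)
    (hChom : ∀ l : ℝ, 0 ≤ l → ∀ y, C (l • y) = l ^ q * C y) {δ : ℝ} (hδ : 0 < δ)
    (hCδ : ∀ y ∈ Icc c d, δ ≤ C y)
    (hfS : ∀ x z, ∀ s : ℝ, 0 < s → |fderiv ℝ f x z| ≤ s ^ (-p) * S x + s ^ q * C z)
    (hface : ∀ x ∈ Icc a b, ∀ i, x i = b i ∨ (i ≠ 0 ∧ x i = a i) → f x = 0) {E J : ℝ}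
    (hE0 : 0 < E) (hE : ∫ x, S x ∂boxMeas a b ≤ E)
    (hJ : J = ∫ y, C y ^ (1 - ((N : ℝ) + 1)) ∂boxMeas c d) :
    ∫ x', |f (Fin.cons (a 0) x')| ^ (p * ((N : ℝ) + 1 - 1) / ((N : ℝ) + 1 - p))
        ∂boxMeas (Fin.tail a) (Fin.tail b) ≤
      J * (((N : ℝ) + 1 - p) / (p - 1)) *
        (E / ((((N : ℝ) + 1 - p) / p) ^ p * (q - 1) * J)) ^
          (((N : ℝ) + 1 - 1) / ((N : ℝ) + 1 - p)) := by
  set n : ℝ := (N : ℝ) + 1 with hn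
  set r : ℝ := p * (n - 1) / (n - p) with hr
  have hn0 : 0 < n := by positivity
  have hp0 : 0 < p := by linarith
  have hp1 : 0 < p - 1 := by linarith
  have hnp : 0 < n - p := by linarith
  have hn1 : 0 < n - 1 := by linarith
  have hr0 : 0 < r := by positivity
  have hr1 : q * (r - 1) = n * p / (n - p) := by rw [hr, hq]; field_simp; ring
  have hr2 : r + p / (n - p) = n * p / (n - p) := by rw [hr]; field_simp; ring
  obtain ⟨M, hM⟩ := (isCompact_Icc (a := c) (b := d)).isBounded.exists_norm_le
  obtain ⟨L₀, hL₀⟩ := (isCompact_Icc (a := c) (b := d)).exists_bound_of_continuousOn hC.continuousOn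
  set L : ℝ := max L₀ δ with hL
  set Cb : (Fin (N + 1) → ℝ) → ℝ := fun y => min (max (C y) δ) L with hCb
  have hCbc : Continuous Cb := (hC.max continuous_const).min continuous_const
  have hCb1 : ∀ y, δ ≤ Cb y := fun y => le_min (le_max_right _ _) (le_max_right _ _)
  have hCbpos : ∀ y, 0 < Cb y := fun y => hδ.trans_le (hCb1 y)
  have hCbL : ∀ y, Cb y ≤ L := fun y => min_le_right _ _
  have hCbC : ∀ y ∈ Icc c d, Cb y = C y := by
    intro y hy
    have h1 := hL₀ y hy
    rw [hCb]
    simp only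
    rw [max_eq_left (hCδ y hy),
      min_eq_left (((le_abs_self _).trans h1).trans (le_max_left _ _))]
  have hCbpow : ∀ e : ℝ, Continuous fun y => Cb y ^ e := fun e =>
    hCbc.rpow_const fun y => Or.inl (hCbpos y).ne'
  have hJb : J = ∫ y, Cb y ^ (1 - n) ∂boxMeas c d := by
    rw [hJ]
    refine integral_congr_ae ?_
    filter_upwards [ae_boxMeas_mem_Icc c d] with y hy
    rw [hCbC y hy]
  have hJ0 : 0 < J := by
    rw [hJb]
    exact integral_boxMeas_pos hcd (hCbpow _) fun y => by have := hCbpos y; positivity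
  set W : ℝ := ∑ i : Fin (N + 1), 2 * M *
    (boxMeas (fun j => a (i.succAbove j)) (fun j => b (i.succAbove j))).real univ with hW
  have key : ∀ ε : ℝ, 0 < ε → ∫ x', |f (Fin.cons (a 0) x')| ^ r ∂boxMeas (Fin.tail a) (Fin.tail b) ≤
      J * ((n - p) / (p - 1)) * (E / (((n - p) / p) ^ p * (q - 1) * J)) ^ ((n - 1) / (n - p)) +
        W * ε ^ r := by
    intro ε hε
    set g : (Fin (N + 1) → ℝ) → ℝ := fun x => f x ^ 2 + ε ^ 2 with hg
    have hg0 : ∀ x, 0 < g x := fun x => by positivity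
    have hgc : ContDiff ℝ 1 g := (hf.pow 2).add contDiff_const
    have hu : ContDiff ℝ 1 fun x => g x ^ (r / 2) := hgc.rpow_const_of_ne fun x => (hg0 x).ne'
    have hF : Continuous fun x => g x ^ (n * p / (n - p) / 2) :=
      hgc.continuous.rpow_const fun x => Or.inl (hg0 x).ne'
    have hFpos : ∀ x, 0 < g x ^ (n * p / (n - p) / 2) := fun x => by have := hg0 x; positivity
    have hκ0 : 0 < (∫ x, g x ^ (n * p / (n - p) / 2) ∂boxMeas a b) /
        ∫ y, Cb y ^ (-n) ∂boxMeas c d :=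
      div_pos (integral_boxMeas_pos hab hF hFpos)
        (integral_boxMeas_pos hcd (hCbpow _) fun y => by have := hCbpos y; positivity)
    obtain ⟨s, hs, hopt⟩ := exists_scale_le hp hpn hq hE0 hJ0 hκ0
    have hfd : ∀ x y, fderiv ℝ (fun x => g x ^ (r / 2)) x y =
        r * g x ^ (r / 2 - 1) * f x * fderiv ℝ f x y := by
      intro x y
      have h1 : HasFDerivAt f (fderiv ℝ f x) x := (hf.differentiable one_ne_zero x).hasFDerivAt
      have h2 := ((h1.pow 2).add_const (ε ^ 2)).rpow_const (p := r / 2) (Or.inl (hg0 x).ne')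
      rw [h2.fderiv]
      simp [hg]
      ring
    have hT := box_transport_inequality a b c d hab hcd (u := fun x => g x ^ (r / 2))
      (F := fun x => g x ^ (n * p / (n - p) / 2)) (G := fun y => Cb y ^ (-n))
      (S := fun x => r * (s ^ (-p) * S x)) (Φ := fun y => r * (s ^ q * C y))
      hu hF (hCbpow _) (continuous_const.mul (continuous_const.mul hS))
      (continuous_const.mul (continuous_const.mul hC))
      (fun x => by have := hg0 x; positivity) hFpos (l := L ^ (-n))
      (by have : 0 < L := hδ.trans_le (le_max_right _ _)
          positivity)
      (fun y => Real.rpow_le_rpow_of_nonpos (hCbpos y) (hCbL y) (by linarith))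
      (fun x => by
        rw [← Real.rpow_mul (hg0 x).le, ← Real.rpow_add (hg0 x), ← hn]
        congr 1
        rw [← hr2]
        rw [hr]
        field_simp
        ring)
      (M := M) (η := ε ^ r) (fun y hy i => (norm_le_pi_norm y i).trans (hM y hy))
      (fun x hx i hi => by
        have h0 := hface x hx i hi
        simp only [hg, h0]
        rw [zero_pow two_ne_zero, zero_add, ← Real.rpow_natCast, ← Real.rpow_mul hε.le]
        apply le_of_eq
        congr 1
        push_cast
        ring)
      (fun x y => by
        rw [hfd]
        have h1 := hfS x (g x ^ ((r - 1) / 2) • y) s hs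
        have hgp : 0 < g x ^ ((r - 1) / 2) := by have := hg0 x; positivity
        rw [map_smul, smul_eq_mul, abs_mul, abs_of_pos hgp, hChom _ hgp.le,
          ← Real.rpow_mul (hg0 x).le, show (r - 1) / 2 * q = n * p / (n - p) / 2 by
            rw [← hr1]; ring] at h1
        have h2 : g x ^ (r / 2 - 1) * |f x| ≤ g x ^ ((r - 1) / 2) := by
          have h3 : |f x| ≤ g x ^ (1 / 2 : ℝ) := by
            rw [← Real.sqrt_eq_rpow]
            exact Real.abs_le_sqrt (by simp only [hg]; nlinarith [sq_nonneg ε])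
          have h4 : g x ^ ((r - 1) / 2) = g x ^ (r / 2 - 1) * g x ^ (1 / 2 : ℝ) := by
            rw [← Real.rpow_add (hg0 x)]; congr 1; ring
          rw [h4]
          exact mul_le_mul_of_nonneg_left h3 (by have := hg0 x; positivity)
        calc -(r * g x ^ (r / 2 - 1) * f x * fderiv ℝ f x y)
            ≤ |r * g x ^ (r / 2 - 1) * f x * fderiv ℝ f x y| := neg_le_abs _
          _ = r * (g x ^ (r / 2 - 1) * |f x| * |fderiv ℝ f x y|) := by
            rw [abs_mul, abs_mul, abs_mul, abs_of_pos hr0,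
              abs_of_pos (Real.rpow_pos_of_pos (hg0 x) _)]
            ring
          _ ≤ r * (g x ^ ((r - 1) / 2) * |fderiv ℝ f x y|) := by gcongr
          _ ≤ r * (s ^ (-p) * S x + s ^ q * (g x ^ (n * p / (n - p) / 2) * C y)) := by gcongr
          _ = _ := by ring)
      rfl hκ0 (integral_boxMeas_pos hcd (hCbpow _) fun y => by have := hCbpos y; positivity)
    rw [hc, one_mul, ← hn, ← hW] at hT
    have i1 : ∫ y, (Cb y ^ (-n)) ^ (1 - n⁻¹) ∂boxMeas c d = J := by
      rw [hJb]
      refine integral_congr_ae (Filter.Eventually.of_forall fun y => ?_)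
      simp only
      rw [← Real.rpow_mul (hCbpos y).le]
      congr 1
      field_simp
      ring
    have i2 : ∫ y, r * (s ^ q * C y) * Cb y ^ (-n) ∂boxMeas c d = r * s ^ q * J := by
      rw [hJb, ← integral_const_mul]
      refine integral_congr_ae ?_
      filter_upwards [ae_boxMeas_mem_Icc c d] with y hy
      rw [← hCbC y hy, sub_eq_add_neg, Real.rpow_add (hCbpos y), Real.rpow_one]
      ring
    have i3 : ∫ x, r * (s ^ (-p) * S x) ∂boxMeas a b ≤ r * (s ^ (-p) * E) := by
      rw [integral_const_mul, integral_const_mul]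
      gcongr
    have i4 : ∫ x', |f (Fin.cons (a 0) x')| ^ r ∂boxMeas (Fin.tail a) (Fin.tail b) ≤
        ∫ x', g (Fin.cons (a 0) x') ^ (r / 2) ∂boxMeas (Fin.tail a) (Fin.tail b) := by
      have hcons : Continuous fun x' : Fin N → ℝ => (Fin.cons (a 0) x' : Fin (N + 1) → ℝ) := by
        refine continuous_pi fun i => ?_
        refine Fin.cases ?_ (fun j => ?_) i
        · simpa using continuous_const
        · simpa using continuous_apply j
      refine integral_mono (integrable_boxMeas _ _ ?_) (integrable_boxMeas _ _ ?_) fun x' => ?_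
      · exact ((hf.continuous.comp hcons).abs).rpow_const fun _ => Or.inr hr0.le
      · exact hu.continuous.comp hcons
      · simp only
        rw [show |f (Fin.cons (a 0) x')| ^ r = (f (Fin.cons (a 0) x') ^ 2) ^ (r / 2) by
          rw [← sq_abs, ← Real.rpow_natCast, ← Real.rpow_mul (abs_nonneg _)]
          congr 1; push_cast; ring]
        refine Real.rpow_le_rpow (sq_nonneg _) ?_ (by positivity)
        simp only [hg]
        nlinarith [sq_nonneg ε]
    rw [i1, i2] at hT
    linarith
  have hlim : Filter.Tendsto (fun ε : ℝ =>
      J * ((n - p) / (p - 1)) * (E / (((n - p) / p) ^ p * (q - 1) * J)) ^ ((n - 1) / (n - p)) +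
        W * ε ^ r) (nhdsWithin 0 (Ioi 0)) (nhds (J * ((n - p) / (p - 1)) *
          (E / (((n - p) / p) ^ p * (q - 1) * J)) ^ ((n - 1) / (n - p)) + W * 0)) := by
    refine (Filter.Tendsto.const_add _ (Filter.Tendsto.const_mul _ ?_)).mono_left
      nhdsWithin_le_nhds
    have := (Real.continuousAt_rpow_const 0 r (Or.inr hr0.le)).tendsto
    rwa [Real.zero_rpow hr0.ne'] at this
  rw [mul_zero, add_zero] at hlim
  exact ge_of_tendsto hlim (Filter.eventually_of_mem self_mem_nhdsWithin fun ε hε => key ε hε)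

theorem iUnion_box_eq (N : ℕ) :
    ⋃ k : ℕ, (univ.pi fun i : Fin (N + 1) =>
      Ioc ((Fin.cons 1 fun _ => -((k : ℝ) + 1) : Fin (N + 1) → ℝ) i) ((k : ℝ) + 2)) =
      {y | 1 < y 0} := by
  ext y
  simp only [mem_iUnion, mem_univ_pi, mem_Ioc]
  constructor
  · rintro ⟨k, hk⟩
    simpa using (hk 0).1
  · intro hy
    obtain ⟨k, hk⟩ := exists_nat_gt ‖y‖
    refine ⟨k, fun i => ?_⟩
    have h1 := abs_le.1 ((norm_le_pi_norm y i).trans hk.le)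
    refine ⟨?_, by linarith [h1.2]⟩
    refine Fin.cases (motive := fun i => (Fin.cons 1 fun _ => -((k : ℝ) + 1) :
      Fin (N + 1) → ℝ) i < y i) ?_ (fun j => ?_) i
    · simpa using hy
    · have h2 := abs_le.1 ((norm_le_pi_norm y j.succ).trans hk.le)
      simp only [Fin.cons_succ]
      linarith [h2.1]

theorem monotone_box (N : ℕ) :
    Monotone fun k : ℕ => (univ.pi fun i : Fin (N + 1) =>
      Ioc ((Fin.cons 1 fun _ => -((k : ℝ) + 1) : Fin (N + 1) → ℝ) i) ((k : ℝ) + 2)) := by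
  intro k l hkl
  have hkl' : (k : ℝ) ≤ l := by exact_mod_cast hkl
  refine pi_mono fun i _ => Ioc_subset_Ioc ?_ (by linarith)
  refine Fin.cases ?_ (fun j => ?_) i
  · simp
  · simp only [Fin.cons_succ]
    linarith

theorem trace_inequality_pi {N : ℕ} {p q : ℝ} (hp : 1 < p) (hpn : p < (N : ℝ) + 1)
    (hq : q = p / (p - 1)) {f S C : (Fin (N + 1) → ℝ) → ℝ} (hf : ContDiff ℝ 1 f)
    (hfc : HasCompactSupport f) (hS : Continuous S) (hS0 : ∀ x, 0 ≤ S x) (hSi : Integrable S)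
    (hC : Continuous C) (hChom : ∀ l : ℝ, 0 ≤ l → ∀ y, C (l • y) = l ^ q * C y) {δ : ℝ}
    (hδ : 0 < δ) (hCδ : ∀ y, 1 ≤ y 0 → δ ≤ C y)
    (hfS : ∀ x z, ∀ s : ℝ, 0 < s → |fderiv ℝ f x z| ≤ s ^ (-p) * S x + s ^ q * C z) {J : ℝ}
    (hJ : J = ∫ y in {y | 1 < y 0}, C y ^ (1 - ((N : ℝ) + 1))) (hJ0 : 0 < J)
    (hCi : IntegrableOn (fun y => C y ^ (1 - ((N : ℝ) + 1))) {y | 1 < y 0}) :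
    ∫ x' : Fin N → ℝ, |f (Fin.cons 0 x')| ^ (p * ((N : ℝ) + 1 - 1) / ((N : ℝ) + 1 - p)) ≤
      J * (((N : ℝ) + 1 - p) / (p - 1)) *
        ((∫ x in {x | 0 < x 0}, S x) / ((((N : ℝ) + 1 - p) / p) ^ p * (q - 1) * J)) ^
          (((N : ℝ) + 1 - 1) / ((N : ℝ) + 1 - p)) := by
  have hn0 : 0 < (N : ℝ) + 1 := by positivity
  have hp0 : 0 < p := by linarith
  have hp1 : 0 < p - 1 := by linarith
  have hnp : 0 < (N : ℝ) + 1 - p := by linarith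
  have hn1 : 0 < (N : ℝ) + 1 - 1 := by linarith
  have hq1 : 0 < q - 1 := by
    have : q - 1 = 1 / (p - 1) := by rw [hq]; field_simp; ring
    rw [this]; positivity
  set r : ℝ := p * ((N : ℝ) + 1 - 1) / ((N : ℝ) + 1 - p) with hr
  have hr0 : 0 < r := by positivity
  obtain ⟨R₀, hR₀⟩ := hfc.isCompact.isBounded.exists_norm_le
  set R : ℝ := max R₀ 0 + 1 with hR
  have hRpos : 0 < R := by positivity
  have hf0 : ∀ x i, R ≤ |x i| → f x = 0 := by
    intro x i hx
    by_contra h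
    have h1 := hR₀ x (subset_tsupport f h)
    have h2 := (norm_le_pi_norm x i).trans h1
    rw [Real.norm_eq_abs] at h2
    linarith [le_max_left R₀ 0]
  set a : Fin (N + 1) → ℝ := Fin.cons 0 fun _ => -R with ha
  set b : Fin (N + 1) → ℝ := fun _ => R with hb
  have hab : ∀ i, a i < b i := by
    intro i
    refine Fin.cases ?_ (fun j => ?_) i
    · simpa [ha, hb] using hRpos
    · simp [ha, hb]; linarith
  set c : ℕ → Fin (N + 1) → ℝ := fun k => Fin.cons 1 fun _ => -((k : ℝ) + 1) with hc
  set d : ℕ → Fin (N + 1) → ℝ := fun k _ => (k : ℝ) + 2 with hd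
  have hcd : ∀ k i, c k i < d k i := by
    intro k i
    have : (0 : ℝ) ≤ k := k.cast_nonneg
    refine Fin.cases ?_ (fun j => ?_) i
    · simp only [hc, hd, Fin.cons_zero]; linarith
    · simp only [hc, hd, Fin.cons_succ]; linarith
  have hleft : ∫ x' : Fin N → ℝ, |f (Fin.cons 0 x')| ^ r =
      ∫ x', |f (Fin.cons (a 0) x')| ^ r ∂boxMeas (Fin.tail a) (Fin.tail b) := by
    rw [boxMeas_eq, setIntegral_eq_integral_of_forall_compl_eq_zero]
    · simp [ha]
    · intro x hx
      simp only [mem_univ_pi, not_forall] at hx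
      obtain ⟨i, hi⟩ := hx
      have : f (Fin.cons (a 0) x) = 0 := by
        refine hf0 _ i.succ ?_
        simp only [Fin.cons_succ]
        by_contra h
        push Not at h
        have := abs_lt.1 h
        exact hi ⟨by simpa [ha, Fin.tail] using this.1, by simpa [hb, Fin.tail] using this.2.le⟩
      rw [this, abs_zero, Real.zero_rpow hr0.ne']
  set E₀ := ∫ x in {x : Fin (N + 1) → ℝ | 0 < x 0}, S x with hE₀
  have hE₀0 : 0 ≤ E₀ := integral_nonneg hS0
  have hE : ∫ x, S x ∂boxMeas a b ≤ E₀ := by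
    rw [boxMeas_eq]
    refine setIntegral_mono_set hSi.integrableOn (Filter.Eventually.of_forall hS0)
      (LE.le.eventuallyLE fun x hx => ?_)
    have := (hx 0 (mem_univ _)).1
    simpa [ha] using this
  set Φ : ℝ → ℝ → ℝ := fun E J => J * (((N : ℝ) + 1 - p) / (p - 1)) *
    (E / ((((N : ℝ) + 1 - p) / p) ^ p * (q - 1) * J)) ^ (((N : ℝ) + 1 - 1) / ((N : ℝ) + 1 - p))
    with hΦ
  set Jk : ℕ → ℝ := fun k => ∫ y, C y ^ (1 - ((N : ℝ) + 1)) ∂boxMeas (c k) (d k) with hJk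
  have key : ∀ k : ℕ, ∀ E, E₀ < E →
      ∫ x' : Fin N → ℝ, |f (Fin.cons 0 x')| ^ r ≤ Φ E (Jk k) := by
    intro k E hEE
    rw [hleft]
    refine box_trace_inequality hp hpn hq hab (hcd k) rfl hf hS hC hChom hδ (fun y hy => ?_) hfS
      (fun x _ i hi => ?_) (hE₀0.trans_lt hEE) (hE.trans hEE.le) rfl
    · exact hCδ y (by simpa [hc] using hy.1 0)
    · rcases hi with h | ⟨h, h'⟩
      · exact hf0 x i (by rw [h, hb]; exact le_abs_self R)
      · obtain ⟨j, rfl⟩ := Fin.exists_succ_eq.2 h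
        exact hf0 x j.succ (by rw [h', ha]; simp [abs_of_pos hRpos])
  have hJlim : Filter.Tendsto Jk Filter.atTop (nhds J) := by
    have h := tendsto_setIntegral_of_monotone (μ := volume)
      (f := fun y : Fin (N + 1) → ℝ => C y ^ (1 - ((N : ℝ) + 1)))
      (fun k => MeasurableSet.univ_pi fun i => measurableSet_Ioc) (monotone_box N)
      (by rw [iUnion_box_eq]; exact hCi)
    rw [iUnion_box_eq, ← hJ] at h
    refine h.congr fun k => ?_
    simp only [hJk, boxMeas_eq, hc, hd]
  have key2 : ∀ E, E₀ < E → ∫ x' : Fin N → ℝ, |f (Fin.cons 0 x')| ^ r ≤ Φ E J := by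
    intro E hEE
    have : ContinuousAt (fun J => Φ E J) J := by
      have hne : ((((N : ℝ) + 1 - p) / p) ^ p * (q - 1) * J) ≠ 0 := by positivity
      refine (continuousAt_id.mul continuousAt_const).mul
        (ContinuousAt.rpow_const (continuousAt_const.div
          (continuousAt_const.mul continuousAt_id) hne) (Or.inr (by positivity)))
    exact ge_of_tendsto' (this.tendsto.comp hJlim) fun k => key k E hEE
  have hlim : Filter.Tendsto (fun E => Φ E J) (nhdsWithin E₀ (Ioi E₀)) (nhds (Φ E₀ J)) := by
    have : ContinuousAt (fun E => Φ E J) E₀ :=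
      continuousAt_const.mul (ContinuousAt.rpow_const (continuousAt_id.div_const _)
        (Or.inr (by positivity)))
    exact this.tendsto.mono_left nhdsWithin_le_nhds
  exact ge_of_tendsto hlim (Filter.eventually_of_mem self_mem_nhdsWithin fun E hE => key2 E hE)

/-- Splitting off the first coordinate of `ℝ^(m+1)`. -/
def splitFirst (m : ℕ) : (Fin (m + 1) → ℝ) ≃ₗ[ℝ] ℝ × EuclideanSpace ℝ (Fin m) where
  toFun x := (x 0, WithLp.toLp 2 (Fin.tail x))
  invFun y := Fin.cons y.1 (WithLp.ofLp y.2)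
  map_add' x y := rfl
  map_smul' c x := rfl
  left_inv x := by simp
  right_inv y := by simp

theorem measurePreserving_splitFirst (m : ℕ) : MeasurePreserving (splitFirst m) := by
  have h1 := volume_preserving_piFinSuccAbove (fun _ : Fin (m + 1) => ℝ) 0
  have h2 := (MeasurePreserving.id (volume : Measure ℝ)).prod
    (PiLp.volume_preserving_toLp (Fin m))
  exact h2.comp h1

theorem measurableEmbedding_splitFirst (m : ℕ) : MeasurableEmbedding (splitFirst m) :=
  (splitFirst m).toContinuousLinearEquiv.toHomeomorph.measurableEmbedding

theorem trace_inequality_prod {m : ℕ} {p q : ℝ} (hp : 1 < p) (hpn : p < (m : ℝ) + 1)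
    (hq : q = p / (p - 1)) {f S C : ℝ × EuclideanSpace ℝ (Fin m) → ℝ} (hf : ContDiff ℝ 1 f)
    (hfc : HasCompactSupport f) (hS : Continuous S) (hS0 : ∀ x, 0 ≤ S x) (hSi : Integrable S)
    (hC : Continuous C) (hChom : ∀ l : ℝ, 0 ≤ l → ∀ y, C (l • y) = l ^ q * C y) {δ : ℝ}
    (hδ : 0 < δ) (hCδ : ∀ y, 1 ≤ y.1 → δ ≤ C y)
    (hfS : ∀ x z, ∀ s : ℝ, 0 < s → |fderiv ℝ f x z| ≤ s ^ (-p) * S x + s ^ q * C z) {J : ℝ}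
    (hJ : J = ∫ y in {y | 1 < y.1}, C y ^ (1 - ((m : ℝ) + 1))) (hJ0 : 0 < J)
    (hCi : IntegrableOn (fun y => C y ^ (1 - ((m : ℝ) + 1))) {y | 1 < y.1}) :
    ∫ x : EuclideanSpace ℝ (Fin m), |f (0, x)| ^ (p * ((m : ℝ) + 1 - 1) / ((m : ℝ) + 1 - p)) ≤
      J * (((m : ℝ) + 1 - p) / (p - 1)) *
        ((∫ x in {x | 0 < x.1}, S x) / ((((m : ℝ) + 1 - p) / p) ^ p * (q - 1) * J)) ^
          (((m : ℝ) + 1 - 1) / ((m : ℝ) + 1 - p)) := by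
  set L := (splitFirst m).toContinuousLinearEquiv with hL
  have hLm : MeasurePreserving L := measurePreserving_splitFirst m
  have hLe : MeasurableEmbedding L := measurableEmbedding_splitFirst m
  have hL0 : ∀ x, (L x).1 = x 0 := fun x => rfl
  have hfd : ∀ x z, fderiv ℝ (f ∘ L) x z = fderiv ℝ f (L x) (L z) := by
    intro x z
    rw [L.comp_right_fderiv]
    rfl
  have h := trace_inequality_pi hp hpn hq (f := f ∘ L) (S := S ∘ L) (C := C ∘ L)
    (hf.comp L.contDiff) (hfc.comp_homeomorph L.toHomeomorph) (hS.comp L.continuous)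
    (fun x => hS0 _) ((hLm.integrable_comp_emb hLe).2 hSi) (hC.comp L.continuous)
    (fun l hl y => by simp only [Function.comp, map_smul]; exact hChom l hl _) hδ
    (fun y hy => hCδ _ hy) (fun x z s hs => by rw [hfd]; exact hfS _ _ s hs) (J := J)
    (by rw [hJ]; exact (hLm.setIntegral_preimage_emb hLe _ _).symm) hJ0
    ((hLm.integrableOn_comp_preimage hLe (s := {y | 1 < y.1})).2 hCi)
  have e1 : ∫ x in {x | 0 < x 0}, (S ∘ L) x = ∫ x in {x | 0 < x.1}, S x :=
    hLm.setIntegral_preimage_emb hLe S {x | 0 < x.1}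
  rw [e1] at h
  refine le_trans (le_of_eq ?_) h
  rw [← (PiLp.volume_preserving_toLp (Fin m)).integral_comp
    (MeasurableEquiv.toLp 2 (Fin m → ℝ)).measurableEmbedding]
  rfl

section Cost

variable {E : Type*} [NormedAddCommGroup E] [NormedSpace ℝ E] {p q : ℝ} {C : E → ℝ}

/-- Even, convex, `q`-homogeneous functions which are positive away from the origin. -/
structure IsCost (q : ℝ) (C : E → ℝ) : Prop where
  nonneg : ∀ y, 0 ≤ C y
  even : ∀ y, C (-y) = C y
  convexOn : ConvexOn ℝ univ C
  hom : ∀ l : ℝ, 0 ≤ l → ∀ y, C (l • y) = l ^ q * C y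
  pos : ∀ y, y ≠ 0 → 0 < C y

namespace IsCost

theorem map_zero (hC : IsCost q C) (hq : 0 < q) : C 0 = 0 := by
  have := hC.hom 0 le_rfl 0
  rwa [zero_smul, Real.zero_rpow hq.ne', zero_mul] at this

theorem continuous [FiniteDimensional ℝ E] (hC : IsCost q C) : Continuous C :=
  hC.convexOn.locallyLipschitz.continuous

theorem map_eq_norm_rpow_mul (hC : IsCost q C) {y : E} (hy : y ≠ 0) :
    C y = ‖y‖ ^ q * C (‖y‖⁻¹ • y) := by
  rw [← hC.hom _ (norm_nonneg y), smul_smul, mul_inv_cancel₀ (norm_ne_zero_iff.2 hy), one_smul]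

theorem exists_bounds [FiniteDimensional ℝ E] (hC : IsCost q C) (hq : 0 < q) :
    ∃ c > 0, ∃ M > 0, ∀ y, c * ‖y‖ ^ q ≤ C y ∧ C y ≤ M * ‖y‖ ^ q := by
  have hK : IsCompact (Metric.sphere (0 : E) 1) := isCompact_sphere 0 1
  rcases (Metric.sphere (0 : E) 1).eq_empty_or_nonempty with he | hne
  · have h0 : ∀ y : E, y = 0 := by
      intro y
      by_contra hy
      have : ‖y‖⁻¹ • y ∈ Metric.sphere (0 : E) 1 := by
        simp [norm_smul, norm_ne_zero_iff.2 hy]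
      rw [he] at this
      exact this
    refine ⟨1, one_pos, 1, one_pos, fun y => ?_⟩
    rw [h0 y, hC.map_zero hq, norm_zero, Real.zero_rpow hq.ne']
    simp
  · obtain ⟨x, hx, hxm⟩ := hK.exists_isMinOn hne hC.continuous.continuousOn
    obtain ⟨z, hz, hzm⟩ := hK.exists_isMaxOn hne hC.continuous.continuousOn
    have hx0 : x ≠ 0 := by
      rintro rfl
      simp at hx
    have hz0 : z ≠ 0 := by
      rintro rfl
      simp at hz
    refine ⟨C x, hC.pos x hx0, C z, hC.pos z hz0, fun y => ?_⟩
    rcases eq_or_ne y 0 with rfl | hy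
    · rw [hC.map_zero hq, norm_zero, Real.zero_rpow hq.ne']
      simp
    · have hmem : ‖y‖⁻¹ • y ∈ Metric.sphere (0 : E) 1 := by
        simp [norm_smul, norm_ne_zero_iff.2 hy]
      rw [hC.map_eq_norm_rpow_mul hy, mul_comm (C x), mul_comm (C z)]
      exact ⟨mul_le_mul_of_nonneg_left (hxm hmem) (by positivity),
        mul_le_mul_of_nonneg_left (hzm hmem) (by positivity)⟩

theorem gauge_smul (hC : IsCost q C) (hq : 0 < q) {l : ℝ} (hl : 0 ≤ l) (y : E) :
    C (l • y) ^ q⁻¹ = l * C y ^ q⁻¹ := by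
  rw [hC.hom l hl, Real.mul_rpow (by positivity) (hC.nonneg y), ← Real.rpow_mul hl,
    mul_inv_cancel₀ hq.ne', Real.rpow_one]

/-- The gauge `C ^ (1 / q)` is subadditive. -/
theorem gauge_add_le (hC : IsCost q C) (hq : 0 < q) (y z : E) :
    C (y + z) ^ q⁻¹ ≤ C y ^ q⁻¹ + C z ^ q⁻¹ := by
  have hi : 0 < q⁻¹ := by positivity
  rcases eq_or_ne y 0 with rfl | hy
  · simp [hC.map_zero hq, Real.zero_rpow hi.ne']
  rcases eq_or_ne z 0 with rfl | hz
  · simp [hC.map_zero hq, Real.zero_rpow hi.ne']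
  set s := C y ^ q⁻¹ with hs
  set t := C z ^ q⁻¹ with ht
  have hs0 : 0 < s := Real.rpow_pos_of_pos (hC.pos y hy) _
  have ht0 : 0 < t := Real.rpow_pos_of_pos (hC.pos z hz) _
  have h1 : ∀ x : E, ∀ r : ℝ, r = C x ^ q⁻¹ → 0 < r → C (r⁻¹ • x) = 1 := by
    intro x r hr hr0
    have : C x = r ^ q := by
      rw [hr, ← Real.rpow_mul (hC.nonneg x), inv_mul_cancel₀ hq.ne', Real.rpow_one]
    rw [hC.hom _ (by positivity), this, Real.inv_rpow hr0.le]
    exact inv_mul_cancel₀ (by positivity)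
  have h2 := hC.convexOn.2 (mem_univ (s⁻¹ • y)) (mem_univ (t⁻¹ • z))
    (show 0 ≤ s / (s + t) by positivity) (show 0 ≤ t / (s + t) by positivity) (by field_simp)
  rw [h1 y s hs hs0, h1 z t ht ht0, smul_smul, smul_smul] at h2
  have h3 : y + z = (s + t) • ((s / (s + t) * s⁻¹) • y + (t / (s + t) * t⁻¹) • z) := by
    rw [smul_add, smul_smul, smul_smul]
    congr 1
    · rw [show (s + t) * (s / (s + t) * s⁻¹) = 1 by field_simp, one_smul]
    · rw [show (s + t) * (t / (s + t) * t⁻¹) = 1 by field_simp, one_smul]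
  have h4 : (s / (s + t)) • (1 : ℝ) + (t / (s + t)) • (1 : ℝ) = 1 := by
    simp only [smul_eq_mul]; field_simp
  rw [h4] at h2
  rw [h3, hC.gauge_smul hq (by positivity)]
  refine mul_le_of_le_one_right (by positivity) (Real.rpow_le_one (hC.nonneg _) h2 hi.le)

theorem exists_lipschitzWith_gauge [FiniteDimensional ℝ E] (hC : IsCost q C) (hq : 0 < q) :
    ∃ K, LipschitzWith K fun y => C y ^ q⁻¹ := by
  obtain ⟨c, hc, M, hM, h⟩ := hC.exists_bounds hq
  refine ⟨Real.toNNReal (M ^ q⁻¹), LipschitzWith.of_le_add_mul _ fun x y => ?_⟩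
  have h1 := hC.gauge_add_le hq y (x - y)
  rw [add_sub_cancel] at h1
  refine h1.trans (add_le_add_right ?_ _)
  rw [Real.coe_toNNReal _ (by positivity), dist_eq_norm]
  calc C (x - y) ^ q⁻¹ ≤ (M * ‖x - y‖ ^ q) ^ q⁻¹ :=
        Real.rpow_le_rpow (hC.nonneg _) (h _).2 (by positivity)
    _ = M ^ q⁻¹ * ‖x - y‖ := by
        rw [Real.mul_rpow hM.le (by positivity), ← Real.rpow_mul (norm_nonneg _),
          mul_inv_cancel₀ hq.ne', Real.rpow_one]

end IsCost

/-- The Legendre transform, as a function on the dual space. -/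
def conj (C : E → ℝ) (φ : E →L[ℝ] ℝ) : ℝ := ⨆ z, (φ z - C z)

namespace IsCost

theorem exists_young_bound [FiniteDimensional ℝ E] (hC : IsCost q C) (hpq : p.HolderConjugate q) :
    ∃ K, 0 < K ∧ ∀ (φ : E →L[ℝ] ℝ) (z : E), φ z - C z ≤ K * ‖φ‖ ^ p := by
  obtain ⟨c, hc, M, hM, h⟩ := hC.exists_bounds hpq.symm.pos
  have hq := hpq.symm.pos
  have hp := hpq.pos
  set l := (c * q) ^ q⁻¹ with hl
  have hl0 : 0 < l := by positivity
  refine ⟨l⁻¹ ^ p / p, by positivity, fun φ z => ?_⟩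
  have h1 := Real.young_inequality_of_nonneg (a := l⁻¹ * ‖φ‖) (b := l * ‖z‖) (by positivity)
    (by positivity) hpq
  have h2 : φ z ≤ ‖φ‖ * ‖z‖ := (le_abs_self _).trans (φ.le_opNorm z)
  have h3 : (l * ‖z‖) ^ q / q = c * ‖z‖ ^ q := by
    rw [Real.mul_rpow hl0.le (norm_nonneg _), hl, ← Real.rpow_mul (by positivity),
      inv_mul_cancel₀ hq.ne', Real.rpow_one]
    field_simp
  have h4 : l⁻¹ * ‖φ‖ * (l * ‖z‖) = ‖φ‖ * ‖z‖ := by field_simp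
  rw [h3, h4, Real.mul_rpow (by positivity) (norm_nonneg _)] at h1
  have := (h z).1
  calc φ z - C z ≤ l⁻¹ ^ p * ‖φ‖ ^ p / p := by linarith
    _ = _ := by ring

theorem bddAbove_conj [FiniteDimensional ℝ E] (hC : IsCost q C) (hpq : p.HolderConjugate q)
    (φ : E →L[ℝ] ℝ) : BddAbove (range fun z => φ z - C z) := by
  obtain ⟨K, -, hK⟩ := hC.exists_young_bound hpq
  exact ⟨K * ‖φ‖ ^ p, by rintro _ ⟨z, rfl⟩; exact hK φ z⟩

theorem exists_conj_le [FiniteDimensional ℝ E] (hC : IsCost q C) (hpq : p.HolderConjugate q) :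
    ∃ K, 0 < K ∧ ∀ φ : E →L[ℝ] ℝ, conj C φ ≤ K * ‖φ‖ ^ p := by
  obtain ⟨K, hK0, hK⟩ := hC.exists_young_bound hpq
  exact ⟨K, hK0, fun φ => ciSup_le (hK φ)⟩

theorem sub_le_conj [FiniteDimensional ℝ E] (hC : IsCost q C) (hpq : p.HolderConjugate q)
    (φ : E →L[ℝ] ℝ) (z : E) : φ z - C z ≤ conj C φ :=
  le_ciSup (hC.bddAbove_conj hpq φ) z

theorem conj_nonneg [FiniteDimensional ℝ E] (hC : IsCost q C) (hpq : p.HolderConjugate q)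
    (φ : E →L[ℝ] ℝ) : 0 ≤ conj C φ := by
  have := hC.sub_le_conj hpq φ 0
  rwa [_root_.map_zero, hC.map_zero hpq.symm.pos, sub_zero] at this

theorem conj_zero [FiniteDimensional ℝ E] (hC : IsCost q C) (hpq : p.HolderConjugate q) :
    conj C 0 = 0 := by
  refine le_antisymm (ciSup_le fun z => ?_) (hC.conj_nonneg hpq 0)
  simpa using hC.nonneg z

theorem conj_neg (hC : IsCost q C) (φ : E →L[ℝ] ℝ) : conj C (-φ) = conj C φ := by
  unfold conj
  rw [← (Equiv.neg E).iSup_comp]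
  simp [hC.even]

theorem conj_smul_le [FiniteDimensional ℝ E] (hC : IsCost q C) (hpq : p.HolderConjugate q) {l : ℝ}
    (hl : 0 < l) (φ : E →L[ℝ] ℝ) : conj C (l • φ) ≤ l ^ p * conj C φ := by
  refine ciSup_le fun z => ?_
  have h1 := mul_le_mul_of_nonneg_left (hC.sub_le_conj hpq φ (l ^ (1 - p) • z))
    (show 0 ≤ l ^ p by positivity)
  refine le_trans (le_of_eq ?_) h1
  rw [hC.hom _ (by positivity), map_smul, smul_eq_mul, smul_apply, smul_eq_mul,
    ← Real.rpow_mul hl.le, mul_sub, ← mul_assoc, ← mul_assoc, ← Real.rpow_add hl,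
    ← Real.rpow_add hl]
  have : p + (1 - p) * q = 0 := by
    have := hpq.mul_eq_add
    linarith
  rw [this, Real.rpow_zero, one_mul, add_sub_cancel, Real.rpow_one]

theorem conj_smul [FiniteDimensional ℝ E] (hC : IsCost q C) (hpq : p.HolderConjugate q) (l : ℝ)
    (φ : E →L[ℝ] ℝ) : conj C (l • φ) = |l| ^ p * conj C φ := by
  have main : ∀ {l : ℝ}, 0 < l → ∀ φ : E →L[ℝ] ℝ, conj C (l • φ) = l ^ p * conj C φ := by
    intro l hl φ
    refine le_antisymm (hC.conj_smul_le hpq hl φ) ?_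
    have := hC.conj_smul_le hpq (inv_pos.2 hl) (l • φ)
    rw [smul_smul, inv_mul_cancel₀ hl.ne', one_smul, Real.inv_rpow hl.le] at this
    rwa [← le_inv_mul_iff₀ (by positivity)]
  rcases lt_trichotomy l 0 with h | h | h
  · rw [abs_of_neg h, ← main (neg_pos.2 h), ← hC.conj_neg, neg_smul l φ]
  · rw [h, zero_smul, hC.conj_zero hpq, abs_zero, Real.zero_rpow hpq.pos.ne', zero_mul]
  · rw [abs_of_pos h, main h]

theorem abs_apply_le [FiniteDimensional ℝ E] (hC : IsCost q C) (hpq : p.HolderConjugate q)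
    (φ : E →L[ℝ] ℝ) (z : E) {s : ℝ} (hs : 0 < s) :
    |φ z| ≤ s ^ (-p) * conj C φ + s ^ q * C z := by
  have main : ∀ φ : E →L[ℝ] ℝ, φ z ≤ s ^ (-p) * conj C φ + s ^ q * C z := by
    intro φ
    have h1 := hC.sub_le_conj hpq (s⁻¹ • φ) (s • z)
    rw [hC.conj_smul hpq, abs_of_pos (inv_pos.2 hs), Real.inv_rpow hs.le, ← Real.rpow_neg hs.le,
      hC.hom _ hs.le, smul_apply, map_smul, smul_smul,
      inv_mul_cancel₀ hs.ne', one_smul] at h1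
    linarith
  refine abs_le.2 ⟨?_, main φ⟩
  have := main (-φ)
  rw [hC.conj_neg, neg_apply] at this
  linarith

theorem convexOn_conj [FiniteDimensional ℝ E] (hC : IsCost q C) (hpq : p.HolderConjugate q) :
    ConvexOn ℝ univ (conj C) := by
  refine ⟨convex_univ, fun φ _ ψ _ s t hs ht hst => ciSup_le fun z => ?_⟩
  have h1 := mul_le_mul_of_nonneg_left (hC.sub_le_conj hpq φ z) hs
  have h2 := mul_le_mul_of_nonneg_left (hC.sub_le_conj hpq ψ z) ht
  simp only [add_apply, smul_apply, smul_eq_mul]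
  have h3 : C z = s * C z + t * C z := by rw [← add_mul, hst, one_mul]
  linarith

theorem continuous_conj [FiniteDimensional ℝ E] (hC : IsCost q C) (hpq : p.HolderConjugate q) :
    Continuous (conj C) :=
  (hC.convexOn_conj hpq).locallyLipschitz.continuous

/-- Euler's identity. -/
theorem fderiv_apply_self (hC : IsCost q C) {z : E} (hz : DifferentiableAt ℝ C z) :
    fderiv ℝ C z z = q * C z := by
  have h1 : HasDerivAt (fun l : ℝ => l • z) z 1 := by
    simpa using (hasDerivAt_id (1 : ℝ)).smul_const z
  have h2 : HasDerivAt (fun l : ℝ => C (l • z)) (fderiv ℝ C z z) 1 := by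
    have h3 : HasFDerivAt C (fderiv ℝ C z) ((1 : ℝ) • z) := by
      rw [one_smul]; exact hz.hasFDerivAt
    exact h3.comp_hasDerivAt 1 h1
  have h4 : HasDerivAt (fun l : ℝ => l ^ q * C z) (q * 1 ^ (q - 1) * C z) 1 :=
    (Real.hasDerivAt_rpow_const (Or.inl one_ne_zero)).mul_const _
  have h5 : (fun l : ℝ => C (l • z)) =ᶠ[nhds 1] fun l => l ^ q * C z := by
    filter_upwards [lt_mem_nhds (show (0 : ℝ) < 1 from one_pos)] with l hl
    exact hC.hom l hl.le z
  have := h2.unique (h4.congr_of_eventuallyEq h5)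
  rwa [Real.one_rpow, mul_one] at this

theorem fderiv_apply_sub_le (hC : IsCost q C) {z : E} (hz : DifferentiableAt ℝ C z) (x : E) :
    fderiv ℝ C z (x - z) ≤ C x - C z := by
  have h1 : HasDerivAt (fun t : ℝ => AffineMap.lineMap z x t) (x - z) 0 := by
    have := (AffineMap.lineMap z x : ℝ →ᵃ[ℝ] E).hasDerivAt (x := 0)
    simpa using this
  have h2 : HasDerivAt (fun t : ℝ => C (AffineMap.lineMap z x t)) (fderiv ℝ C z (x - z)) 0 := by
    have h3 : HasFDerivAt C (fderiv ℝ C z) (AffineMap.lineMap z x (0 : ℝ)) := by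
      rw [AffineMap.lineMap_apply_zero]; exact hz.hasFDerivAt
    exact h3.comp_hasDerivAt 0 h1
  have h4 : ConvexOn ℝ univ fun t : ℝ => C (AffineMap.lineMap z x t) :=
    hC.convexOn.comp_affineMap (AffineMap.lineMap z x)
  have := h4.le_slope_of_hasDerivAt (mem_univ 0) (mem_univ 1) one_pos h2
  simpa [slope_def_field] using this

theorem conj_fderiv [FiniteDimensional ℝ E] (hC : IsCost q C) (hpq : p.HolderConjugate q) {z : E}
    (hz : DifferentiableAt ℝ C z) : conj C (fderiv ℝ C z) = (q - 1) * C z := by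
  have h0 := hC.fderiv_apply_self hz
  refine le_antisymm (ciSup_le fun x => ?_) ?_
  · have := hC.fderiv_apply_sub_le hz x
    rw [map_sub] at this
    linarith
  · have := hC.sub_le_conj hpq (fderiv ℝ C z) z
    linarith

end IsCost

end Cost

section CostIntegrals

variable {m : ℕ} {p q : ℝ} {C : ℝ × EuclideanSpace ℝ (Fin m) → ℝ}

instance isAddHaarMeasure_volume_prod (m : ℕ) :
    (volume : Measure (ℝ × EuclideanSpace ℝ (Fin m))).IsAddHaarMeasure :=
  Measure.prod.instIsAddHaarMeasure _ _

theorem IsCost.exists_rpow_le (hC : IsCost q C) (hq : 0 < q) {e : ℝ} (he : e ≤ 0) :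
    ∃ K, ∀ (y : ℝ × EuclideanSpace ℝ (Fin m)) (t : ℝ), 0 ≤ t → 1 + t ≤ 2 * ‖y‖ →
      C y ^ e ≤ K * (1 + t) ^ (-(q * -e)) := by
  obtain ⟨c, hc, M, hM, h⟩ := hC.exists_bounds hq
  refine ⟨(c / 2 ^ q) ^ e, fun y t ht hy => ?_⟩
  have h1 : c / 2 ^ q * (1 + t) ^ q ≤ C y := by
    refine le_trans ?_ (h y).1
    calc c / 2 ^ q * (1 + t) ^ q ≤ c / 2 ^ q * (2 * ‖y‖) ^ q := by gcongr
      _ = c * ‖y‖ ^ q := by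
        rw [Real.mul_rpow two_pos.le (norm_nonneg y)]
        field_simp
  calc C y ^ e ≤ (c / 2 ^ q * (1 + t) ^ q) ^ e :=
        Real.rpow_le_rpow_of_nonpos (by positivity) h1 he
    _ = _ := by
        rw [Real.mul_rpow (by positivity) (by positivity), ← Real.rpow_mul (by positivity)]
        congr 2
        ring

theorem IsCost.integrableOn_rpow (hC : IsCost q C) (hq : 0 < q) {e : ℝ} (he : e ≤ 0)
    (hqe : (m : ℝ) + 1 < q * -e) : IntegrableOn (fun y => C y ^ e) {y | 1 < y.1} := by
  obtain ⟨K, hK⟩ := hC.exists_rpow_le hq he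
  have hi : Integrable (fun y : ℝ × EuclideanSpace ℝ (Fin m) => K * (1 + ‖y‖) ^ (-(q * -e))) := by
    refine (integrable_one_add_norm (μ := volume) ?_).const_mul K
    rw [Module.finrank_prod, Module.finrank_self, finrank_euclideanSpace_fin]
    push_cast
    linarith
  refine Integrable.mono' hi.integrableOn ?_ ?_
  · exact (hC.continuous.measurable.pow_const e).aestronglyMeasurable
  · refine (ae_restrict_iff' (measurableSet_lt measurable_const measurable_fst)).2
      (Filter.Eventually.of_forall fun y hy => ?_)
    rw [Real.norm_of_nonneg (Real.rpow_nonneg (hC.nonneg y) e)]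
    refine hK y ‖y‖ (norm_nonneg y) ?_
    have h1 : 1 < y.1 := hy
    have h2 : |y.1| ≤ ‖y‖ := norm_fst_le y
    linarith [le_abs_self y.1]

theorem IsCost.integrable_rpow_slice (hC : IsCost q C) (hq : 0 < q) {e : ℝ} (he : e ≤ 0)
    (hqe : (m : ℝ) < q * -e) : Integrable (fun x : EuclideanSpace ℝ (Fin m) => C (1, x) ^ e) := by
  obtain ⟨K, hK⟩ := hC.exists_rpow_le hq he
  have hi : Integrable (fun x : EuclideanSpace ℝ (Fin m) => K * (1 + ‖x‖) ^ (-(q * -e))) := by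
    refine (integrable_one_add_norm (μ := volume) ?_).const_mul K
    simpa using hqe
  refine Integrable.mono' hi ?_ (Filter.Eventually.of_forall fun x => ?_)
  · exact ((hC.continuous.comp (continuous_const.prodMk continuous_id)).measurable.pow_const
      e).aestronglyMeasurable
  · rw [Real.norm_of_nonneg (Real.rpow_nonneg (hC.nonneg _) e)]
    refine hK _ ‖x‖ (norm_nonneg x) ?_
    have h1 : |(1 : ℝ)| ≤ ‖((1 : ℝ), x)‖ := norm_fst_le ((1 : ℝ), x)
    have h2 : ‖x‖ ≤ ‖((1 : ℝ), x)‖ := norm_snd_le ((1 : ℝ), x)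
    rw [abs_one] at h1
    linarith

theorem setIntegral_halfSpace_eq {h : ℝ × EuclideanSpace ℝ (Fin m) → ℝ}
    (hi : IntegrableOn h {y | 0 < y.1}) :
    ∫ y in {y | 0 < y.1}, h y = ∫ t in Ioi (0 : ℝ), t ^ m * ∫ z, h (t, t • z) := by
  have hs : {y : ℝ × EuclideanSpace ℝ (Fin m) | 0 < y.1} = Ioi (0 : ℝ) ×ˢ univ := by
    ext y; simp
  rw [hs] at hi ⊢
  rw [Measure.volume_eq_prod] at hi ⊢
  rw [setIntegral_prod _ hi]
  refine setIntegral_congr_fun measurableSet_Ioi fun t ht => ?_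
  have ht0 : 0 < t := ht
  simp only [Measure.restrict_univ]
  rw [Measure.integral_comp_smul volume (fun x => h (t, x)) t, finrank_euclideanSpace_fin,
    abs_of_pos (by positivity), smul_eq_mul, ← mul_assoc, mul_inv_cancel₀ (by positivity), one_mul]

theorem IsCost.map_smul_slice (hC : IsCost q C) {t : ℝ} (ht : 0 < t)
    (z : EuclideanSpace ℝ (Fin m)) : C (t, t • z) = t ^ q * C (1, z) := by
  rw [← hC.hom t ht.le]
  simp

theorem IsCost.setIntegral_rpow (hC : IsCost q C) (hq : 0 < q) {e : ℝ} (he : e ≤ 0)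
    (hqe : (m : ℝ) + 1 < q * -e) :
    ∫ y in {y | 1 < y.1}, C y ^ e = (∫ x, C (1, x) ^ e) / (q * -e - (m + 1)) := by
  have hsub : {y : ℝ × EuclideanSpace ℝ (Fin m) | 1 < y.1} ⊆ {y | 0 < y.1} :=
    fun y (hy : 1 < y.1) => show 0 < y.1 from one_pos.trans hy
  have hms : MeasurableSet {y : ℝ × EuclideanSpace ℝ (Fin m) | 1 < y.1} :=
    measurableSet_lt measurable_const measurable_fst
  have h1 : ∫ y in {y | 1 < y.1}, C y ^ e =
      ∫ y in {y : ℝ × EuclideanSpace ℝ (Fin m) | 0 < y.1},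
        ({y : ℝ × EuclideanSpace ℝ (Fin m) | 1 < y.1}.indicator fun y => C y ^ e) y := by
    rw [setIntegral_indicator hms, inter_eq_right.2 hsub]
  have hi : IntegrableOn ({y : ℝ × EuclideanSpace ℝ (Fin m) | 1 < y.1}.indicator fun y => C y ^ e)
      {y | 0 < y.1} :=
    ((integrable_indicator_iff hms).2 (hC.integrableOn_rpow hq he hqe)).integrableOn
  rw [h1, setIntegral_halfSpace_eq hi]
  have h2 : ∫ t in Ioi (0 : ℝ), t ^ m * ∫ z : EuclideanSpace ℝ (Fin m),
        ({y : ℝ × EuclideanSpace ℝ (Fin m) | 1 < y.1}.indicator fun y => C y ^ e) (t, t • z) =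
      ∫ t in Ioi (0 : ℝ), (Ioi (1 : ℝ)).indicator
        (fun t => t ^ ((m : ℝ) + q * e) * ∫ x, C (1, x) ^ e) t := by
    refine setIntegral_congr_fun measurableSet_Ioi fun t ht => ?_
    have ht0 : 0 < t := ht
    by_cases ht1 : 1 < t
    · rw [indicator_of_mem (show t ∈ Ioi (1 : ℝ) from ht1)]
      have : ∀ z : EuclideanSpace ℝ (Fin m),
          ({y : ℝ × EuclideanSpace ℝ (Fin m) | 1 < y.1}.indicator fun y => C y ^ e) (t, t • z) =
          t ^ (q * e) * C (1, z) ^ e := by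
        intro z
        rw [indicator_of_mem (show (t, t • z) ∈
          {y : ℝ × EuclideanSpace ℝ (Fin m) | 1 < y.1} from ht1), hC.map_smul_slice ht0,
          Real.mul_rpow (by positivity) (hC.nonneg _), ← Real.rpow_mul ht0.le]
      simp_rw [this]
      rw [integral_const_mul, ← mul_assoc, Real.rpow_add ht0, Real.rpow_natCast]
    · rw [indicator_of_notMem (show t ∉ Ioi (1 : ℝ) from ht1)]
      have : ∀ z : EuclideanSpace ℝ (Fin m),
          ({y : ℝ × EuclideanSpace ℝ (Fin m) | 1 < y.1}.indicator fun y => C y ^ e) (t, t • z) =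
          0 := fun z => indicator_of_notMem (show (t, t • z) ∉
          {y : ℝ × EuclideanSpace ℝ (Fin m) | 1 < y.1} from ht1) _
      simp_rw [this]
      simp
  rw [h2, setIntegral_indicator measurableSet_Ioi,
    inter_eq_right.2 (Ioi_subset_Ioi zero_le_one), integral_mul_const,
    integral_Ioi_rpow_of_lt (by linarith) one_pos, Real.one_rpow]
  have h3 : (m : ℝ) + q * e + 1 = -(q * -e - (m + 1)) := by ring
  rw [h3, neg_div_neg_eq]
  ring

theorem IsCost.setIntegral_sublevel (hC : IsCost q C) (hq : 0 < q) {e : ℝ} (he : e ≤ 0)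
    (hqe : (m : ℝ) + 1 < q * -e) :
    ∫ y in {y | C y ≤ 1} ∩ {y | 0 < y.1}, y.1 ^ (q * -e - (m + 1)) =
      (∫ x, C (1, x) ^ e) / (q * -e) := by
  obtain ⟨c, hc, M, hM, hb⟩ := hC.exists_bounds hq
  set r := q * -e - (m + 1) with hr
  have hr0 : 0 < r := by linarith
  have hqe0 : 0 < q * -e := by have : (0 : ℝ) ≤ m := m.cast_nonneg; linarith
  set s : Set (ℝ × EuclideanSpace ℝ (Fin m)) := {y | C y ≤ 1} with hs
  have hsm : MeasurableSet s := measurableSet_le hC.continuous.measurable measurable_const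
  have hpm : MeasurableSet {y : ℝ × EuclideanSpace ℝ (Fin m) | 0 < y.1} :=
    measurableSet_lt measurable_const measurable_fst
  have hbd : Bornology.IsBounded s := by
    refine (Metric.isBounded_iff_subset_closedBall 0).2 ⟨c⁻¹ ^ q⁻¹, fun y hy => ?_⟩
    rw [mem_closedBall_zero_iff]
    have h1 : ‖y‖ ^ q ≤ c⁻¹ := by
      rw [← one_div, le_div_iff₀ hc, mul_comm]
      exact (hb y).1.trans hy
    calc ‖y‖ = (‖y‖ ^ q) ^ q⁻¹ := by
          rw [← Real.rpow_mul (norm_nonneg y), mul_inv_cancel₀ hq.ne', Real.rpow_one]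
      _ ≤ _ := Real.rpow_le_rpow (by positivity) h1 (by positivity)
  have hcpt : IsCompact s :=
    Metric.isCompact_of_isClosed_isBounded (isClosed_le hC.continuous continuous_const) hbd
  set h : ℝ × EuclideanSpace ℝ (Fin m) → ℝ := s.indicator fun y => y.1 ^ r with hh
  have hi : Integrable h := by
    refine (integrable_indicator_iff hsm).2 (ContinuousOn.integrableOn_compact hcpt ?_)
    exact (continuous_fst.rpow_const fun _ => Or.inr hr0.le).continuousOn
  have h1 : ∫ y in s ∩ {y | 0 < y.1}, y.1 ^ r =
      ∫ y in {y : ℝ × EuclideanSpace ℝ (Fin m) | 0 < y.1}, h y := by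
    rw [setIntegral_indicator hsm, inter_comm]
  rw [h1, setIntegral_halfSpace_eq hi.integrableOn]
  set g : ℝ × EuclideanSpace ℝ (Fin m) → ℝ :=
    ({y | 0 < y.1} ∩ {y | y.1 ^ q * C (1, y.2) ≤ 1}).indicator fun y => y.1 ^ (q * -e - 1) with hg
  have hslice : Continuous fun x : EuclideanSpace ℝ (Fin m) => C (1, x) :=
    hC.continuous.comp (continuous_const.prodMk continuous_id)
  have hg1 : ∀ t : ℝ, 0 < t → t ^ m * ∫ z, h (t, t • z) = ∫ z, g (t, z) := by
    intro t ht
    rw [← integral_const_mul]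
    refine integral_congr_ae (Filter.Eventually.of_forall fun z => ?_)
    simp only [hh, hg, indicator_apply, hs, mem_inter_iff, mem_ofPred_eq, hC.map_smul_slice ht, ht,
      true_and]
    split_ifs
    · rw [← Real.rpow_natCast, ← Real.rpow_add ht]
      congr 1
      rw [hr]; ring
    · simp
  have hgm : Measurable g := by
    refine Measurable.indicator (measurable_fst.pow_const _) (hpm.inter ?_)
    exact measurableSet_le ((measurable_fst.pow_const q).mul
      (hslice.measurable.comp measurable_snd)) measurable_const
  have hCpos : ∀ z : EuclideanSpace ℝ (Fin m), 0 < C (1, z) := fun z => hC.pos _ (by simp)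
  have hg2 : ∀ z : EuclideanSpace ℝ (Fin m), (fun t => g (t, z)) =
      (Ioc 0 (C (1, z) ^ (-q⁻¹))).indicator fun t => t ^ (q * -e - 1) := by
    intro z
    ext t
    have hiff : ((0 < t) ∧ t ^ q * C (1, z) ≤ 1) ↔ t ∈ Ioc 0 (C (1, z) ^ (-q⁻¹)) := by
      rw [mem_Ioc]
      refine and_congr_right fun ht => ?_
      rw [← le_div_iff₀ (hCpos z), Real.rpow_neg (hCpos z).le, one_div,
        ← Real.inv_rpow (hCpos z).le, Real.le_rpow_inv_iff_of_pos ht.le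
          (inv_nonneg.2 (hCpos z).le) hq]
    simp only [hg, indicator_apply, mem_inter_iff, mem_ofPred_eq, hiff]
  have hg3 : ∀ z : EuclideanSpace ℝ (Fin m), ∫ t, g (t, z) = C (1, z) ^ e / (q * -e) := by
    intro z
    rw [hg2 z, integral_indicator measurableSet_Ioc,
      ← intervalIntegral.integral_of_le (Real.rpow_nonneg (hCpos z).le _),
      integral_rpow (Or.inl (by linarith)), sub_add_cancel, Real.zero_rpow hqe0.ne', sub_zero,
      ← Real.rpow_mul (hCpos z).le]
    congr 2
    field_simp
  have hg0 : ∀ y, 0 ≤ g y := by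
    intro y
    refine indicator_nonneg (fun y hy => ?_) y
    exact Real.rpow_nonneg (le_of_lt hy.1) _
  have hgi : Integrable g (volume.prod volume) := by
    rw [integrable_prod_iff' hgm.aestronglyMeasurable]
    refine ⟨Filter.Eventually.of_forall fun z => ?_, ?_⟩
    · rw [hg2 z, integrable_indicator_iff measurableSet_Ioc,
        ← intervalIntegrable_iff_integrableOn_Ioc_of_le (Real.rpow_nonneg (hCpos z).le _)]
      exact intervalIntegral.intervalIntegrable_rpow' (by linarith)
    · simp_rw [Real.norm_of_nonneg (hg0 _), hg3]
      exact (hC.integrable_rpow_slice hq he (by linarith)).div_const _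
  rw [setIntegral_congr_fun measurableSet_Ioi fun t ht => hg1 t ht]
  have h4 : ∫ t in Ioi (0 : ℝ), ∫ z, g (t, z) = ∫ t, ∫ z, g (t, z) := by
    refine setIntegral_eq_integral_of_forall_compl_eq_zero fun t ht => ?_
    have : ∀ z, g (t, z) = 0 := fun z => indicator_of_notMem (fun hmem => ht hmem.1) _
    simp [this]
  rw [h4, ← integral_prod _ hgi, integral_prod_symm _ hgi]
  simp_rw [hg3]
  rw [integral_div]

end CostIntegrals

section TraceConstant

variable {m : ℕ} {p q : ℝ} {C : ℝ × EuclideanSpace ℝ (Fin m) → ℝ}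

theorem legendreP_fderiv_gradient (C : ℝ × EuclideanSpace ℝ (Fin m) → ℝ)
    {f : ℝ × EuclideanSpace ℝ (Fin m) → ℝ} {y : ℝ × EuclideanSpace ℝ (Fin m)}
    (hf : DifferentiableAt ℝ f y) :
    legendreP C (fderiv ℝ f y (1, 0), gradient (fun x => f (y.1, x)) y.2) =
      conj C (fderiv ℝ f y) := by
  unfold legendreP conj
  congr 1
  ext z
  congr 1
  have h1 : HasFDerivAt (fun x => f (y.1, x))
      ((fderiv ℝ f y).comp (ContinuousLinearMap.inr ℝ ℝ (EuclideanSpace ℝ (Fin m)))) y.2 :=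
    HasFDerivAt.comp y.2 (f := fun x => (y.1, x)) (g := f) hf.hasFDerivAt
      (hasFDerivAt_prodMk_right y.1 y.2)
  have h2 : ⟪gradient (fun x => f (y.1, x)) y.2, z.2⟫ = fderiv ℝ f y (0, z.2) := by
    rw [gradient, InnerProductSpace.toDual_symm_apply, h1.fderiv]
    simp
  unfold pairP
  simp only
  rw [h2, mul_comm, ← smul_eq_mul, ← map_smul, ← map_add]
  simp

theorem mul_sub_add_pos_of_holder (hp : 1 < p) (hpn : p < (m : ℝ) + 1) (hq : q = p / (p - 1)) :
    (m : ℝ) + 1 < q * -(1 - ((m : ℝ) + 1)) := by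
  have h1 : 0 < p - 1 := by linarith
  rw [hq, div_mul_eq_mul_div, lt_div_iff₀ h1]
  nlinarith

theorem holderConjugate_of_eq_div (hp : 1 < p) (hq : q = p / (p - 1)) : p.HolderConjugate q := by
  rw [hq]
  exact Real.HolderConjugate.conjExponent hp

theorem IsCost.integral_slice_pos (hC : IsCost q C) (hp : 1 < p) (hpn : p < (m : ℝ) + 1)
    (hq : q = p / (p - 1)) :
    0 < ∫ x : EuclideanSpace ℝ (Fin m), C (1, x) ^ (1 - ((m : ℝ) + 1)) := by
  have hq0 : 0 < q := (holderConjugate_of_eq_div hp hq).symm.pos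
  have hpos : ∀ x : EuclideanSpace ℝ (Fin m), 0 < C (1, x) ^ (1 - ((m : ℝ) + 1)) :=
    fun x => Real.rpow_pos_of_pos (hC.pos _ (by simp)) _
  have hi := hC.integrable_rpow_slice hq0 (e := 1 - ((m : ℝ) + 1)) (by simp)
    (by linarith [mul_sub_add_pos_of_holder hp hpn hq])
  rw [integral_pos_iff_support_of_nonneg (fun x => (hpos x).le) hi]
  have : Function.support (fun x : EuclideanSpace ℝ (Fin m) =>
      C (1, x) ^ (1 - ((m : ℝ) + 1))) = univ :=
    eq_univ_of_forall fun x => (hpos x).ne'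
  rw [this]
  exact isOpen_univ.measure_pos _ univ_nonempty

theorem IsCost.setIntegral_rpow_eq (hC : IsCost q C) (hp : 1 < p) (hpn : p < (m : ℝ) + 1)
    (hq : q = p / (p - 1)) :
    ∫ y in {y | 1 < y.1}, C y ^ (1 - ((m : ℝ) + 1)) =
      (∫ x, C (1, x) ^ (1 - ((m : ℝ) + 1))) * ((p - 1) / ((m : ℝ) + 1 - p)) := by
  have hq0 : 0 < q := (holderConjugate_of_eq_div hp hq).symm.pos
  have h1 : 0 < p - 1 := by linarith
  have h2 : 0 < (m : ℝ) + 1 - p := by linarith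
  rw [hC.setIntegral_rpow hq0 (by simp) (mul_sub_add_pos_of_holder hp hpn hq)]
  have h3 : q * -(1 - ((m : ℝ) + 1)) - (m + 1) = ((m : ℝ) + 1 - p) / (p - 1) := by
    rw [hq]; field_simp; ring
  rw [h3, div_eq_mul_inv, inv_div]

/-- The sharp constant of the trace inequality in terms of the boundary integral
`∫ C(1, x) ^ (1 - n) dx`, where `n = m + 1`. -/
def traceConst (p : ℝ) (C : ℝ × EuclideanSpace ℝ (Fin m) → ℝ) : ℝ :=
  p ^ p * ((m : ℝ) + 1 - p) ^ (1 - p) *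
    (∫ x : EuclideanSpace ℝ (Fin m), C (1, x) ^ (1 - ((m : ℝ) + 1))) ^ (-((p - 1) / m))

theorem IsCost.traceConst_eq (hC : IsCost q C) (hp : 1 < p) (hpn : p < (m : ℝ) + 1)
    (hq : q = p / (p - 1)) :
    traceConst p C =
      (∫ x, C (1, x) ^ (1 - ((m : ℝ) + 1))) ^ (((m : ℝ) + 1 - p) / ((m : ℝ) + 1 - 1)) /
        ((((m : ℝ) + 1 - p) / p) ^ p * (q - 1) *
          ∫ y in {y | 1 < y.1}, C y ^ (1 - ((m : ℝ) + 1))) := by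
  have hB := hC.integral_slice_pos hp hpn hq
  rw [hC.setIntegral_rpow_eq hp hpn hq, traceConst]
  set B := ∫ x : EuclideanSpace ℝ (Fin m), C (1, x) ^ (1 - ((m : ℝ) + 1))
  have hp0 : 0 < p := by linarith
  have h1 : 0 < p - 1 := by linarith
  have h2 : 0 < (m : ℝ) + 1 - p := by linarith
  have hm : (0 : ℝ) < m := by linarith
  have h3 : (q - 1) * (B * ((p - 1) / ((m : ℝ) + 1 - p))) = B / ((m : ℝ) + 1 - p) := by
    rw [hq]; field_simp; ring
  rw [mul_assoc _ (q - 1), h3, Real.div_rpow h2.le hp0.le, Real.rpow_sub h2, Real.rpow_one]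
  have h4 : B ^ (-((p - 1) / m)) = B ^ (((m : ℝ) + 1 - p) / ((m : ℝ) + 1 - 1)) / B := by
    rw [← Real.rpow_sub_one hB.ne', add_sub_cancel_right]
    congr 1
    field_simp
    ring
  rw [h4]
  field_simp

theorem IsCost.trace_inequality (hC : IsCost q C) (hp : 1 < p) (hpn : p < (m : ℝ) + 1)
    (hq : q = p / (p - 1)) {f : ℝ × EuclideanSpace ℝ (Fin m) → ℝ} (hf : ContDiff ℝ 1 f)
    (hfc : HasCompactSupport f) :
    (∫ x, |f (0, x)| ^ (p * ((m : ℝ) + 1 - 1) / ((m : ℝ) + 1 - p))) ^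
        (((m : ℝ) + 1 - p) / ((m : ℝ) + 1 - 1)) ≤
      traceConst p C * ∫ y in {y | 0 < y.1}, conj C (fderiv ℝ f y) := by
  have hpq := holderConjugate_of_eq_div hp hq
  have hq0 := hpq.symm.pos
  obtain ⟨c, hc, M, hM, hb⟩ := hC.exists_bounds hq0
  have hScont : Continuous fun y => conj C (fderiv ℝ f y) :=
    (hC.continuous_conj hpq).comp (hf.continuous_fderiv one_ne_zero)
  have hScs : HasCompactSupport fun y => conj C (fderiv ℝ f y) :=
    (hfc.fderiv (𝕜 := ℝ)).comp_left (hC.conj_zero hpq)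
  have hB := hC.integral_slice_pos hp hpn hq
  have hJB := hC.setIntegral_rpow_eq hp hpn hq
  have h1 : 0 < p - 1 := by linarith
  have h2 : 0 < (m : ℝ) + 1 - p := by linarith
  have hm : (0 : ℝ) < m := by linarith
  have hJ0 : 0 < ∫ y in {y | 1 < y.1}, C y ^ (1 - ((m : ℝ) + 1)) := by
    rw [hJB]; positivity
  have key := trace_inequality_prod hp hpn hq hf hfc hScont (fun y => hC.conj_nonneg hpq _)
    (hScont.integrable_of_hasCompactSupport hScs) hC.continuous hC.hom hc
    (fun y hy => by
      refine le_trans ?_ (hb y).1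
      have h3 : 1 ≤ ‖y‖ := hy.trans ((le_abs_self _).trans (norm_fst_le y))
      have h4 := Real.one_le_rpow h3 hq0.le
      nlinarith)
    (fun x z s hs => hC.abs_apply_le hpq _ z hs) rfl hJ0
    (hC.integrableOn_rpow hq0 (by simp) (mul_sub_add_pos_of_holder hp hpn hq))
  set E := ∫ y in {y | 0 < y.1}, conj C (fderiv ℝ f y)
  have hE0 : 0 ≤ E := integral_nonneg fun y => hC.conj_nonneg hpq _
  have hJB' : (∫ y in {y | 1 < y.1}, C y ^ (1 - ((m : ℝ) + 1))) * (((m : ℝ) + 1 - p) / (p - 1)) =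
      ∫ x, C (1, x) ^ (1 - ((m : ℝ) + 1)) := by
    rw [hJB]; field_simp
  rw [hJB'] at key
  rw [hC.traceConst_eq hp hpn hq]
  set B := ∫ x : EuclideanSpace ℝ (Fin m), C (1, x) ^ (1 - ((m : ℝ) + 1))
  set J := ∫ y in {y | 1 < y.1}, C y ^ (1 - ((m : ℝ) + 1))
  have hq1 : 0 < q - 1 := by linarith [hpq.symm.lt]
  have hD : 0 < (((m : ℝ) + 1 - p) / p) ^ p * (q - 1) * J := by
    have : 0 < p := by linarith
    positivity
  have hm' : (m : ℝ) + 1 - 1 = m := by ring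
  rw [hm'] at key ⊢
  calc _ ≤ (B * (E / ((((m : ℝ) + 1 - p) / p) ^ p * (q - 1) * J)) ^
        ((m : ℝ) / ((m : ℝ) + 1 - p))) ^ (((m : ℝ) + 1 - p) / m) := by
        refine Real.rpow_le_rpow (integral_nonneg fun x => by positivity) key (by positivity)
    _ = _ := by
        rw [Real.mul_rpow hB.le (by positivity), ← Real.rpow_mul (by positivity)]
        have : (m : ℝ) / ((m : ℝ) + 1 - p) * (((m : ℝ) + 1 - p) / m) = 1 := by field_simp
        rw [this, Real.rpow_one]
        ring

end TraceConstant

section Mollification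

open ContinuousLinearMap Filter
open scoped Convolution Topology ContDiff

variable {E : Type*} [NormedAddCommGroup E] [NormedSpace ℝ E] [FiniteDimensional ℝ E]
  [MeasurableSpace E] [BorelSpace E] (μ : Measure E) [μ.IsAddHaarMeasure]

theorem ae_differentiableAt_sub {f : E → ℝ} {K : ℝ≥0} (hf : LipschitzWith K f) (x : E) :
    ∀ᵐ t ∂μ, DifferentiableAt ℝ f (x - t) :=
  (quasiMeasurePreserving_sub_left μ x).ae hf.ae_differentiableAt

theorem hasFDerivAt_convolution_of_lipschitz {φ f : E → ℝ} {K : ℝ≥0} (hφ : Continuous φ)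
    (hφc : HasCompactSupport φ) (hf : LipschitzWith K f) (x : E) :
    HasFDerivAt (φ ⋆[lsmul ℝ ℝ, μ] f) ((φ ⋆[lsmul ℝ ℝ, μ] fderiv ℝ f) x) x := by
  have hφi : Integrable φ μ := hφ.integrable_of_hasCompactSupport hφc
  have h := hasFDerivAt_integral_of_dominated_loc_of_lip (μ := μ) (𝕜 := ℝ) (s := univ) (x₀ := x)
    (F := fun x t => φ t * f (x - t)) (F' := fun t => φ t • fderiv ℝ f (x - t))
    (bound := fun t => φ t * K) univ_mem
    (Eventually.of_forall fun y =>
      (hφ.mul (hf.continuous.comp (continuous_const.sub continuous_id))).aestronglyMeasurable)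
    ((hφ.mul (hf.continuous.comp (continuous_const.sub
      continuous_id))).integrable_of_hasCompactSupport hφc.mul_right)
    (hφ.aestronglyMeasurable.smul
      ((measurable_fderiv ℝ f).comp (measurable_const.sub measurable_id)).aestronglyMeasurable)
    (Eventually.of_forall fun t => by
      refine LipschitzOnWith.of_dist_le_mul fun y _ z _ => ?_
      rw [Real.dist_eq, ← mul_sub, abs_mul, Real.coe_nnabs, abs_mul, mul_assoc,
        abs_of_nonneg K.coe_nonneg]
      refine mul_le_mul_of_nonneg_left ?_ (abs_nonneg _)
      have := hf.dist_le_mul (y - t) (z - t)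
      rwa [Real.dist_eq, dist_sub_right] at this)
    (hφi.mul_const _)
    (by
      filter_upwards [ae_differentiableAt_sub μ hf x] with t ht
      exact ((hasFDerivAt_comp_sub t).2 ht.hasFDerivAt).const_mul (φ t))
  exact h.2

theorem norm_convolution_normed_le {F : Type*} [NormedAddCommGroup F] [NormedSpace ℝ F]
    (φ : ContDiffBump (0 : E)) {h : E → F} {B : ℝ} (hB : ∀ y, ‖h y‖ ≤ B) (y : E) :
    ‖(φ.normed μ ⋆[lsmul ℝ ℝ, μ] h) y‖ ≤ B := by
  have h1 : Integrable (fun t => φ.normed μ t * B) μ := φ.integrable_normed.mul_const _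
  refine (norm_integral_le_of_norm_le h1 (Eventually.of_forall fun t => ?_)).trans_eq ?_
  · rw [lsmul_apply, norm_smul, Real.norm_of_nonneg (φ.nonneg_normed t)]
    exact mul_le_mul_of_nonneg_left (hB _) (φ.nonneg_normed t)
  · rw [integral_mul_const, φ.integral_normed, one_mul]

theorem convolution_normed_eq_zero {F : Type*} [NormedAddCommGroup F] [NormedSpace ℝ F]
    (φ : ContDiffBump (0 : E)) {h : E → F} {R : ℝ} (hR : ∀ y, R < ‖y‖ → h y = 0) {y : E}
    (hy : R + φ.rOut < ‖y‖) : (φ.normed μ ⋆[lsmul ℝ ℝ, μ] h) y = 0 := by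
  refine integral_eq_zero_of_ae (Eventually.of_forall fun t => ?_)
  simp only [lsmul_apply, Pi.zero_apply]
  by_cases ht : t ∈ Metric.ball (0 : E) φ.rOut
  · rw [mem_ball_zero_iff] at ht
    rw [hR _ (by linarith [norm_sub_norm_le y t]), smul_zero]
  · rw [← φ.support_normed_eq (μ := μ), Function.notMem_support] at ht
    rw [ht, zero_smul]

theorem exists_smooth_approx {f : E → ℝ} {K : ℝ≥0} (hf : LipschitzWith K f)
    (hfc : HasCompactSupport f) :
    ∃ (g : ℕ → E → ℝ) (R M : ℝ), (∀ k, ContDiff ℝ ∞ (g k)) ∧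
      (∀ k y, R < ‖y‖ → g k y = 0 ∧ fderiv ℝ (g k) y = 0) ∧
      (∀ k y, |g k y| ≤ M ∧ ‖fderiv ℝ (g k) y‖ ≤ M) ∧
      (∀ y, Tendsto (fun k => g k y) atTop (𝓝 (f y))) ∧
      ∀ᵐ y ∂μ, Tendsto (fun k => fderiv ℝ (g k) y) atTop (𝓝 (fderiv ℝ f y)) := by
  let φ : ℕ → ContDiffBump (0 : E) := fun k =>
    ⟨1 / (2 * ((k : ℝ) + 1)), 1 / ((k : ℝ) + 1), by positivity,
      one_div_lt_one_div_of_lt (by positivity) (by linarith [k.cast_nonneg (α := ℝ)])⟩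
  have hφ0 : Tendsto (fun k => (φ k).rOut) atTop (𝓝 0) := tendsto_one_div_add_atTop_nhds_zero_nat
  have hφ1 : ∀ k, (φ k).rOut ≤ 1 := fun k => by
    change 1 / ((k : ℝ) + 1) ≤ 1
    rw [div_le_one (by positivity)]
    linarith [k.cast_nonneg (α := ℝ)]
  have hφ2 : ∀ k, (φ k).rOut ≤ 2 * (φ k).rIn := fun k => by
    change 1 / ((k : ℝ) + 1) ≤ 2 * (1 / (2 * ((k : ℝ) + 1)))
    field_simp
    exact le_rfl
  set g : ℕ → E → ℝ := fun k => (φ k).normed μ ⋆[lsmul ℝ ℝ, μ] f with hg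
  have hfd : ∀ k y, fderiv ℝ (g k) y = ((φ k).normed μ ⋆[lsmul ℝ ℝ, μ] fderiv ℝ f) y := fun k y =>
    (hasFDerivAt_convolution_of_lipschitz μ (φ k).continuous_normed
      (φ k).hasCompactSupport_normed hf y).fderiv
  obtain ⟨R, hR⟩ := (Metric.isBounded_iff_subset_closedBall 0).1 hfc.isCompact.isBounded
  obtain ⟨M, hM⟩ := hf.continuous.bounded_above_of_compact_support hfc
  have hloc : LocallyIntegrable (fderiv ℝ f) μ := by
    refine (locallyIntegrable_const (K : ℝ)).mono (measurable_fderiv ℝ f).aestronglyMeasurable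
      (Eventually.of_forall fun y => ?_)
    rw [Real.norm_of_nonneg K.coe_nonneg]
    exact norm_fderiv_le_of_lipschitz ℝ hf
  have hfR : ∀ y, R < ‖y‖ → y ∉ tsupport f := fun y hy hmem => by
    have := hR hmem
    rw [mem_closedBall_zero_iff] at this
    linarith
  refine ⟨g, R + 1, max M K, fun k => ?_, fun k y hy => ⟨?_, ?_⟩, fun k y => ⟨?_, ?_⟩,
    fun y => ?_, ?_⟩
  · exact (φ k).hasCompactSupport_normed.contDiff_convolution_left _ (φ k).contDiff_normed
      hf.continuous.locallyIntegrable
  · exact convolution_normed_eq_zero μ _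
      (fun y hy => image_eq_zero_of_notMem_tsupport (hfR y hy)) (by linarith [hφ1 k])
  · rw [hfd]
    refine convolution_normed_eq_zero μ _ (fun y hy => ?_) (R := R) (by linarith [hφ1 k])
    exact image_eq_zero_of_notMem_tsupport fun h => hfR y hy (tsupport_fderiv_subset ℝ h)
  · exact (norm_convolution_normed_le μ _ hM y).trans (le_max_left _ _)
  · rw [hfd]
    exact (norm_convolution_normed_le μ _ (fun y => norm_fderiv_le_of_lipschitz ℝ hf) y).trans
      (le_max_right _ _)
  · exact ContDiffBump.convolution_tendsto_right_of_continuous hφ0 hf.continuous y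
  · simp_rw [hfd]
    exact ContDiffBump.ae_convolution_tendsto_right_of_locallyIntegrable hφ0
      (Eventually.of_forall hφ2) hloc

end Mollification

section Extremal

open Filter
open scoped Topology ContDiff

variable {m : ℕ} {p q : ℝ} {C : ℝ × EuclideanSpace ℝ (Fin m) → ℝ}

theorem IsCost.trace_le_of_lipschitz (hC : IsCost q C) (hpq : p.HolderConjugate q) {r s κ : ℝ}
    (hr : 0 < r) (hs : 0 < s)
    (hκ : ∀ f : ℝ × EuclideanSpace ℝ (Fin m) → ℝ, ContDiff ℝ ∞ f → HasCompactSupport f →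
      (∫ x, |f (0, x)| ^ r) ^ s ≤ κ * ∫ y in {y | 0 < y.1}, conj C (fderiv ℝ f y))
    {f : ℝ × EuclideanSpace ℝ (Fin m) → ℝ} {K : ℝ≥0} (hf : LipschitzWith K f)
    (hfc : HasCompactSupport f) :
    (∫ x, |f (0, x)| ^ r) ^ s ≤ κ * ∫ y in {y | 0 < y.1}, conj C (fderiv ℝ f y) := by
  obtain ⟨g, R, M, hg, hgR, hgM, hlim, hflim⟩ := exists_smooth_approx volume hf hfc
  have hM0 : 0 ≤ M := (abs_nonneg _).trans (hgM 0 0).1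
  have hgc : ∀ k, HasCompactSupport (g k) := fun k =>
    HasCompactSupport.intro (isCompact_closedBall 0 R) fun y hy => by
      rw [mem_closedBall_zero_iff, not_le] at hy
      exact (hgR k y hy).1
  have hball : ∀ {X : Type} [NormedAddCommGroup X] [MeasurableSpace X] [BorelSpace X] [ProperSpace X]
      (ν : Measure X) [IsFiniteMeasureOnCompacts ν] (c : ℝ),
      Integrable ((Metric.closedBall (0 : X) R).indicator fun _ => c) ν := by
    intro X _ _ _ _ ν _ c
    exact (integrable_indicator_iff Metric.isClosed_closedBall.measurableSet).2
      (integrableOn_const (isCompact_closedBall 0 R).measure_lt_top.ne)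
  have h1 : Tendsto (fun k => ∫ x, |g k (0, x)| ^ r) atTop (𝓝 (∫ x, |f (0, x)| ^ r)) := by
    refine tendsto_integral_of_dominated_convergence _ (fun k => ?_)
      (hball (volume : Measure (EuclideanSpace ℝ (Fin m))) (M ^ r)) (fun k => ?_) ?_
    · exact (((hg k).continuous.comp (continuous_const.prodMk continuous_id)).abs.rpow_const
        fun _ => Or.inr hr.le).aestronglyMeasurable
    · refine Eventually.of_forall fun x => ?_
      rw [Real.norm_of_nonneg (by positivity)]
      by_cases hx : x ∈ Metric.closedBall (0 : EuclideanSpace ℝ (Fin m)) R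
      · rw [indicator_of_mem hx]
        exact Real.rpow_le_rpow (abs_nonneg _) (hgM k _).1 hr.le
      · rw [indicator_of_notMem hx]
        rw [mem_closedBall_zero_iff, not_le] at hx
        rw [(hgR k (0, x) (hx.trans_le (norm_snd_le ((0 : ℝ), x)))).1, abs_zero,
          Real.zero_rpow hr.ne']
    · exact Eventually.of_forall fun x => ((hlim (0, x)).abs.rpow_const (Or.inr hr.le))
  obtain ⟨L, hL0, hL⟩ := hC.exists_conj_le hpq
  have h2 : Tendsto (fun k => ∫ y in {y | 0 < y.1}, conj C (fderiv ℝ (g k) y)) atTop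
      (𝓝 (∫ y in {y | 0 < y.1}, conj C (fderiv ℝ f y))) := by
    refine tendsto_integral_of_dominated_convergence _ (fun k => ?_)
      (hball (volume.restrict {y : ℝ × EuclideanSpace ℝ (Fin m) | 0 < y.1}) (L * M ^ p))
      (fun k => ?_) (ae_restrict_of_ae ?_)
    · exact ((hC.continuous_conj hpq).comp
        ((hg k).continuous_fderiv (by simp))).aestronglyMeasurable
    · refine Eventually.of_forall fun y => ?_
      rw [Real.norm_of_nonneg (hC.conj_nonneg hpq _)]
      by_cases hy : y ∈ Metric.closedBall (0 : ℝ × EuclideanSpace ℝ (Fin m)) R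
      · rw [indicator_of_mem hy]
        refine (hL _).trans (mul_le_mul_of_nonneg_left ?_ hL0.le)
        exact Real.rpow_le_rpow (norm_nonneg _) (hgM k y).2 hpq.nonneg
      · rw [indicator_of_notMem hy]
        rw [mem_closedBall_zero_iff, not_le] at hy
        rw [(hgR k y hy).2, hC.conj_zero hpq]
    · filter_upwards [hflim] with y hy
      exact ((hC.continuous_conj hpq).tendsto _).comp hy
  exact le_of_tendsto_of_tendsto' (h1.rpow_const (Or.inr hs.le)) (h2.const_mul κ)
    fun k => hκ (g k) (hg k) (hgc k)

theorem IsCost.ae_differentiableAt (hC : IsCost q C) (hq : 1 ≤ q) :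
    ∀ᵐ y : ℝ × EuclideanSpace ℝ (Fin m), DifferentiableAt ℝ C y := by
  have hq0 : 0 < q := by linarith
  obtain ⟨K, hK⟩ := hC.exists_lipschitzWith_gauge hq0
  filter_upwards [hK.ae_differentiableAt (μ := volume)] with y hy
  have h1 := hy.rpow_const (p := q) (Or.inr hq)
  refine h1.congr_of_eventuallyEq (Eventually.of_forall fun z => ?_)
  simp only
  rw [← Real.rpow_mul (hC.nonneg z), inv_mul_cancel₀ hq0.ne', Real.rpow_one]

/-- The translate of `C ^ (-(n - p) / p)` by `e₁`, where `n = m + 1`. -/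
def extremal (p : ℝ) (C : ℝ × EuclideanSpace ℝ (Fin m) → ℝ)
    (y : ℝ × EuclideanSpace ℝ (Fin m)) : ℝ :=
  C (y + (1, 0)) ^ (-(((m : ℝ) + 1 - p) / p))

theorem add_e₁_ne_zero {y : ℝ × EuclideanSpace ℝ (Fin m)} (hy : 0 ≤ y.1) :
    y + ((1 : ℝ), 0) ≠ 0 := by
  intro h
  have := congrArg Prod.fst h
  simp only [Prod.fst_add, Prod.fst_zero] at this
  linarith

theorem IsCost.differentiableAt_extremal (hC : IsCost q C)
    {y : ℝ × EuclideanSpace ℝ (Fin m)} (hy : 0 ≤ y.1)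
    (hd : DifferentiableAt ℝ C (y + (1, 0))) : DifferentiableAt ℝ (extremal p C) y :=
  (((hasFDerivAt_comp_add_right _).2 hd.hasFDerivAt).rpow_const
    (Or.inl (hC.pos _ (add_e₁_ne_zero hy)).ne')).differentiableAt

theorem IsCost.conj_fderiv_extremal (hC : IsCost q C) (hpq : p.HolderConjugate q)
    (hpn : p < (m : ℝ) + 1) {y : ℝ × EuclideanSpace ℝ (Fin m)} (hy : 0 ≤ y.1)
    (hd : DifferentiableAt ℝ C (y + (1, 0))) :
    conj C (fderiv ℝ (extremal p C) y) =
      (((m : ℝ) + 1 - p) / p) ^ p * (q - 1) * C (y + (1, 0)) ^ (1 - ((m : ℝ) + 1)) := by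
  have hpos := hC.pos _ (add_e₁_ne_zero hy)
  have h1 : HasFDerivAt (extremal p C) _ y :=
    ((hasFDerivAt_comp_add_right _).2 hd.hasFDerivAt).rpow_const
      (p := -(((m : ℝ) + 1 - p) / p)) (Or.inl hpos.ne')
  have ha : 0 < ((m : ℝ) + 1 - p) / p := div_pos (by linarith) hpq.pos
  rw [h1.fderiv, hC.conj_smul hpq, hC.conj_fderiv hpq hd, abs_mul, abs_neg, abs_of_pos ha,
    abs_of_pos (Real.rpow_pos_of_pos hpos _), Real.mul_rpow ha.le (by positivity),
    ← Real.rpow_mul hpos.le]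
  have h2 : C (y + (1, 0)) ^ (1 - ((m : ℝ) + 1)) =
      C (y + (1, 0)) ^ ((-(((m : ℝ) + 1 - p) / p) - 1) * p) * C (y + (1, 0)) := by
    rw [← Real.rpow_add_one hpos.ne']
    congr 1
    have := hpq.ne_zero
    field_simp
    ring
  rw [h2]
  ring

theorem IsCost.ae_conj_fderiv_extremal (hC : IsCost q C) (hpq : p.HolderConjugate q)
    (hpn : p < (m : ℝ) + 1) :
    ∀ᵐ y ∂volume.restrict {y : ℝ × EuclideanSpace ℝ (Fin m) | 0 < y.1},
      DifferentiableAt ℝ (extremal p C) y ∧ conj C (fderiv ℝ (extremal p C) y) =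
      (((m : ℝ) + 1 - p) / p) ^ p * (q - 1) * C (y + (1, 0)) ^ (1 - ((m : ℝ) + 1)) := by
  have h1 : ∀ᵐ y : ℝ × EuclideanSpace ℝ (Fin m), DifferentiableAt ℝ C (y + (1, 0)) :=
    (measurePreserving_add_right volume _).quasiMeasurePreserving.ae
      (hC.ae_differentiableAt hpq.symm.lt.le)
  refine (ae_restrict_iff' (measurableSet_lt measurable_const measurable_fst)).2 ?_
  filter_upwards [h1] with y hy hy0
  exact ⟨hC.differentiableAt_extremal (le_of_lt hy0) hy,
    hC.conj_fderiv_extremal hpq hpn (le_of_lt hy0) hy⟩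

theorem setIntegral_halfSpace_add (h : ℝ × EuclideanSpace ℝ (Fin m) → ℝ) :
    ∫ y in {y : ℝ × EuclideanSpace ℝ (Fin m) | 0 < y.1}, h (y + (1, 0)) =
      ∫ y in {y | 1 < y.1}, h y := by
  rw [← (measurePreserving_add_right volume
    ((1 : ℝ), (0 : EuclideanSpace ℝ (Fin m)))).setIntegral_preimage_emb
    (measurableEmbedding_addRight _) h {y | 1 < y.1}]
  congr 2
  ext y
  simp

theorem IsCost.energy_extremal (hC : IsCost q C) (hpq : p.HolderConjugate q)
    (hpn : p < (m : ℝ) + 1) :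
    ∫ y in {y | 0 < y.1}, conj C (fderiv ℝ (extremal p C) y) =
      (((m : ℝ) + 1 - p) / p) ^ p * (q - 1) *
        ∫ y in {y | 1 < y.1}, C y ^ (1 - ((m : ℝ) + 1)) := by
  rw [integral_congr_ae ((hC.ae_conj_fderiv_extremal hpq hpn).mono fun y hy => hy.2),
    integral_const_mul, setIntegral_halfSpace_add fun y => C y ^ (1 - ((m : ℝ) + 1))]

theorem IsCost.abs_extremal_rpow (hC : IsCost q C) (hp : 0 < p) (hpn : p < (m : ℝ) + 1)
    (x : EuclideanSpace ℝ (Fin m)) :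
    |extremal p C (0, x)| ^ (p * ((m : ℝ) + 1 - 1) / ((m : ℝ) + 1 - p)) =
      C (1, x) ^ (1 - ((m : ℝ) + 1)) := by
  have h1 : ((0 : ℝ), x) + (1, 0) = (1, x) := by simp
  have h2 : 0 < (m : ℝ) + 1 - p := by linarith
  rw [extremal, h1, abs_of_nonneg (Real.rpow_nonneg (hC.nonneg _) _),
    ← Real.rpow_mul (hC.nonneg _)]
  congr 1
  field_simp
  ring

theorem IsCost.trace_ratio_extremal (hC : IsCost q C) (hp : 1 < p) (hpn : p < (m : ℝ) + 1)
    (hq : q = p / (p - 1)) :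
    (∫ x, |extremal p C (0, x)| ^ (p * ((m : ℝ) + 1 - 1) / ((m : ℝ) + 1 - p))) ^
        (((m : ℝ) + 1 - p) / ((m : ℝ) + 1 - 1)) /
      (∫ y in {y | 0 < y.1}, conj C (fderiv ℝ (extremal p C) y)) = traceConst p C := by
  have hpq := holderConjugate_of_eq_div hp hq
  rw [hC.energy_extremal hpq hpn, hC.traceConst_eq hp hpn hq]
  simp_rw [hC.abs_extremal_rpow hpq.pos hpn]

end Extremal

section Leastness

open Filter
open scoped Topology ContDiff

variable {m : ℕ} {p q : ℝ} {C : ℝ × EuclideanSpace ℝ (Fin m) → ℝ}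

theorem exists_lipschitzOnWith_rpow_neg {r b : ℝ} (hr : 0 < r) (hb : 0 ≤ b) :
    ∃ K, LipschitzOnWith K (fun s : ℝ => s ^ (-b)) (Ici r) := by
  refine ⟨Real.toNNReal (b * r ^ (-b - 1)),
    (convex_Ici r).lipschitzOnWith_of_nnnorm_deriv_le (fun s hs => ?_) fun s hs => ?_⟩
  · exact Real.differentiableAt_rpow_const_of_ne _ (hr.trans_le hs).ne'
  · have hs0 : 0 < s := hr.trans_le hs
    rw [← NNReal.coe_le_coe, coe_nnnorm, Real.coe_toNNReal _ (by positivity),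
      Real.deriv_rpow_const, Real.norm_eq_abs, abs_mul, abs_neg, abs_of_nonneg hb,
      abs_of_pos (Real.rpow_pos_of_pos hs0 _)]
    exact mul_le_mul_of_nonneg_left (Real.rpow_le_rpow_of_nonpos hr hs (by linarith)) hb

/-- If `κ` bounds the trace quotient of smooth compactly supported functions, then it is at least
the sharp constant. -/
theorem IsCost.trace_extremal_le (hC : IsCost q C) (hp : 1 < p) (hpn : p < (m : ℝ) + 1)
    (hq : q = p / (p - 1)) {κ : ℝ}
    (hκ : ∀ f : ℝ × EuclideanSpace ℝ (Fin m) → ℝ, ContDiff ℝ ∞ f → HasCompactSupport f →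
      (∫ x, |f (0, x)| ^ (p * ((m : ℝ) + 1 - 1) / ((m : ℝ) + 1 - p))) ^
        (((m : ℝ) + 1 - p) / ((m : ℝ) + 1 - 1)) ≤
      κ * ∫ y in {y | 0 < y.1}, conj C (fderiv ℝ f y)) :
    (∫ x, |extremal p C (0, x)| ^ (p * ((m : ℝ) + 1 - 1) / ((m : ℝ) + 1 - p))) ^
        (((m : ℝ) + 1 - p) / ((m : ℝ) + 1 - 1)) ≤
      max κ 0 * ∫ y in {y | 0 < y.1}, conj C (fderiv ℝ (extremal p C) y) := by
  have hpq := holderConjugate_of_eq_div hp hq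
  have hq0 := hpq.symm.pos
  have h2 : 0 < (m : ℝ) + 1 - p := by linarith
  have hm : 0 < (m : ℝ) + 1 - 1 := by linarith
  have hr : 0 < p * ((m : ℝ) + 1 - 1) / ((m : ℝ) + 1 - p) := by
    have := hpq.pos
    positivity
  have hs : 0 < ((m : ℝ) + 1 - p) / ((m : ℝ) + 1 - 1) := by positivity
  set r := p * ((m : ℝ) + 1 - 1) / ((m : ℝ) + 1 - p) with hr_def
  set a := ((m : ℝ) + 1 - p) / p with ha
  have ha0 : 0 < a := div_pos h2 hpq.pos
  obtain ⟨c, hc, M, hM, hb⟩ := hC.exists_bounds hq0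
  set N : ℝ × EuclideanSpace ℝ (Fin m) → ℝ := fun y => C y ^ q⁻¹ with hN
  set r₀ := c ^ q⁻¹ with hr₀
  have hr₀0 : 0 < r₀ := by positivity
  have hNlow : ∀ y, r₀ * ‖y‖ ≤ N y := by
    intro y
    have h3 := Real.rpow_le_rpow (by positivity) (hb y).1 (inv_nonneg.2 hq0.le)
    rwa [Real.mul_rpow hc.le (by positivity), ← Real.rpow_mul (norm_nonneg y),
      mul_inv_cancel₀ hq0.ne', Real.rpow_one] at h3
  set v : ℝ × EuclideanSpace ℝ (Fin m) → ℝ := fun y => max (N (y + (1, 0))) r₀ ^ (-(q * a))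
    with hv
  have hve : ∀ y : ℝ × EuclideanSpace ℝ (Fin m), 0 ≤ y.1 → v y = extremal p C y := by
    intro y hy
    have h3 : 1 ≤ ‖y + ((1 : ℝ), (0 : EuclideanSpace ℝ (Fin m)))‖ := by
      refine le_trans ?_ (norm_fst_le _)
      rw [Prod.fst_add, Real.norm_eq_abs]
      exact (by linarith : (1 : ℝ) ≤ y.1 + 1).trans (le_abs_self _)
    have h4 : r₀ ≤ N (y + (1, 0)) := by
      refine le_trans ?_ (hNlow _)
      nlinarith
    simp only [hv, extremal]
    rw [max_eq_left h4, hN, ← Real.rpow_mul (hC.nonneg _), mul_neg, ← mul_assoc,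
      inv_mul_cancel₀ hq0.ne', one_mul]
  obtain ⟨K₁, hK₁⟩ := hC.exists_lipschitzWith_gauge hq0
  obtain ⟨K₂, hK₂⟩ := exists_lipschitzOnWith_rpow_neg hr₀0 (mul_pos hq0 ha0).le
  have hvL : LipschitzWith (K₂ * K₁) v := by
    have h3 : LipschitzWith K₁ fun y : ℝ × EuclideanSpace ℝ (Fin m) =>
        max (N (y + (1, 0))) r₀ := by
      have h4 : LipschitzWith K₁ fun y : ℝ × EuclideanSpace ℝ (Fin m) => N (y + (1, 0)) :=
        LipschitzWith.of_dist_le_mul fun y z => by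
          have := hK₁.dist_le_mul (y + (1, 0)) (z + (1, 0))
          rwa [dist_add_right] at this
      exact h4.max_const r₀
    refine LipschitzWith.of_dist_le_mul fun y z => ?_
    refine (hK₂.dist_le_mul _ (mem_Ici.2 (le_max_right _ _)) _
      (mem_Ici.2 (le_max_right _ _))).trans ?_
    rw [NNReal.coe_mul, mul_assoc]
    exact mul_le_mul_of_nonneg_left (h3.dist_le_mul y z) K₂.coe_nonneg
  have hv0 : ∀ y, 0 ≤ v y := fun y => Real.rpow_nonneg (hr₀0.le.trans (le_max_right _ _)) _
  have hvt : Tendsto v (cocompact _) (𝓝 0) := by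
    refine (tendsto_rpow_neg_atTop (mul_pos hq0 ha0)).comp ?_
    refine tendsto_atTop_mono (fun y => (hNlow (y + (1, 0))).trans (le_max_left _ _)) ?_
    refine Tendsto.const_mul_atTop hr₀0 ?_
    exact tendsto_norm_cocompact_atTop.comp
      (Homeomorph.addRight ((1 : ℝ), (0 : EuclideanSpace ℝ (Fin m)))).isClosedEmbedding.tendsto_cocompact
  set E := ∫ y in {y | 0 < y.1}, conj C (fderiv ℝ (extremal p C) y) with hE
  have hEi : IntegrableOn (fun y => conj C (fderiv ℝ (extremal p C) y)) {y | 0 < y.1} := by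
    have h3 := hC.integrableOn_rpow hq0 (e := 1 - ((m : ℝ) + 1)) (by simp)
      (mul_sub_add_pos_of_holder hp hpn hq)
    have h4 : IntegrableOn (fun y => C (y + (1, 0)) ^ (1 - ((m : ℝ) + 1)))
        {y : ℝ × EuclideanSpace ℝ (Fin m) | 0 < y.1} := by
      have h5 := ((measurePreserving_add_right volume
        ((1 : ℝ), (0 : EuclideanSpace ℝ (Fin m)))).integrableOn_comp_preimage
        (measurableEmbedding_addRight _)).2 h3
      have h6 : {y : ℝ × EuclideanSpace ℝ (Fin m) | 0 < y.1} =
          (fun y => y + ((1 : ℝ), (0 : EuclideanSpace ℝ (Fin m)))) ⁻¹' {y | 1 < y.1} := by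
        ext y
        simp
      rw [h6]
      exact h5
    exact (h4.const_mul ((((m : ℝ) + 1 - p) / p) ^ p * (q - 1))).congr
      ((hC.ae_conj_fderiv_extremal hpq hpn).mono fun y hy => hy.2.symm)
  set u : ℝ → ℝ × EuclideanSpace ℝ (Fin m) → ℝ := fun δ y => max (v y - δ) 0 with hu
  have huL : ∀ δ, LipschitzWith (K₂ * K₁) (u δ) := by
    intro δ
    have h3 : LipschitzWith (K₂ * K₁) fun y => v y - δ :=
      LipschitzWith.of_dist_le_mul fun y z => by
        rw [dist_sub_right]
        exact hvL.dist_le_mul y z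
    exact h3.max_const 0
  have huc : ∀ δ, 0 < δ → HasCompactSupport (u δ) := by
    intro δ hδ
    rw [hasCompactSupport_iff_eventuallyEq, coclosedCompact_eq_cocompact]
    filter_upwards [hvt.eventually_lt_const hδ] with y hy
    exact max_eq_right (by linarith)
  have hue : ∀ δ, 0 < δ → ∀ y : ℝ × EuclideanSpace ℝ (Fin m), 0 < y.1 →
      conj C (fderiv ℝ (u δ) y) ≤ conj C (fderiv ℝ (extremal p C) y) := by
    intro δ hδ y hy
    rcases le_or_gt (v y) δ with h3 | h3
    · have h4 : IsLocalMin (u δ) y := Eventually.of_forall fun z => by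
        simp only [hu]
        rw [max_eq_right (by linarith : v y - δ ≤ 0)]
        exact le_max_right _ _
      rw [h4.fderiv_eq_zero, hC.conj_zero hpq]
      exact hC.conj_nonneg hpq _
    · have h4 : u δ =ᶠ[𝓝 y] fun z => extremal p C z - δ := by
        filter_upwards [hvL.continuous.continuousAt.eventually_const_lt h3,
          continuous_fst.continuousAt.eventually_const_lt hy] with z hz hz0
        simp only [hu]
        rw [← hve z (le_of_lt hz0), max_eq_left (by linarith)]
      rw [h4.fderiv_eq, fderiv_sub_const]
  have hineq : ∀ δ, 0 < δ → (∫ x, |u δ (0, x)| ^ r) ^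
      (((m : ℝ) + 1 - p) / ((m : ℝ) + 1 - 1)) ≤ max κ 0 * E := by
    intro δ hδ
    have h3 := hC.trace_le_of_lipschitz hpq hr hs hκ (huL δ) (huc δ hδ)
    refine h3.trans ?_
    have h4 : ∫ y in {y | 0 < y.1}, conj C (fderiv ℝ (u δ) y) ≤ E := by
      refine integral_mono_of_nonneg (Eventually.of_forall fun y => hC.conj_nonneg hpq _) hEi ?_
      refine (ae_restrict_iff' (measurableSet_lt measurable_const measurable_fst)).2
        (Eventually.of_forall fun y hy => hue δ hδ y hy)
    have h5 : 0 ≤ ∫ y in {y | 0 < y.1}, conj C (fderiv ℝ (u δ) y) :=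
      integral_nonneg fun y => hC.conj_nonneg hpq _
    exact mul_le_mul (le_max_left _ _) h4 h5 (le_max_right _ _)
  have hδ0 : Tendsto (fun k : ℕ => 1 / ((k : ℝ) + 1)) atTop (𝓝 0) :=
    tendsto_one_div_add_atTop_nhds_zero_nat
  have hlim : Tendsto (fun k : ℕ => ∫ x, |u (1 / ((k : ℝ) + 1)) (0, x)| ^ r) atTop
      (𝓝 (∫ x, |extremal p C (0, x)| ^ r)) := by
    have hbi : Integrable fun x => |extremal p C (0, x)| ^ r := by
      simp_rw [hr_def, hC.abs_extremal_rpow hpq.pos hpn]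
      exact hC.integrable_rpow_slice hq0 (by simp)
        (by linarith [mul_sub_add_pos_of_holder hp hpn hq])
    refine tendsto_integral_of_dominated_convergence _ (fun k => ?_) hbi (fun k => ?_) ?_
    · exact (((huL _).continuous.comp (continuous_const.prodMk continuous_id)).abs.rpow_const
        fun _ => Or.inr hr.le).aestronglyMeasurable
    · refine Eventually.of_forall fun x => ?_
      rw [Real.norm_of_nonneg (by positivity), ← hve (0, x) le_rfl]
      refine Real.rpow_le_rpow (abs_nonneg _) ?_ hr.le
      rw [abs_of_nonneg (hv0 _), abs_of_nonneg (le_max_right _ _)]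
      have : 0 < 1 / ((k : ℝ) + 1) := by positivity
      exact max_le (by linarith) (hv0 _)
    · refine Eventually.of_forall fun x => ?_
      rw [← hve (0, x) le_rfl]
      refine Tendsto.rpow_const (Tendsto.abs ?_) (Or.inr hr.le)
      have h3 : Tendsto (fun k : ℕ => max (v (0, x) - 1 / ((k : ℝ) + 1)) 0) atTop
          (𝓝 (max (v (0, x) - 0) 0)) := (tendsto_const_nhds.sub hδ0).max tendsto_const_nhds
      rwa [sub_zero, max_eq_left (hv0 _)] at h3
  exact le_of_tendsto' (hlim.rpow_const (Or.inr hs.le)) fun k => hineq _ (by positivity)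

theorem IsCost.traceConst_le (hC : IsCost q C) (hp : 1 < p) (hpn : p < (m : ℝ) + 1)
    (hq : q = p / (p - 1)) {κ : ℝ}
    (hκ : ∀ f : ℝ × EuclideanSpace ℝ (Fin m) → ℝ, ContDiff ℝ ∞ f → HasCompactSupport f →
      (∫ x, |f (0, x)| ^ (p * ((m : ℝ) + 1 - 1) / ((m : ℝ) + 1 - p))) ^
        (((m : ℝ) + 1 - p) / ((m : ℝ) + 1 - 1)) ≤
      κ * ∫ y in {y | 0 < y.1}, conj C (fderiv ℝ f y)) :
    traceConst p C ≤ κ := by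
  have hpq := holderConjugate_of_eq_div hp hq
  have hB := hC.integral_slice_pos hp hpn hq
  have h1 : 0 < p - 1 := by linarith
  have h2 : 0 < (m : ℝ) + 1 - p := by linarith
  have hq1 : 0 < q - 1 := by linarith [hpq.symm.lt]
  have hE : 0 < ∫ y in {y | 0 < y.1}, conj C (fderiv ℝ (extremal p C) y) := by
    rw [hC.energy_extremal hpq hpn, hC.setIntegral_rpow_eq hp hpn hq]
    have := hpq.pos
    positivity
  have h3 := (div_le_iff₀ hE).2 (hC.trace_extremal_le hp hpn hq hκ)
  rw [hC.trace_ratio_extremal hp hpn hq] at h3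
  have h4 : 0 < traceConst p C := by
    have := hpq.pos
    unfold traceConst
    positivity
  rcases le_total κ 0 with hk | hk
  · rw [max_eq_right hk] at h3
    linarith
  · rwa [max_eq_left hk] at h3

end Leastness

section Assembly

variable {m : ℕ} {p q : ℝ} {C : ℝ × EuclideanSpace ℝ (Fin m) → ℝ}

theorem IsCost.traceConst_eq_sublevel (hC : IsCost q C) (hp : 1 < p) (hpn : p < (m : ℝ) + 1)
    (hq : q = p / (p - 1)) :
    p ^ p * ((m : ℝ) + 1 - p) ^ (-(p / q)) *
        (q * ((m : ℝ) + 1 - 1)) ^ (-(p / (q * ((m : ℝ) + 1 - 1)))) *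
        (∫ y in {y | C y ≤ 1} ∩ {y | 0 < y.1},
          y.1 ^ (q * ((m : ℝ) + 1) - q - ((m : ℝ) + 1))) ^ (-(p / (q * ((m : ℝ) + 1 - 1)))) =
      traceConst p C := by
  have hq0 := (holderConjugate_of_eq_div hp hq).symm.pos
  have hm : (0 : ℝ) < m := by linarith
  have hB := hC.integral_slice_pos hp hpn hq
  have h1 := hC.setIntegral_sublevel hq0 (e := 1 - ((m : ℝ) + 1)) (by simp)
    (mul_sub_add_pos_of_holder hp hpn hq)
  have h2 : q * -(1 - ((m : ℝ) + 1)) - (m + 1) = q * ((m : ℝ) + 1) - q - ((m : ℝ) + 1) := by ring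
  have h3 : q * -(1 - ((m : ℝ) + 1)) = q * m := by ring
  have h4 : p / q = p - 1 := by
    have : 0 < p - 1 := by linarith
    rw [hq]; field_simp
  rw [h2, h3] at h1
  rw [h1, add_sub_cancel_right, traceConst, mul_assoc, ← Real.mul_rpow (by positivity)
    (by positivity), mul_div_cancel₀ _ (by positivity), ← div_div, h4, neg_sub]

theorem legendreP_dt_gradx (C : ℝ × EuclideanSpace ℝ (Fin m) → ℝ)
    {f : ℝ × EuclideanSpace ℝ (Fin m) → ℝ} {y : ℝ × EuclideanSpace ℝ (Fin m)}
    (hf : DifferentiableAt ℝ f y) :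
    legendreP C (dt (n := m + 1) f y, gradx (n := m + 1) f y) = conj C (fderiv ℝ f y) :=
  legendreP_fderiv_gradient C hf

end Assembly

/-- For `w₀(t,x) = C((t,x) + e₁)^{-(n-p)/(q(p-1))}`, the ratio of the two sides of the
anisotropic trace inequality equals
`p^p (n-p)^{-p/q} (q(n-1))^{-p/(q(n-1))} (∫_{(K_C)_+} y₁^{qn-q-n} dy)^{-p/(q(n-1))}`;
consequently this is the best constant `𝒦_{n,C}` in the anisotropic trace inequality. -/
theorem anisotropic_trace_best_constant (n : ℕ) (hn : 3 ≤ n) (p q : ℝ) (hp : 1 < p)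
    (hpn : p < n) (hq : q = p / (p - 1))
    (C : ℝ × EuclideanSpace ℝ (Fin (n - 1)) → ℝ)
    (hC0 : ∀ y, 0 ≤ C y) (hCeven : ∀ y, C (-y) = C y) (hCconvex : ConvexOn ℝ Set.univ C)
    (hChom : ∀ l : ℝ, 0 ≤ l → ∀ y, C (l • y) = l ^ q * C y)
    (hCpos : ∀ y, y ≠ 0 → 0 < C y)
    (w₀ : ℝ × EuclideanSpace ℝ (Fin (n - 1)) → ℝ)
    (hw₀ : ∀ y : ℝ × EuclideanSpace ℝ (Fin (n - 1)),
      w₀ y = C (y + ((1 : ℝ), 0)) ^ (-(((n : ℝ) - p) / (q * (p - 1))))) :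
    bdry n (p * ((n : ℝ) - 1) / ((n : ℝ) - p)) w₀ ^ (((n : ℝ) - p) / ((n : ℝ) - 1)) /
        (∫ y in H n, legendreP C (dt w₀ y, gradx w₀ y)) =
      p ^ p * ((n : ℝ) - p) ^ (-(p / q)) *
        (q * ((n : ℝ) - 1)) ^ (-(p / (q * ((n : ℝ) - 1)))) *
        (∫ y in ({y | C y ≤ 1} ∩ H n), y.1 ^ (q * (n : ℝ) - q - (n : ℝ))) ^
          (-(p / (q * ((n : ℝ) - 1)))) ∧
    IsLeast {κ : ℝ | ∀ f : ℝ × EuclideanSpace ℝ (Fin (n - 1)) → ℝ,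
        ContDiff ℝ (⊤ : ℕ∞) f → HasCompactSupport f →
        bdry n (p * ((n : ℝ) - 1) / ((n : ℝ) - p)) f ^ (((n : ℝ) - p) / ((n : ℝ) - 1)) ≤
          κ * ∫ y in H n, legendreP C (dt f y, gradx f y)}
      (p ^ p * ((n : ℝ) - p) ^ (-(p / q)) *
        (q * ((n : ℝ) - 1)) ^ (-(p / (q * ((n : ℝ) - 1)))) *
        (∫ y in ({y | C y ≤ 1} ∩ H n), y.1 ^ (q * (n : ℝ) - q - (n : ℝ))) ^
          (-(p / (q * ((n : ℝ) - 1))))) := by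
  obtain ⟨m, rfl⟩ : ∃ m, n = m + 1 := ⟨n - 1, by omega⟩
  have hpn' : p < (m : ℝ) + 1 := by exact_mod_cast hpn
  have hC : IsCost (E := ℝ × EuclideanSpace ℝ (Fin m)) q C :=
    ⟨hC0, hCeven, hCconvex, hChom, hCpos⟩
  have hpq := holderConjugate_of_eq_div hp hq
  have hw : w₀ = extremal (m := m) p C := by
    ext y
    have h1 : q * (p - 1) = p := by
      have : 0 < p - 1 := by linarith
      rw [hq]; field_simp
    rw [hw₀ y, h1, Nat.cast_succ]
    rfl
  have hconst := hC.traceConst_eq_sublevel hp hpn' hq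
  have hfun : ∀ f : ℝ × EuclideanSpace ℝ (Fin m) → ℝ,
      (∀ᵐ y ∂volume.restrict {y : ℝ × EuclideanSpace ℝ (Fin m) | 0 < y.1},
        DifferentiableAt ℝ f y) →
      ∫ y in {y | 0 < y.1}, legendreP C (dt (n := m + 1) f y, gradx (n := m + 1) f y) =
        ∫ y in {y | 0 < y.1}, conj C (fderiv ℝ f y) := fun f hf =>
    integral_congr_ae (hf.mono fun y hy => legendreP_dt_gradx (m := m) C hy)
  have hsmooth : ∀ f : ℝ × EuclideanSpace ℝ (Fin m) → ℝ, ContDiff ℝ (⊤ : ℕ∞) f →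
      ∫ y in {y | 0 < y.1}, legendreP C (dt (n := m + 1) f y, gradx (n := m + 1) f y) =
        ∫ y in {y | 0 < y.1}, conj C (fderiv ℝ f y) := fun f hf =>
    hfun f (Filter.Eventually.of_forall fun y => hf.differentiable (by simp) y)
  unfold bdry H
  rw [Nat.cast_succ]
  refine ⟨?_, ?_, ?_⟩
  · refine Eq.trans ?_ hconst.symm
    rw [hw]
    refine Eq.trans ?_ (hC.trace_ratio_extremal hp hpn' hq)
    congr 1
    exact hfun _ ((hC.ae_conj_fderiv_extremal hpq hpn').mono fun y hy => hy.1)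
  · intro f hf hfc
    have h1 := hC.trace_inequality hp hpn' hq (hf.of_le (by simp)) hfc
    rw [← hconst, ← hsmooth f hf] at h1
    exact h1
  · intro κ hκ
    refine hconst.trans_le (hC.traceConst_le hp hpn' hq fun f hf hfc => ?_)
    rw [← hsmooth f hf]
    exact hκ f hf hfc

end AffineTrace
end
end

section
/- Let 1 < p < n and let f be a smooth compactly supported function on ℝ^n, not identically zero on ℝ^n_+. Then for every x ∈ ℝ^{n-1}, (n+p-1) · a_{n-1,p} · vol(L_f) · h_{Γ_p L_f}(x)^p = D_f^*(x), where D_f^*(x) = ∫_{𝕊^{n-2}} ‖∇_ξ f‖_p^{1-n-p} |⟨x,ξ⟩|^p dξ. -/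
open MeasureTheory Real Set
open scoped RealInnerProductSpace ENNReal NNReal Pointwise

noncomputable section

namespace AffineTrace

/-- Integration in polar coordinates. -/
theorem integral_eq_integral_toSphere {E : Type*} [NormedAddCommGroup E] [NormedSpace ℝ E]
    [FiniteDimensional ℝ E] [Nontrivial E] [MeasurableSpace E] [BorelSpace E] (μ : Measure E)
    [μ.IsAddHaarMeasure] {F : E → ℝ} (hF : Integrable F μ) :
    ∫ z, F z ∂μ = ∫ ξ : Metric.sphere (0 : E) 1,
      (∫ r in Ioi (0 : ℝ), r ^ (Module.finrank ℝ E - 1) * F (r • (ξ : E))) ∂μ.toSphere := by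
  have hmp := μ.measurePreserving_homeomorphUnitSphereProd
  have hemb := (homeomorphUnitSphereProd E).measurableEmbedding
  set G : Metric.sphere (0 : E) 1 × Ioi (0 : ℝ) → ℝ := fun y => F (y.2.1 • (y.1 : E)) with hG
  have hGF : ∀ z : ({0}ᶜ : Set E), G (homeomorphUnitSphereProd E z) = F z := by
    intro z
    have hz : ‖(z : E)‖ ≠ 0 := norm_ne_zero_iff.2 z.2
    simp [hG, smul_smul, hz]
  have hGint : Integrable G
      (μ.toSphere.prod (Measure.volumeIoiPow (Module.finrank ℝ E - 1))) := by
    rw [← hmp.integrable_comp_emb hemb]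
    have : G ∘ homeomorphUnitSphereProd E = F ∘ Subtype.val := funext hGF
    rw [this, ← integrableOn_iff_comap_subtypeVal (measurableSet_singleton _).compl]
    exact hF.integrableOn
  calc
    ∫ z, F z ∂μ = ∫ z : ({0}ᶜ : Set E), F z ∂(μ.comap (↑)) := by
      rw [integral_subtype_comap (measurableSet_singleton _).compl F,
        restrict_compl_singleton]
    _ = ∫ y, G y ∂μ.toSphere.prod (.volumeIoiPow (Module.finrank ℝ E - 1)) := by
      rw [← hmp.integral_comp hemb]
      simp_rw [hGF]
    _ = _ := by
      rw [integral_prod _ hGint]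
      refine integral_congr_ae (.of_forall fun ξ => ?_)
      simp only [Measure.volumeIoiPow, ENNReal.ofReal]
      rw [integral_withDensity_eq_integral_smul, integral_subtype_comap measurableSet_Ioi
        fun r : ℝ => Real.toNNReal (r ^ (Module.finrank ℝ E - 1)) • F (r • (ξ : E))]
      · refine setIntegral_congr_fun measurableSet_Ioi fun r hr => ?_
        simp [NNReal.smul_def, Real.coe_toNNReal _ (pow_nonneg (le_of_lt hr) _)]
      · fun_prop

/-- A continuous absolutely homogeneous function, positive away from the origin, dominates a
multiple of the norm. -/
theorem exists_mul_norm_le {E : Type*} [NormedAddCommGroup E] [NormedSpace ℝ E]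
    [FiniteDimensional ℝ E] {N : E → ℝ} (hN : Continuous N)
    (hNsmul : ∀ (c : ℝ) z, N (c • z) = |c| * N z) (hNpos : ∀ z, z ≠ 0 → 0 < N z) :
    ∃ c > 0, ∀ z, c * ‖z‖ ≤ N z := by
  have h0 : N 0 = 0 := by simpa using hNsmul 0 0
  rcases subsingleton_or_nontrivial E with hE | hE
  · exact ⟨1, one_pos, fun z => by simp [Subsingleton.elim z 0, h0]⟩
  obtain ⟨ξ, hξ, hmin⟩ := (isCompact_sphere (0 : E) 1).exists_isMinOn
    (NormedSpace.sphere_nonempty.2 zero_le_one) hN.continuousOn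
  have hξ0 : ξ ≠ 0 := by rintro rfl; simp at hξ
  refine ⟨N ξ, hNpos ξ hξ0, fun z => ?_⟩
  rcases eq_or_ne z 0 with rfl | hz
  · simp [h0]
  have hz' : 0 < ‖z‖ := norm_pos_iff.2 hz
  have h1 : N ξ ≤ N (‖z‖⁻¹ • z) := hmin (by simp [norm_smul, hz'.ne'])
  rw [hNsmul, abs_of_pos (inv_pos.2 hz'), ← div_eq_inv_mul, le_div_iff₀ hz'] at h1
  exact h1

/-- The unit sublevel set of such a function is compact. -/
theorem isCompact_sublevel {E : Type*} [NormedAddCommGroup E] [NormedSpace ℝ E]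
    [FiniteDimensional ℝ E] {N : E → ℝ} (hN : Continuous N)
    (hNsmul : ∀ (c : ℝ) z, N (c • z) = |c| * N z) (hNpos : ∀ z, z ≠ 0 → 0 < N z) :
    IsCompact {z | N z ≤ 1} := by
  obtain ⟨c, hc, hle⟩ := exists_mul_norm_le hN hNsmul hNpos
  refine Metric.isCompact_of_isClosed_isBounded (isClosed_le hN continuous_const)
    ((Metric.isBounded_closedBall (x := (0 : E)) (r := c⁻¹)).subset fun z hz => ?_)
  rw [mem_closedBall_zero_iff, ← one_div, le_div_iff₀' hc]
  exact (hle z).trans hz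

theorem volume_sublevel_pos {E : Type*} [NormedAddCommGroup E] [NormedSpace ℝ E]
    [MeasurableSpace E] (μ : Measure E) [μ.IsOpenPosMeasure] {N : E → ℝ} (hN : Continuous N)
    (hNsmul : ∀ (c : ℝ) z, N (c • z) = |c| * N z) : 0 < μ {z | N z ≤ 1} := by
  have h0 : N 0 = 0 := by simpa using hNsmul 0 0
  refine lt_of_lt_of_le ((isOpen_lt hN continuous_const).measure_pos μ ⟨0, ?_⟩)
    (measure_mono fun z (hz : N z < 1) => hz.le)
  simp [h0]

/-- Moments of the unit sublevel set of an absolutely homogeneous function. -/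
theorem setIntegral_sublevel_abs_inner_rpow {E : Type*} [NormedAddCommGroup E]
    [InnerProductSpace ℝ E] [FiniteDimensional ℝ E] [Nontrivial E] [MeasurableSpace E]
    [BorelSpace E] (μ : Measure E) [μ.IsAddHaarMeasure] {N : E → ℝ} (hN : Continuous N)
    (hNsmul : ∀ (c : ℝ) z, N (c • z) = |c| * N z) (hNpos : ∀ z, z ≠ 0 → 0 < N z)
    {p : ℝ} (hp : 0 ≤ p) (x : E) :
    (Module.finrank ℝ E + p) * ∫ z in {z | N z ≤ 1}, |⟪x, z⟫| ^ p ∂μ =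
      ∫ ξ : Metric.sphere (0 : E) 1,
        N ξ ^ (-(Module.finrank ℝ E : ℝ) - p) * |⟪x, (ξ : E)⟫| ^ p ∂μ.toSphere := by
  have hK := isCompact_sublevel hN hNsmul hNpos
  have hd : 0 < Module.finrank ℝ E := Module.finrank_pos
  have hd' : (0 : ℝ) < Module.finrank ℝ E := by exact_mod_cast hd
  have hcont : Continuous fun z : E => |⟪x, z⟫| ^ p :=
    (continuous_const.inner continuous_id).abs.rpow_const fun _ => Or.inr hp
  have hint : Integrable ({z | N z ≤ 1}.indicator fun z : E => |⟪x, z⟫| ^ p) μ :=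
    (integrable_indicator_iff hK.measurableSet).2 (hcont.continuousOn.integrableOn_compact hK)
  rw [← integral_indicator hK.measurableSet, integral_eq_integral_toSphere μ hint,
    ← integral_const_mul]
  refine integral_congr_ae (.of_forall fun ξ => ?_)
  have hNξ : 0 < N ξ := hNpos ξ (ne_zero_of_mem_unit_sphere ξ)
  have hinner : ∫ r in Ioi (0 : ℝ), r ^ (Module.finrank ℝ E - 1) *
      {z | N z ≤ 1}.indicator (fun z : E => |⟪x, z⟫| ^ p) (r • (ξ : E)) =
      ∫ r in Ioi (0 : ℝ), (Ioc 0 (N ξ)⁻¹).indicator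
        (fun r => r ^ ((Module.finrank ℝ E : ℝ) - 1 + p) * |⟪x, (ξ : E)⟫| ^ p) r := by
    refine setIntegral_congr_fun measurableSet_Ioi fun r (hr : 0 < r) => ?_
    have hiff : r • (ξ : E) ∈ {z | N z ≤ 1} ↔ r ∈ Ioc 0 (N ξ)⁻¹ := by
      simp [hNsmul, abs_of_pos hr, hr, ← one_div, le_div_iff₀ hNξ]
    by_cases h : r ∈ Ioc 0 (N ξ)⁻¹
    · simp only [indicator_of_mem h, indicator_of_mem (hiff.2 h), inner_smul_right, abs_mul,
        abs_of_pos hr, mul_rpow hr.le (abs_nonneg _), rpow_add hr]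
      rw [← Nat.cast_pred hd, rpow_natCast, mul_assoc]
    · simp only [indicator_of_notMem h, indicator_of_notMem (mt hiff.1 h), mul_zero]
  simp only [hinner]
  rw [setIntegral_indicator measurableSet_Ioc, inter_eq_self_of_subset_right Ioc_subset_Ioi_self,
    integral_mul_const, ← intervalIntegral.integral_of_le (inv_pos.2 hNξ).le,
    integral_rpow (Or.inl (by linarith)), zero_rpow (by linarith), inv_rpow hNξ.le,
    ← rpow_neg hNξ.le]
  rw [show -((Module.finrank ℝ E : ℝ) - 1 + p + 1) = -(Module.finrank ℝ E : ℝ) - p by ring,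
    show (Module.finrank ℝ E : ℝ) - 1 + p + 1 = Module.finrank ℝ E + p by ring]
  have hdp : (Module.finrank ℝ E : ℝ) + p ≠ 0 := by linarith
  field_simp
  ring

/-- The `L^p`-centroid functional of a compact set is the support function of a convex body: it
has a supporting linear functional at every point. -/
theorem exists_inner_eq_and_forall_inner_le {E : Type*} [NormedAddCommGroup E]
    [InnerProductSpace ℝ E] [FiniteDimensional ℝ E] [MeasurableSpace E] [BorelSpace E]
    (μ : Measure E) [IsFiniteMeasureOnCompacts μ] {K : Set E} (hK : IsCompact K)
    {p : ℝ} (hp : 1 ≤ p) (x : E) :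
    ∃ v : E, ⟪v, x⟫ = (∫ z in K, |⟪x, z⟫| ^ p ∂μ) ^ p⁻¹ ∧
      ∀ y, ⟪v, y⟫ ≤ (∫ z in K, |⟪y, z⟫| ^ p ∂μ) ^ p⁻¹ := by
  have hp0 : 0 < p := by linarith
  set q : ℝ≥0∞ := ENNReal.ofReal p with hq
  have hq0 : q ≠ 0 := by simpa [hq] using hp0
  have hqr : q.toReal = p := ENNReal.toReal_ofReal hp0.le
  have : Fact (1 ≤ q) := ⟨by simpa [hq] using hp⟩
  have hcont : ∀ y : E, Continuous fun z : E => ⟪y, z⟫ := fun y =>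
    continuous_const.inner continuous_id
  have hmem : ∀ y : E, MemLp (fun z => ⟪y, z⟫) q (μ.restrict K) := by
    intro y
    rw [← integrable_norm_rpow_iff (hcont y).aestronglyMeasurable hq0 ENNReal.ofReal_ne_top, hqr]
    exact (((hcont y).norm.rpow_const fun _ => Or.inr hp0.le).continuousOn).integrableOn_compact hK
  have hnorm : ∀ y : E, ‖(hmem y).toLp _‖ = (∫ z in K, |⟪y, z⟫| ^ p ∂μ) ^ p⁻¹ := by
    intro y
    rw [Lp.norm_toLp, (hmem y).eLpNorm_eq_integral_rpow_norm hq0 ENNReal.ofReal_ne_top, hqr,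
      ENNReal.toReal_ofReal (by positivity)]
    simp [Real.norm_eq_abs]
  let T : E →ₗ[ℝ] Lp ℝ q (μ.restrict K) :=
    { toFun := fun y => (hmem y).toLp _
      map_add' := fun y y' => by
        rw [← MemLp.toLp_add]
        exact MemLp.toLp_congr _ _ (.of_forall fun z => inner_add_left y y' z)
      map_smul' := fun c y => by
        rw [RingHom.id_apply, ← MemLp.toLp_const_smul]
        exact MemLp.toLp_congr _ _ (.of_forall fun z => real_inner_smul_left y z c) }
  obtain ⟨g, hg, hgx⟩ := exists_dual_vector'' ℝ (T x)
  refine ⟨(InnerProductSpace.toDual ℝ E).symm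
    (LinearMap.toContinuousLinearMap (g.toLinearMap ∘ₗ T)), ?_, fun y => ?_⟩
  · rw [InnerProductSpace.toDual_symm_apply, ← hnorm]
    exact hgx
  · rw [InnerProductSpace.toDual_symm_apply, ← hnorm]
    calc g (T y) ≤ ‖g (T y)‖ := le_abs_self _
      _ ≤ ‖g‖ * ‖T y‖ := g.le_opNorm _
      _ ≤ ‖T y‖ := mul_le_of_le_one_left (norm_nonneg _) hg
theorem w_pos {s : ℝ} (hs : 0 ≤ s) : 0 < w s :=
  div_pos (rpow_pos_of_pos pi_pos _) (Gamma_pos_of_pos (by linarith))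

theorem aa_pos (m : ℕ) {p : ℝ} (hp : 1 ≤ p) : 0 < aa m p :=
  div_pos (w_pos (by positivity)) (mul_pos (mul_pos (w_pos (by norm_num)) (w_pos (by positivity)))
    (w_pos (by linarith)))

/-- The support function of the `L_p`-centroid body of a compact set of positive volume. -/
theorem suppFn_centroid_rpow {m : ℕ} {p : ℝ} (hp : 1 ≤ p) {K : Set (EuclideanSpace ℝ (Fin m))}
    (hK : IsCompact K) (x : EuclideanSpace ℝ (Fin m)) :
    suppFn (centroid m p K) x ^ p = (aa m p * vol K)⁻¹ * ∫ z in K, |⟪x, z⟫| ^ p := by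
  have hC : 0 ≤ (aa m p * vol K)⁻¹ :=
    inv_nonneg.2 (mul_nonneg (aa_pos m hp).le ENNReal.toReal_nonneg)
  have hI : ∀ y : EuclideanSpace ℝ (Fin m), 0 ≤ ∫ z in K, |⟪y, z⟫| ^ p := fun y =>
    integral_nonneg fun z => by positivity
  obtain ⟨v, hvx, hv⟩ := exists_inner_eq_and_forall_inner_le volume hK hp x
  have hgreatest : IsGreatest ((fun z => ⟪x, z⟫) '' centroid m p K)
      (((aa m p * vol K)⁻¹ * ∫ z in K, |⟪x, z⟫| ^ p) ^ p⁻¹) := by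
    refine ⟨⟨((aa m p * vol K)⁻¹) ^ p⁻¹ • v, fun y => ?_, ?_⟩, ?_⟩
    · rw [real_inner_smul_left, mul_rpow hC (hI y)]
      exact mul_le_mul_of_nonneg_left (hv y) (rpow_nonneg hC _)
    · simp only [real_inner_smul_right, real_inner_comm v x, hvx, mul_rpow hC (hI x)]
    · rintro _ ⟨z, hz, rfl⟩
      simpa only [real_inner_comm] using hz x
  rw [suppFn, hgreatest.csSup_eq, rpow_inv_rpow (mul_nonneg hC (hI x)) (by linarith)]

theorem continuous_lp_dxi {n : ℕ} {p : ℝ} (hp : 0 < p)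
    {f : ℝ × EuclideanSpace ℝ (Fin (n - 1)) → ℝ} (hf : ContDiff ℝ 1 f)
    (hfc : HasCompactSupport f) : Continuous fun ξ => lp n p (dxi f ξ) := by
  refine Continuous.rpow_const ?_ fun _ => Or.inr (by positivity)
  rw [← continuousOn_univ]
  refine continuousOn_integral_of_compact_support (k := tsupport f) hfc ?_ fun ξ y _ hy => ?_
  · refine Continuous.continuousOn (Continuous.rpow_const ?_ fun _ => Or.inr hp.le)
    exact (((hf.continuous_fderiv one_ne_zero).comp continuous_snd).clm_apply
      (continuous_const.prodMk continuous_fst)).abs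
  · have : fderiv ℝ f y = 0 := by
      by_contra h
      exact hy (support_fderiv_subset ℝ h)
    simp [dxi, this, hp.ne']

theorem lp_dxi_smul {n : ℕ} {p : ℝ} (hp : 0 < p)
    (f : ℝ × EuclideanSpace ℝ (Fin (n - 1)) → ℝ) (c : ℝ)
    (ξ : EuclideanSpace ℝ (Fin (n - 1))) :
    lp n p (dxi f (c • ξ)) = |c| * lp n p (dxi f ξ) := by
  have h : ∀ y, |dxi f (c • ξ) y| ^ p = |c| ^ p * |dxi f ξ y| ^ p := by
    intro y
    rw [← mul_rpow (abs_nonneg _) (abs_nonneg _), ← abs_mul, dxi, dxi, ← smul_eq_mul, ← map_smul,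
      Prod.smul_mk, smul_zero]
  simp only [lp, h]
  rw [integral_const_mul, mul_rpow (by positivity) (integral_nonneg fun _ => by positivity),
    rpow_rpow_inv (abs_nonneg _) hp.ne']

/-- A compactly supported function whose derivative in a nonzero direction vanishes along a line
parallel to it vanishes on that line. -/
theorem eq_zero_of_fderiv_apply_eq_zero {E : Type*} [NormedAddCommGroup E] [NormedSpace ℝ E]
    {f : E → ℝ} (hf : Differentiable ℝ f) (hfc : HasCompactSupport f) {v y : E} (hv : v ≠ 0)
    (h : ∀ s : ℝ, fderiv ℝ f (y + s • v) v = 0) : f y = 0 := by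
  have hderiv : ∀ s : ℝ, HasDerivAt (fun s : ℝ => f (y + s • v)) 0 s := by
    intro s
    have hl : HasDerivAt (fun s : ℝ => y + s • v) v s := by
      simpa using ((hasDerivAt_id s).smul_const v).const_add y
    simpa [h s, Function.comp_def] using (hf (y + s • v)).hasFDerivAt.comp_hasDerivAt s hl
  have hconst := is_const_of_deriv_eq_zero (fun s => (hderiv s).differentiableAt)
    fun s => (hderiv s).deriv
  obtain ⟨R, hR⟩ := hfc.isBounded.subset_closedBall 0
  have hv' : 0 < ‖v‖ := norm_pos_iff.2 hv
  set s : ℝ := (|R| + ‖y‖ + 1) / ‖v‖ with hs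
  have hsv : ‖s • v‖ = |R| + ‖y‖ + 1 := by
    rw [norm_smul, Real.norm_of_nonneg (by positivity), hs, div_mul_cancel₀ _ hv'.ne']
  have hout : f (y + s • v) = 0 := by
    by_contra hne
    have hmem := hR (subset_tsupport f hne)
    rw [mem_closedBall_zero_iff] at hmem
    have htri : ‖s • v‖ ≤ ‖y + s • v‖ + ‖y‖ := by
      simpa using norm_sub_le (y + s • v) y
    linarith [le_abs_self R]
  simpa [hout] using hconst 0 s

theorem lp_dxi_pos {n : ℕ} {p : ℝ} (hp : 0 < p)
    {f : ℝ × EuclideanSpace ℝ (Fin (n - 1)) → ℝ} (hf : ContDiff ℝ 1 f)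
    (hfc : HasCompactSupport f) (hf0 : ∃ y ∈ H n, f y ≠ 0)
    {ξ : EuclideanSpace ℝ (Fin (n - 1))} (hξ : ξ ≠ 0) : 0 < lp n p (dxi f ξ) := by
  obtain ⟨y, hy, hfy⟩ := hf0
  have hHo : IsOpen (H n) := isOpen_lt continuous_const continuous_fst
  have hcont : Continuous fun y => dxi f ξ y :=
    (hf.continuous_fderiv one_ne_zero).clm_apply continuous_const
  have hcont' : Continuous fun y => |dxi f ξ y| ^ p :=
    hcont.abs.rpow_const fun _ => Or.inr hp.le
  have hcs : HasCompactSupport fun y => |dxi f ξ y| ^ p := by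
    refine (hfc.fderiv (𝕜 := ℝ)).comp_left
      (g := fun L : (ℝ × EuclideanSpace ℝ (Fin (n - 1))) →L[ℝ] ℝ => |L (0, ξ)| ^ p) ?_
    simp [hp.ne']
  have hnn : 0 ≤ ∫ y in H n, |dxi f ξ y| ^ p := integral_nonneg fun _ => by positivity
  refine rpow_pos_of_pos (hnn.lt_of_ne' fun h0 => hfy ?_) _
  rw [integral_eq_zero_iff_of_nonneg (fun _ => by positivity)
    (hcont'.integrable_of_hasCompactSupport hcs).integrableOn] at h0
  have hzero : EqOn (fun y => |dxi f ξ y| ^ p) 0 (H n) :=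
    Measure.eqOn_open_of_ae_eq h0 hHo hcont'.continuousOn continuousOn_const
  refine eq_zero_of_fderiv_apply_eq_zero (v := (0, ξ)) (hf.differentiable one_ne_zero) hfc
    (by simpa using hξ) fun s => ?_
  have := hzero (x := y + s • (0, ξ)) (by simpa [H] using hy)
  simpa [dxi, rpow_eq_zero (abs_nonneg _) hp.ne'] using this

/-- The support function of the `L_p`-centroid body of `L_f` satisfies
`(n+p-1) a_{n-1,p} vol(L_f) h_{Γ_p L_f}(x)^p = D_f^*(x)` for all `x ∈ ℝ^{n-1}`. -/
theorem support_function_centroid_Lf (n : ℕ) (hn : 3 ≤ n) (p : ℝ) (hp : 1 < p) (hpn : p < n)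
    (f : ℝ × EuclideanSpace ℝ (Fin (n - 1)) → ℝ) (hf : ContDiff ℝ (⊤ : ℕ∞) f)
    (hfc : HasCompactSupport f) (hf0 : ∃ y ∈ H n, f y ≠ 0) :
    ∀ x : EuclideanSpace ℝ (Fin (n - 1)),
      ((n : ℝ) + p - 1) * aa (n - 1) p * vol (Lbody n p f) *
          suppFn (centroid (n - 1) p (Lbody n p f)) x ^ p =
        Dstar n p f x := by
  intro x
  have hp0 : 0 < p := by linarith
  have hf1 : ContDiff ℝ 1 f := hf.of_le (by exact_mod_cast le_top)
  have hN := continuous_lp_dxi (n := n) hp0 hf1 hfc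
  have hNsmul := lp_dxi_smul (n := n) hp0 f
  have hNpos : ∀ ξ, ξ ≠ 0 → 0 < lp n p (dxi f ξ) := fun _ => lp_dxi_pos hp0 hf1 hfc hf0
  have hK : IsCompact (Lbody n p f) := isCompact_sublevel hN hNsmul hNpos
  have hvol : vol (Lbody n p f) ≠ 0 :=
    (ENNReal.toReal_pos (volume_sublevel_pos volume hN hNsmul).ne' hK.measure_lt_top.ne).ne'
  have : NeZero (n - 1) := ⟨by omega⟩
  have hmoment := setIntegral_sublevel_abs_inner_rpow volume hN hNsmul hNpos hp0.le x
  rw [finrank_euclideanSpace_fin, Nat.cast_pred (by omega : 0 < n),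
    show -((n : ℝ) - 1) - p = 1 - n - p by ring] at hmoment
  rw [suppFn_centroid_rpow hp.le hK, Dstar, sphMeasure, ← hmoment, Lbody]
  have haa := (aa_pos (n - 1) hp.le).ne'
  rw [Lbody] at hvol
  field_simp
  ring

end AffineTrace
end
end
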